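/- Let m = p + q and let X_1, ..., X_p be complex analytic vector fields and F_1, ..., F_q complex analytic functions on an open neighborhood U of 0 in ℂ^m such that: [X_i, X_j] = 0 for all i, j; DF_j(x)(X_i(x)) = 0 for all i, j and x ∈ U; the vectors X_1(x), ..., X_p(x) are linearly independent for x in a dense subset of U; and the differentials DF_1(x), ..., DF_q(x) are linearly independent for x in a dense subset of U. Assume 0 is a nondegenerate fixed point, i.e.: X_i(0) = 0 for all i; each matrix A_i := DX_i(0) is semisimple; the vectors A_1 x, ..., A_p x are linearly independent for x in a dense subset of ℂ^m; and, denoting for each j by G_j the lowest-degree nonzero homogeneous term of the Taylor expansion of F_j at 0, the differentials DG_1(x), ..., DG_q(x) are linearly independent for x in a dense subset of ℂ^m. Then there exist an open neighborhood V ⊆ U of 0, an analytic diffeomorphism φ from V onto an open neighborhood W of 0 in ℂ^m with φ(0) = 0, and analytic functions f_{ij} (1 ≤ i, j ≤ p) on W with det(f_{ij}(y)) ≠ 0 for every y ∈ W, such that Df_{ij}(y)(A_k y) = 0 for all i, j, k and all y ∈ W, and such that Dφ(x)(X_i(x)) = Σ_{j=1}^p f_{ij}(φ(x)) · A_j φ(x)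 for every x ∈ V and every i = 1, ..., p. -/

import Mathlib

open scoped BigOperators

/-- A complex square matrix is semisimple iff it is diagonalizable (over ℂ). -/
def IsSemisimpleMatrixC {m : ℕ} (A : Matrix (Fin m) (Fin m) ℂ) : Prop :=
  ∃ P : Matrix (Fin m) (Fin m) ℂ, IsUnit P ∧ ∃ d : Fin m → ℂ,
    A = P * Matrix.diagonal d * P⁻¹

namespace GeomLin

/-- The `ℓ¹` algebra of power series in `m` variables. -/
def WA (m : ℕ) : Type := lp (fun _ : (Fin m →₀ ℕ) => ℂ) 1

noncomputable section

namespace WA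

variable {m : ℕ}

instance : NormedAddCommGroup (WA m) :=
  inferInstanceAs (NormedAddCommGroup (lp (fun _ : (Fin m →₀ ℕ) => ℂ) 1))
instance : NormedSpace ℂ (WA m) :=
  inferInstanceAs (NormedSpace ℂ (lp (fun _ : (Fin m →₀ ℕ) => ℂ) 1))
instance : CompleteSpace (WA m) :=
  inferInstanceAs (CompleteSpace (lp (fun _ : (Fin m →₀ ℕ) => ℂ) 1))

/-- coefficients -/
def cf (a : WA m) : (Fin m →₀ ℕ) → ℂ := (show lp (fun _ : (Fin m →₀ ℕ) => ℂ) 1 from a).1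

theorem ext' {a b : WA m} (h : ∀ α, a.cf α = b.cf α) : a = b := by
  apply Subtype.ext
  funext α
  exact h α

@[simp] theorem cf_add (a b : WA m) (α) : (a + b).cf α = a.cf α + b.cf α := rfl
@[simp] theorem cf_neg (a : WA m) (α) : (-a).cf α = -a.cf α := rfl
@[simp] theorem cf_sub (a b : WA m) (α) : (a - b).cf α = a.cf α - b.cf α := rfl
@[simp] theorem cf_zero (α) : (0 : WA m).cf α = 0 := rfl
@[simp] theorem cf_smul (c : ℂ) (a : WA m) (α) : (c • a).cf α = c * a.cf α := rfl

theorem summable_cf (a : WA m) : Summable fun α => ‖a.cf α‖ := by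
  have h := (memℓp_gen_iff (p := 1) (by simp)).1 (show lp (fun _ : (Fin m →₀ ℕ) => ℂ) 1 from a).2
  simp at h; exact h

theorem norm_eq (a : WA m) : ‖a‖ = ∑' α, ‖a.cf α‖ := by
  have h := lp.norm_eq_tsum_rpow (p := 1) (by simp) (show lp (fun _ : (Fin m →₀ ℕ) => ℂ) 1 from a)
  simp at h; exact h

/-- build an element from a summable family -/
def mk (f : (Fin m →₀ ℕ) → ℂ) (hf : Summable fun α => ‖f α‖) : WA m :=
  (⟨f, by
    show Memℓp f 1
    rw [memℓp_gen_iff (by simp)]; simpa using hf⟩ : lp (fun _ : (Fin m →₀ ℕ) => ℂ) 1)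

@[simp] theorem cf_mk (f : (Fin m →₀ ℕ) → ℂ) (hf) (α) : (mk f hf).cf α = f α := rfl

/-- formal power series -/
def toPS (a : WA m) : MvPowerSeries (Fin m) ℂ := a.cf

theorem toPS_inj {a b : WA m} (h : a.toPS = b.toPS) : a = b := ext' fun α => congrFun h α

theorem summable_prod (a b : WA m) :
    Summable fun x : (Fin m →₀ ℕ) × (Fin m →₀ ℕ) => ‖a.cf x.1‖ * ‖b.cf x.2‖ :=
  a.summable_cf.mul_of_nonneg b.summable_cf (fun _ => norm_nonneg _) (fun _ => norm_nonneg _)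

theorem summable_conv' (a b : WA m) : Summable fun α : Fin m →₀ ℕ =>
    ∑ x ∈ Finset.HasAntidiagonal.antidiagonal α, ‖a.cf x.1‖ * ‖b.cf x.2‖ :=
  summable_sum_mul_antidiagonal_of_summable_mul (f := fun α => ‖a.cf α‖) (g := fun α => ‖b.cf α‖)
    (summable_prod a b)

theorem norm_conv_le (a b : WA m) (α : Fin m →₀ ℕ) :
    ‖∑ x ∈ Finset.HasAntidiagonal.antidiagonal α, a.cf x.1 * b.cf x.2‖ ≤
      ∑ x ∈ Finset.HasAntidiagonal.antidiagonal α, ‖a.cf x.1‖ * ‖b.cf x.2‖ :=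
  (norm_sum_le _ _).trans (le_of_eq (by simp))

theorem summable_conv (a b : WA m) : Summable fun α : Fin m →₀ ℕ =>
    ‖∑ x ∈ Finset.HasAntidiagonal.antidiagonal α, a.cf x.1 * b.cf x.2‖ :=
  (summable_conv' a b).of_nonneg_of_le (fun _ => norm_nonneg _) (norm_conv_le a b)

instance : Mul (WA m) := ⟨fun a b => mk _ (summable_conv a b)⟩

theorem cf_mul (a b : WA m) (α) :
    (a * b).cf α = ∑ x ∈ Finset.HasAntidiagonal.antidiagonal α, a.cf x.1 * b.cf x.2 := rfl

theorem toPS_mul (a b : WA m) : (a * b).toPS = a.toPS * b.toPS := by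
  ext α
  rw [MvPowerSeries.coeff_mul]
  rfl

/-- monomial with coefficient one -/
def mono (β : Fin m →₀ ℕ) : WA m :=
  mk (fun α => if α = β then 1 else 0) (summable_of_ne_finset_zero (s := {β}) (by
    intro b hb
    simp at hb
    simp [hb]))

theorem cf_mono (β α : Fin m →₀ ℕ) : (mono β).cf α = if α = β then 1 else 0 := rfl

theorem norm_mono (β : Fin m →₀ ℕ) : ‖mono β‖ = 1 := by
  rw [norm_eq, tsum_eq_single β]
  · simp [cf_mono]
  · intro b hb; simp [cf_mono, hb]

instance : One (WA m) := ⟨mono 0⟩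

theorem cf_one (α : Fin m →₀ ℕ) : (1 : WA m).cf α = if α = 0 then 1 else 0 := rfl

theorem toPS_one : (1 : WA m).toPS = 1 := by
  ext α
  rw [MvPowerSeries.coeff_one]
  rfl

theorem toPS_add (a b : WA m) : (a + b).toPS = a.toPS + b.toPS := rfl
theorem toPS_zero : (0 : WA m).toPS = 0 := rfl

instance : NormedCommRing (WA m) :=
  { (inferInstance : NormedAddCommGroup (WA m)) with
    mul := (· * ·)
    one := 1
    left_distrib := fun a b c => toPS_inj (by simp only [toPS_mul, toPS_add, mul_add])
    right_distrib := fun a b c => toPS_inj (by simp only [toPS_mul, toPS_add, add_mul])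
    zero_mul := fun a => toPS_inj (by simp only [toPS_mul, toPS_zero, zero_mul])
    mul_zero := fun a => toPS_inj (by simp only [toPS_mul, toPS_zero, mul_zero])
    mul_assoc := fun a b c => toPS_inj (by simp only [toPS_mul, mul_assoc])
    one_mul := fun a => toPS_inj (by simp only [toPS_mul, toPS_one, one_mul])
    mul_one := fun a => toPS_inj (by simp only [toPS_mul, toPS_one, mul_one])
    mul_comm := fun a b => toPS_inj (by simp only [toPS_mul, mul_comm])
    norm_mul_le := fun a b => by
      rw [norm_eq (a * b), norm_eq a, norm_eq b,
        Summable.tsum_mul_tsum_eq_tsum_sum_antidiagonal a.summable_cf b.summable_cf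
          (summable_prod a b)]
      exact (summable_conv a b).tsum_le_tsum (norm_conv_le a b) (summable_conv' a b) }

instance : NormOneClass (WA m) := ⟨norm_mono 0⟩

instance : NormedAlgebra ℂ (WA m) :=
  { Algebra.ofModule (R := ℂ) (A := WA m)
      (fun r a b => ext' fun α => by
        simp only [cf_mul, cf_smul, Finset.mul_sum, mul_assoc])
      (fun r a b => ext' fun α => by
        simp only [cf_mul, cf_smul, Finset.mul_sum]
        exact Finset.sum_congr rfl fun x _ => by ring) with
    norm_smul_le := fun r a => (norm_smul_le r a) }

/-- evaluation of a monomial -/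
def mon (y : Fin m → ℂ) (α : Fin m →₀ ℕ) : ℂ := ∏ i, y i ^ α i

theorem mon_add (y : Fin m → ℂ) (α β) : mon y (α + β) = mon y α * mon y β := by
  simp [mon, pow_add, Finset.prod_mul_distrib]

@[simp] theorem mon_zero (y : Fin m → ℂ) : mon y 0 = 1 := by simp [mon]

theorem mon_single (y : Fin m → ℂ) (k) : mon y (Finsupp.single k 1) = y k := by
  rw [mon, Finset.prod_eq_single k]
  · simp
  · intro b _ hb; simp [Finsupp.single_apply, hb.symm]
  · simp

theorem degree_eq (α : Fin m →₀ ℕ) : α.degree = ∑ i, α i := by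
  rw [Finsupp.degree_apply]
  exact Finset.sum_subset (Finset.subset_univ _) (by simp)

theorem norm_mon_le (y : Fin m → ℂ) (r : ℝ) (hy : ∀ i, ‖y i‖ ≤ r) (α) :
    ‖mon y α‖ ≤ r ^ α.degree := by
  rw [mon, norm_prod, degree_eq, ← Finset.prod_pow_eq_pow_sum]
  refine Finset.prod_le_prod (fun _ _ => norm_nonneg _) fun i _ => ?_
  rw [norm_pow]
  exact pow_le_pow_left₀ (norm_nonneg _) (hy i) _

theorem mon_smul (c : ℂ) (y : Fin m → ℂ) (α) : mon (c • y) α = c ^ α.degree * mon y α := by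
  simp [mon, degree_eq, mul_pow, Finset.prod_mul_distrib, Finset.prod_pow_eq_pow_sum]

theorem norm_mon_le_one (y : Fin m → ℂ) (hy : ‖y‖ ≤ 1) (α) : ‖mon y α‖ ≤ 1 := by
  simpa using norm_mon_le y 1 (fun i => (norm_le_pi_norm y i).trans hy) α

theorem norm_term_le (y : Fin m → ℂ) (hy : ‖y‖ ≤ 1) (a : WA m) (α) :
    ‖a.cf α * mon y α‖ ≤ ‖a.cf α‖ := by
  rw [norm_mul]
  exact mul_le_of_le_one_right (norm_nonneg _) (norm_mon_le_one y hy α)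

theorem summable_term (y : Fin m → ℂ) (hy : ‖y‖ ≤ 1) (a : WA m) :
    Summable fun α => ‖a.cf α * mon y α‖ :=
  a.summable_cf.of_nonneg_of_le (fun _ => norm_nonneg _) (norm_term_le y hy a)

/-- evaluation at a point of the closed unit polydisc, a continuous linear map -/
def ev (y : Fin m → ℂ) (hy : ‖y‖ ≤ 1) : WA m →L[ℂ] ℂ :=
  LinearMap.mkContinuous
    { toFun := fun a => ∑' α, a.cf α * mon y α
      map_add' := fun a b => by
        simp only [cf_add, add_mul]
        exact (summable_term y hy a).of_norm.tsum_add (summable_term y hy b).of_norm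
      map_smul' := fun c a => by
        simp only [cf_smul, mul_assoc, tsum_mul_left, RingHom.id_apply, smul_eq_mul] } 1 (by
    intro a
    rw [one_mul, norm_eq]
    exact (norm_tsum_le_tsum_norm (summable_term y hy a)).trans
      ((summable_term y hy a).tsum_le_tsum (norm_term_le y hy a) a.summable_cf))

theorem ev_apply (y : Fin m → ℂ) (hy : ‖y‖ ≤ 1) (a : WA m) :
    ev y hy a = ∑' α, a.cf α * mon y α := rfl

theorem ev_mono (y : Fin m → ℂ) (hy : ‖y‖ ≤ 1) (β) : ev y hy (mono β) = mon y β := by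
  rw [ev_apply, tsum_eq_single β]
  · simp [cf_mono]
  · intro b hb; simp [cf_mono, hb]

theorem ev_one (y : Fin m → ℂ) (hy : ‖y‖ ≤ 1) : ev y hy 1 = 1 := by
  have := ev_mono y hy 0
  rw [mon_zero] at this
  exact this

theorem ev_mul (y : Fin m → ℂ) (hy : ‖y‖ ≤ 1) (a b : WA m) :
    ev y hy (a * b) = ev y hy a * ev y hy b := by
  simp only [ev_apply]
  rw [Summable.tsum_mul_tsum_eq_tsum_sum_antidiagonal (summable_term y hy a).of_norm
    (summable_term y hy b).of_norm
    ((summable_term y hy a).mul_norm (summable_term y hy b)).of_norm]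
  congr 1; funext α
  rw [cf_mul, Finset.sum_mul]
  refine Finset.sum_congr rfl fun x hx => ?_
  rw [Finset.HasAntidiagonal.mem_antidiagonal] at hx
  rw [← hx, mon_add]; ring

/-- evaluation as an algebra homomorphism -/
def evHom (y : Fin m → ℂ) (hy : ‖y‖ ≤ 1) : WA m →+* ℂ :=
  { toFun := ev y hy
    map_one' := ev_one y hy
    map_mul' := ev_mul y hy
    map_zero' := map_zero _
    map_add' := map_add _ }

/-- multiplication of the coefficients by a bounded family -/
def mult (c : (Fin m →₀ ℕ) → ℂ) (C : ℝ) (hc : ∀ α, ‖c α‖ ≤ C) : WA m →L[ℂ] WA m :=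
  LinearMap.mkContinuous
    { toFun := fun a => mk (fun α => c α * a.cf α)
        ((a.summable_cf.mul_left C).of_nonneg_of_le (fun _ => norm_nonneg _) (fun α => by
          rw [norm_mul]; exact mul_le_mul_of_nonneg_right (hc α) (norm_nonneg _)))
      map_add' := fun a b => ext' fun α => by simp [mul_add]
      map_smul' := fun r a => ext' fun α => by simp; ring } C (by
    intro a
    rw [norm_eq, norm_eq, ← tsum_mul_left]
    refine Summable.tsum_le_tsum (fun α => ?_) (summable_cf _) (a.summable_cf.mul_left C)
    show ‖c α * a.cf α‖ ≤ _
    rw [norm_mul]; exact mul_le_mul_of_nonneg_right (hc α) (norm_nonneg _))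

@[simp] theorem cf_mult (c : (Fin m →₀ ℕ) → ℂ) (C : ℝ) (hc) (a : WA m) (α) :
    (mult c C hc a).cf α = c α * a.cf α := rfl

theorem inj_shift (k : Fin m) : Function.Injective fun β : Fin m →₀ ℕ => β + Finsupp.single k 1 :=
  fun _ _ h => add_right_cancel h

/-- shift of the coefficients -/
def shift (k : Fin m) : WA m →L[ℂ] WA m :=
  LinearMap.mkContinuous
    { toFun := fun a => mk (fun β => a.cf (β + Finsupp.single k 1))
        (a.summable_cf.comp_injective (inj_shift k))
      map_add' := fun a b => ext' fun α => by simp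
      map_smul' := fun r a => ext' fun α => by simp } 1 (by
    intro a
    rw [norm_eq, norm_eq, one_mul]
    exact tsum_comp_le_tsum_of_inj a.summable_cf (fun _ => norm_nonneg _) (inj_shift k))

@[simp] theorem cf_shift (k : Fin m) (a : WA m) (β) :
    (shift k a).cf β = a.cf (β + Finsupp.single k 1) := rfl

theorem cf_finset_sum {ι : Type*} (s : Finset ι) (a : ι → WA m) (α) :
    (∑ i ∈ s, a i).cf α = ∑ i ∈ s, (a i).cf α := by
  classical
  induction s using Finset.induction_on with
  | empty => simp
  | insert i s hi ih => rw [Finset.sum_insert hi, Finset.sum_insert hi, cf_add, ih]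

end WA
end
end GeomLin

namespace GeomLin
noncomputable section
open WA Filter Topology

variable {m n : ℕ}

theorem norm_ev_le (y : Fin m → ℂ) (hy : ‖y‖ ≤ 1) (a : WA m) : ‖ev y hy a‖ ≤ ‖a‖ := by
  have h : ‖ev y hy‖ ≤ 1 := LinearMap.mkContinuous_norm_le _ zero_le_one _
  simpa using (ev y hy).le_of_opNorm_le h a

/-- extension of a formal multilinear series on `ℂ^m` to the algebra `WA n` -/
def extSeries (n : ℕ) (p : FormalMultilinearSeries ℂ (Fin m → ℂ) ℂ) :
    FormalMultilinearSeries ℂ (Fin m → WA n) (WA n) := fun l =>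
  ∑ f : Fin l → Fin m, p l (fun i => Pi.single (f i) 1) •
    (ContinuousMultilinearMap.mkPiAlgebraFin ℂ l (WA n)).compContinuousLinearMap
      (fun i => ContinuousLinearMap.proj (R := ℂ) (φ := fun _ : Fin m => WA n) (f i))

theorem norm_proj_le' (k : Fin m) :
    ‖ContinuousLinearMap.proj (R := ℂ) (φ := fun _ : Fin m => WA n) k‖ ≤ 1 :=
  ContinuousLinearMap.opNorm_le_bound _ zero_le_one fun x => by
    simpa using norm_le_pi_norm x k

theorem norm_extSeries_le (p : FormalMultilinearSeries ℂ (Fin m → ℂ) ℂ) (l : ℕ) :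
    ‖extSeries n p l‖ ≤ (m : ℝ) ^ l * ‖p l‖ := by
  have h1 : ∀ f : Fin l → Fin m, ‖p l (fun i => Pi.single (f i) 1) •
    (ContinuousMultilinearMap.mkPiAlgebraFin ℂ l (WA n)).compContinuousLinearMap
      (fun i => ContinuousLinearMap.proj (R := ℂ) (φ := fun _ : Fin m => WA n) (f i))‖ ≤ ‖p l‖ := by
    intro f
    rw [norm_smul]
    have ha : ‖p l (fun i => Pi.single (f i) (1 : ℂ))‖ ≤ ‖p l‖ := by
      refine ((p l).le_opNorm _).trans ?_
      refine mul_le_of_le_one_right (norm_nonneg _) (Finset.prod_le_one (fun _ _ => norm_nonneg _) ?_)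
      intro i _
      rw [Pi.norm_single]; simp
    have hb : ‖(ContinuousMultilinearMap.mkPiAlgebraFin ℂ l (WA n)).compContinuousLinearMap
      (fun i => ContinuousLinearMap.proj (R := ℂ) (φ := fun _ : Fin m => WA n) (f i))‖ ≤ 1 := by
      refine (ContinuousMultilinearMap.norm_compContinuousLinearMap_le _ _).trans ?_
      rw [ContinuousMultilinearMap.norm_mkPiAlgebraFin, one_mul]
      exact Finset.prod_le_one (fun _ _ => norm_nonneg _) fun i _ => norm_proj_le' _
    calc _ ≤ ‖p l‖ * 1 := mul_le_mul ha hb (norm_nonneg _) (norm_nonneg _)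
      _ = _ := mul_one _
  refine (norm_sum_le _ _).trans ((Finset.sum_le_sum fun f _ => h1 f).trans ?_)
  simp

theorem ev_extSeries (p : FormalMultilinearSeries ℂ (Fin m → ℂ) ℂ) (l : ℕ) (ψ : Fin m → WA n)
    (y : Fin n → ℂ) (hy : ‖y‖ ≤ 1) :
    ev y hy (extSeries n p l (fun _ => ψ)) = p l (fun _ => fun k => ev y hy (ψ k)) := by
  have h2 : (fun k => ev y hy (ψ k)) = ∑ k, ev y hy (ψ k) • (Pi.single k (1 : ℂ) : Fin m → ℂ) := by
    funext j
    simp [Finset.sum_apply, Pi.single_apply]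
  rw [h2]
  have h3 := (p l).toMultilinearMap.map_sum
    (fun (_ : Fin l) (k : Fin m) => ev y hy (ψ k) • (Pi.single k (1 : ℂ) : Fin m → ℂ))
  have h4 : p l (fun _ => ∑ k, ev y hy (ψ k) • (Pi.single k (1 : ℂ) : Fin m → ℂ)) =
    ∑ r : Fin l → Fin m, p l (fun i => ev y hy (ψ (r i)) • (Pi.single (r i) (1 : ℂ) : Fin m → ℂ)) := h3
  rw [h4, extSeries, sum_apply, map_sum]
  refine Finset.sum_congr rfl fun f _ => ?_
  rw [ContinuousMultilinearMap.map_smul_univ]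
  simp only [smul_apply, map_smul,
    ContinuousMultilinearMap.compContinuousLinearMap_apply,
    ContinuousMultilinearMap.mkPiAlgebraFin_apply, ContinuousLinearMap.proj_apply, smul_eq_mul]
  rw [mul_comm]
  congr 1
  have := map_list_prod (evHom y hy) (List.ofFn fun i => ψ (f i))
  rw [List.map_ofFn] at this
  refine (show ev y hy _ = _ from this).trans ?_
  rw [List.prod_ofFn]
  rfl

theorem functional_calculus (n : ℕ) (u : (Fin m → ℂ) → ℂ) (hu : AnalyticAt ℂ u 0) :
    ∃ U : (Fin m → WA n) → WA n,
      HasStrictFDerivAt U (∑ k, fderiv ℂ u 0 (Pi.single k 1) •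
        ContinuousLinearMap.proj (R := ℂ) (φ := fun _ : Fin m => WA n) k) 0 ∧
      U 0 = u 0 • 1 ∧
      ∃ ρ : ℝ, 0 < ρ ∧ ∀ ψ : Fin m → WA n, ‖ψ‖ < ρ → ∀ y hy,
        ev y hy (U ψ) = u (fun k => ev y hy (ψ k)) := by
  obtain ⟨p, hp⟩ := hu
  obtain ⟨r, hr⟩ := id hp
  have hrad : 0 < p.radius := hp.radius_pos
  obtain ⟨s, hs0, hs⟩ := ENNReal.lt_iff_exists_nnreal_btwn.1 hrad
  obtain ⟨C, hC0, hC⟩ := p.norm_mul_pow_le_of_lt_radius hs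
  have hs0' : (0 : NNReal) < s := by exact_mod_cast hs0
  set s' : NNReal := s / (m + 1) with hs'
  have hs'0 : 0 < s' := by positivity
  have hle : (s' : ENNReal) ≤ (extSeries n p).radius := by
    apply FormalMultilinearSeries.le_radius_of_bound _ C
    intro l
    calc ‖extSeries n p l‖ * (s' : ℝ) ^ l ≤ ((m : ℝ) ^ l * ‖p l‖) * (s' : ℝ) ^ l :=
          mul_le_mul_of_nonneg_right (norm_extSeries_le p l) (by positivity)
      _ = (‖p l‖ * (s : ℝ) ^ l) * ((m : ℝ) / (m + 1)) ^ l := by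
          rw [hs']; push_cast; rw [div_pow, div_pow]; ring
      _ ≤ C * 1 := by
          refine mul_le_mul (hC l) (pow_le_one₀ (by positivity) ?_) (by positivity) hC0.le
          rw [div_le_one (by positivity)]; linarith
      _ = C := mul_one _
  have hpos : 0 < (extSeries n p).radius := lt_of_lt_of_le (by exact_mod_cast hs'0) hle
  have hP := (extSeries n p).hasFPowerSeriesOnBall hpos
  refine ⟨(extSeries n p).sum, ?_, ?_, ?_⟩
  · have h := hP.hasFPowerSeriesAt.hasStrictFDerivAt
    refine h.congr_fderiv ?_
    symm
    ext1 v
    rw [continuousMultilinearCurryFin1_apply, extSeries, hp.hasStrictFDerivAt.hasFDerivAt.fderiv]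
    simp only [sum_apply,
      smul_apply,
      ContinuousMultilinearMap.compContinuousLinearMap_apply,
      ContinuousMultilinearMap.mkPiAlgebraFin_apply, ContinuousLinearMap.proj_apply]
    refine Fintype.sum_equiv (Equiv.funUnique (Fin 1) (Fin m)).symm _ _ fun k => ?_
    rw [continuousMultilinearCurryFin1_apply]
    simp
    congr 2
    funext i
    fin_cases i
    simp
  · have h := hP.coeff_zero (fun _ => 0)
    have h' := hr.coeff_zero (fun _ => 0)
    rw [← h, ← h', extSeries]
    simp
    congr 2
    funext i
    exact i.elim0
  · obtain ⟨t, ht0, ht⟩ := ENNReal.lt_iff_exists_nnreal_btwn.1 hr.r_pos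
    refine ⟨min s' t, lt_min (by exact_mod_cast hs'0) (by exact_mod_cast ht0), ?_⟩
    intro ψ hψ y hy
    have h1 : HasSum (fun l => extSeries n p l fun _ => ψ) ((extSeries n p).sum ψ) := by
      have := hP.hasSum (y := ψ) (by
        rw [mem_eball_zero_iff]
        refine lt_of_lt_of_le ?_ hle
        have h5 : ‖ψ‖ < s' := hψ.trans_le (min_le_left _ _)
        rw [enorm_lt_coe]
        exact_mod_cast h5)
      simpa using this
    have h2 := h1.mapL (ev y hy)
    simp only [ev_extSeries] at h2
    have h3 := hr.hasSum (y := fun k => ev y hy (ψ k)) (by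
      rw [mem_eball_zero_iff]
      refine lt_trans ?_ ht
      rw [enorm_lt_coe]
      have h5 : ‖ψ‖ < t := hψ.trans_le (min_le_right _ _)
      have h6 : ‖fun k => ev y hy (ψ k)‖ ≤ ‖ψ‖ :=
        (pi_norm_le_iff_of_nonneg (norm_nonneg _)).2 fun k =>
          (norm_ev_le y hy _).trans (norm_le_pi_norm ψ k)
      exact_mod_cast h6.trans_lt h5)
    rw [zero_add] at h3
    exact h2.unique h3

end
end GeomLin

namespace GeomLin
noncomputable section
open WA Filter Topology

variable {m n : ℕ}

/-- `u` is the sum, near `0`, of the power series `a` -/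
def Rep (a : MvPowerSeries (Fin m) ℂ) (u : (Fin m → ℂ) → ℂ) : Prop :=
  ∃ r : ℝ, 0 < r ∧ ∃ w : WA m, (∀ α, w.cf α = MvPowerSeries.coeff α a * (r : ℂ) ^ α.degree) ∧
    ∀ y (hy : ‖y‖ ≤ 1), u ((r : ℂ) • y) = ev y hy w

theorem ev_scale (w w' : WA m) (s : ℂ) (hs : ‖s‖ ≤ 1) (h : ∀ α, w'.cf α = w.cf α * s ^ α.degree)
    (y) (hy : ‖y‖ ≤ 1) (hy' : ‖s • y‖ ≤ 1) : ev y hy w' = ev (s • y) hy' w := by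
  rw [ev_apply, ev_apply]
  congr 1; funext α
  rw [h, mon_smul]; ring

theorem Rep.shrink {a : MvPowerSeries (Fin m) ℂ} {u : (Fin m → ℂ) → ℂ} (h : Rep a u) :
    ∃ r : ℝ, 0 < r ∧ ∀ r' : ℝ, 0 < r' → r' ≤ r → ∃ w : WA m,
      (∀ α, w.cf α = MvPowerSeries.coeff α a * (r' : ℂ) ^ α.degree) ∧
      ∀ y (hy : ‖y‖ ≤ 1), u ((r' : ℂ) • y) = ev y hy w := by
  obtain ⟨r, hr, w, hw, hu⟩ := h
  refine ⟨r, hr, fun r' hr' hle => ?_⟩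
  have hq : ‖((r' / r : ℝ) : ℂ)‖ ≤ 1 := by
    rw [Complex.norm_real, Real.norm_of_nonneg (by positivity)]
    exact (div_le_one hr).2 hle
  have hrc : (r : ℂ) ≠ 0 := by exact_mod_cast hr.ne'
  refine ⟨mult (fun α => ((r' / r : ℝ) : ℂ) ^ α.degree) 1 (fun α => by
    rw [norm_pow]; exact pow_le_one₀ (norm_nonneg _) hq) w, ?_, ?_⟩
  · intro α
    rw [cf_mult, hw]
    push_cast
    rw [div_pow]
    field_simp
  · intro y hy
    have hy' : ‖((r' / r : ℝ) : ℂ) • y‖ ≤ 1 := by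
      rw [norm_smul]; exact mul_le_one₀ hq (norm_nonneg _) hy
    rw [ev_scale w _ _ hq (fun α => by rw [cf_mult, mul_comm]) y hy hy', ← hu, smul_smul]
    congr 2
    push_cast
    field_simp

theorem Rep.unfold {a : MvPowerSeries (Fin m) ℂ} {u : (Fin m → ℂ) → ℂ} (h : Rep a u) :
    ∃ r : ℝ, 0 < r ∧ (Summable fun α => ‖MvPowerSeries.coeff α a‖ * r ^ α.degree) ∧
      ∀ z, ‖z‖ ≤ r → u z = ∑' α, MvPowerSeries.coeff α a * mon z α := by
  obtain ⟨r, hr, w, hw, hu⟩ := h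
  have hrc : (r : ℂ) ≠ 0 := by exact_mod_cast hr.ne'
  refine ⟨r, hr, ?_, ?_⟩
  · have := w.summable_cf
    simp only [hw, norm_mul, norm_pow, Complex.norm_real, Real.norm_of_nonneg hr.le] at this
    exact this
  · intro z hz
    have hy : ‖(r : ℂ)⁻¹ • z‖ ≤ 1 := by
      rw [norm_smul, norm_inv, Complex.norm_real, Real.norm_of_nonneg hr.le]
      rw [inv_mul_le_iff₀ hr]; simpa using hz
    have := hu _ hy
    rw [smul_smul, mul_inv_cancel₀ hrc, one_smul] at this
    rw [this, ev_apply]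
    congr 1; funext α
    rw [hw, mon_smul, inv_pow]
    field_simp

theorem Rep.of_tsum {a : MvPowerSeries (Fin m) ℂ} {u : (Fin m → ℂ) → ℂ} (r : ℝ) (hr : 0 < r)
    (hs : Summable fun α => ‖MvPowerSeries.coeff α a‖ * r ^ α.degree)
    (hu : ∀ z, ‖z‖ ≤ r → u z = ∑' α, MvPowerSeries.coeff α a * mon z α) : Rep a u := by
  refine ⟨r, hr, WA.mk (fun α => MvPowerSeries.coeff α a * (r : ℂ) ^ α.degree) (by
    simpa only [norm_mul, norm_pow, Complex.norm_real, Real.norm_of_nonneg hr.le] using hs),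
    fun α => rfl, fun y hy => ?_⟩
  rw [hu _ (by
    rw [norm_smul, Complex.norm_real, Real.norm_of_nonneg hr.le]
    exact mul_le_of_le_one_right hr.le hy), ev_apply]
  congr 1; funext α
  rw [mon_smul, cf_mk]; ring

theorem Rep.congr {a : MvPowerSeries (Fin m) ℂ} {u v : (Fin m → ℂ) → ℂ} (h : Rep a u)
    (huv : u =ᶠ[𝓝 0] v) : Rep a v := by
  obtain ⟨r, hr, H⟩ := h.shrink
  obtain ⟨s, hs, hs'⟩ := Metric.eventually_nhds_iff.1 huv
  obtain ⟨w, hw, hu⟩ := H (min r (s / 2)) (by positivity) (min_le_left _ _)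
  refine ⟨min r (s / 2), by positivity, w, hw, fun y hy => ?_⟩
  rw [← hu y hy]
  symm
  apply hs'
  rw [dist_zero_right, norm_smul, Complex.norm_real, Real.norm_of_nonneg (by positivity)]
  calc min r (s / 2) * ‖y‖ ≤ s / 2 * 1 :=
        mul_le_mul (min_le_right _ _) hy (norm_nonneg _) (by positivity)
    _ < s := by linarith

theorem Rep.common {a b : MvPowerSeries (Fin m) ℂ} {u v : (Fin m → ℂ) → ℂ} (h : Rep a u)
    (h' : Rep b v) : ∃ r : ℝ, 0 < r ∧ ∃ w w' : WA m,
      (∀ α, w.cf α = MvPowerSeries.coeff α a * (r : ℂ) ^ α.degree) ∧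
      (∀ α, w'.cf α = MvPowerSeries.coeff α b * (r : ℂ) ^ α.degree) ∧
      (∀ y (hy : ‖y‖ ≤ 1), u ((r : ℂ) • y) = ev y hy w) ∧
      (∀ y (hy : ‖y‖ ≤ 1), v ((r : ℂ) • y) = ev y hy w') := by
  obtain ⟨r, hr, H⟩ := h.shrink
  obtain ⟨s, hs, H'⟩ := h'.shrink
  obtain ⟨w, h1, h2⟩ := H (min r s) (by positivity) (min_le_left _ _)
  obtain ⟨w', h1', h2'⟩ := H' (min r s) (by positivity) (min_le_right _ _)
  exact ⟨min r s, by positivity, w, w', h1, h1', h2, h2'⟩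

theorem Rep.add {a b : MvPowerSeries (Fin m) ℂ} {u v : (Fin m → ℂ) → ℂ} (h : Rep a u)
    (h' : Rep b v) : Rep (a + b) (fun y => u y + v y) := by
  obtain ⟨r, hr, w, w', h1, h2, h3, h4⟩ := h.common h'
  refine ⟨r, hr, w + w', fun α => ?_, fun y hy => ?_⟩
  · rw [cf_add, h1, h2, map_add, add_mul]
  · beta_reduce
    rw [h3 y hy, h4 y hy, map_add]

theorem Rep.mul {a b : MvPowerSeries (Fin m) ℂ} {u v : (Fin m → ℂ) → ℂ} (h : Rep a u)
    (h' : Rep b v) : Rep (a * b) (fun y => u y * v y) := by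
  obtain ⟨r, hr, w, w', h1, h2, h3, h4⟩ := h.common h'
  refine ⟨r, hr, w * w', fun α => ?_, fun y hy => ?_⟩
  · rw [cf_mul, MvPowerSeries.coeff_mul, Finset.sum_mul]
    refine Finset.sum_congr rfl fun x hx => ?_
    rw [Finset.HasAntidiagonal.mem_antidiagonal] at hx
    rw [h1, h2, ← hx, map_add, pow_add]; ring
  · beta_reduce
    rw [h3 y hy, h4 y hy, ev_mul]

theorem Rep.const_mul {a : MvPowerSeries (Fin m) ℂ} {u : (Fin m → ℂ) → ℂ} (c : ℂ) (h : Rep a u) :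
    Rep (c • a) (fun y => c * u y) := by
  obtain ⟨r, hr, w, h1, h3⟩ := h
  refine ⟨r, hr, c • w, fun α => ?_, fun y hy => ?_⟩
  · rw [cf_smul, h1]; simp; ring
  · beta_reduce
    rw [h3 y hy, map_smul, smul_eq_mul]

theorem Rep.neg {a : MvPowerSeries (Fin m) ℂ} {u : (Fin m → ℂ) → ℂ} (h : Rep a u) :
    Rep (-a) (fun y => -u y) := by
  simpa using h.const_mul (-1)

theorem Rep.sub {a b : MvPowerSeries (Fin m) ℂ} {u v : (Fin m → ℂ) → ℂ} (h : Rep a u)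
    (h' : Rep b v) : Rep (a - b) (fun y => u y - v y) := by
  simpa [sub_eq_add_neg] using h.add h'.neg

theorem Rep.zero : Rep (0 : MvPowerSeries (Fin m) ℂ) (fun _ => 0) :=
  ⟨1, one_pos, 0, by simp, by simp⟩

theorem Rep.sum {ι : Type*} (s : Finset ι) {a : ι → MvPowerSeries (Fin m) ℂ}
    {u : ι → (Fin m → ℂ) → ℂ} (h : ∀ i ∈ s, Rep (a i) (u i)) :
    Rep (∑ i ∈ s, a i) (fun y => ∑ i ∈ s, u i y) := by
  classical
  induction s using Finset.induction_on with
  | empty => simpa using Rep.zero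
  | insert i s hi ih =>
    simp only [Finset.sum_insert hi]
    exact (h i (by simp)).add (ih fun j hj => h j (by simp [hj]))

theorem Rep.ev_scaled (w : WA m) (ε : ℝ) (hε : 0 < ε) (u : (Fin m → ℂ) → ℂ)
    (hu : ∀ y hy, u ((ε : ℂ) • y) = ev y hy w) :
    Rep (fun α => w.cf α * ((ε : ℂ) ^ α.degree)⁻¹) u := by
  have hrc : (ε : ℂ) ≠ 0 := by exact_mod_cast hε.ne'
  refine ⟨ε, hε, w, fun α => ?_, hu⟩
  show _ = w.cf α * ((ε : ℂ) ^ α.degree)⁻¹ * _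
  field_simp

theorem norm_mono_vec (ε : ℝ) (hε : 0 < ε) :
    ‖(fun k => (ε : ℂ) • WA.mono (Finsupp.single k 1) : Fin m → WA m)‖ ≤ ε := by
  refine (pi_norm_le_iff_of_nonneg hε.le).2 fun k => ?_
  rw [norm_smul, norm_mono, Complex.norm_real, Real.norm_of_nonneg hε.le, mul_one]

theorem Rep.exists (u : (Fin m → ℂ) → ℂ) (hu : AnalyticAt ℂ u 0) : ∃ a, Rep a u := by
  obtain ⟨U, -, -, ρ, hρ, h⟩ := functional_calculus m u hu
  have h2 : (0 : ℝ) < ρ / 2 := by positivity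
  refine ⟨_, Rep.ev_scaled (U fun k => ((ρ / 2 : ℝ) : ℂ) • WA.mono (Finsupp.single k 1)) (ρ / 2)
    h2 u fun y hy => ?_⟩
  rw [h _ ((norm_mono_vec _ h2).trans_lt (by linarith))]
  congr 1; funext k
  rw [map_smul, ev_mono, mon_single]; rfl

/-- homogeneous component -/
def lead (n : ℕ) (a : MvPowerSeries (Fin m) ℂ) : MvPolynomial (Fin m) ℂ :=
  ∑ α ∈ (Finset.univ : Finset (Fin m)).finsuppAntidiag n,
    MvPolynomial.monomial α (MvPowerSeries.coeff α a)

theorem mem_fa (n : ℕ) (α : Fin m →₀ ℕ) :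
    α ∈ (Finset.univ : Finset (Fin m)).finsuppAntidiag n ↔ α.degree = n := by
  simp [Finset.mem_finsuppAntidiag, degree_eq]

theorem coeff_lead (n : ℕ) (a : MvPowerSeries (Fin m) ℂ) (α) :
    MvPolynomial.coeff α (lead n a) = if α.degree = n then MvPowerSeries.coeff α a else 0 := by
  rw [lead, MvPolynomial.coeff_sum]
  simp only [MvPolynomial.coeff_monomial]
  rw [Finset.sum_ite_eq']
  simp only [mem_fa]

theorem eval_lead (n : ℕ) (a : MvPowerSeries (Fin m) ℂ) (y : Fin m → ℂ) :
    MvPolynomial.eval y (lead n a) =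
      ∑' α : Fin m →₀ ℕ, if α.degree = n then MvPowerSeries.coeff α a * mon y α else 0 := by
  rw [tsum_eq_sum (s := (Finset.univ : Finset (Fin m)).finsuppAntidiag n)]
  · rw [lead, map_sum]
    refine Finset.sum_congr rfl fun α hα => ?_
    rw [mem_fa] at hα
    rw [if_pos hα, MvPolynomial.eval_monomial, mon, Finsupp.prod_fintype]
    simp
  · intro α hα
    rw [mem_fa] at hα
    rw [if_neg hα]

theorem Rep.tendsto {a : MvPowerSeries (Fin m) ℂ} {u : (Fin m → ℂ) → ℂ} (h : Rep a u) (n : ℕ)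
    (ha : ∀ α : Fin m →₀ ℕ, α.degree < n → MvPowerSeries.coeff α a = 0) (y : Fin m → ℂ)
    (z : ℂ → Fin m → ℂ) (hz : Tendsto z (𝓝[≠] 0) (𝓝 y)) :
    Tendsto (fun t : ℂ => (t ^ n)⁻¹ * u (t • z t)) (𝓝[≠] 0)
      (𝓝 (MvPolynomial.eval y (lead n a))) := by
  obtain ⟨r, hr, hs, hu⟩ := h.unfold
  rw [eval_lead]
  set B : ℝ := ‖y‖ + 1 with hB
  have hB0 : 0 < B := by positivity
  set τ : ℝ := r / B with hτ
  have hτ0 : 0 < τ := by positivity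
  have ev1 : ∀ᶠ t in 𝓝[≠] (0 : ℂ), ‖z t‖ < B := by
    have := hz.norm.eventually (gt_mem_nhds (show ‖y‖ < B by rw [hB]; linarith))
    exact this
  have ev2 : ∀ᶠ t in 𝓝[≠] (0 : ℂ), ‖t‖ < τ := by
    have : ∀ᶠ t in 𝓝 (0 : ℂ), ‖t‖ < τ := by
      have := Metric.ball_mem_nhds (0 : ℂ) hτ0
      filter_upwards [this] with t ht
      simpa using ht
    exact this.filter_mono nhdsWithin_le_nhds
  have ev3 : ∀ᶠ t in 𝓝[≠] (0 : ℂ), t ≠ 0 := eventually_mem_nhdsWithin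
  have hmon : ∀ α : Fin m →₀ ℕ, Tendsto (fun t => mon (z t) α) (𝓝[≠] 0) (𝓝 (mon y α)) := by
    intro α
    unfold mon
    exact tendsto_finsetProd _ fun i _ => ((tendsto_pi_nhds.1 hz) i).pow _
  have key := tendsto_tsum_of_dominated_convergence (𝓕 := 𝓝[≠] (0 : ℂ))
    (f := fun t α => (t ^ n)⁻¹ * (MvPowerSeries.coeff α a * mon (t • z t) α))
    (g := fun α : Fin m →₀ ℕ => if α.degree = n then MvPowerSeries.coeff α a * mon y α else 0)
    (bound := fun α => (‖MvPowerSeries.coeff α a‖ * r ^ α.degree) * (τ ^ n)⁻¹)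
    (hs.mul_right _) ?_ ?_
  · refine key.congr' ?_
    filter_upwards [ev1, ev2, ev3] with t h1 h2 h3
    rw [hu, ← tsum_mul_left]
    rw [norm_smul]
    calc ‖t‖ * ‖z t‖ ≤ τ * B := mul_le_mul h2.le h1.le (norm_nonneg _) hτ0.le
      _ = r := by rw [hτ]; field_simp
  · intro α
    rcases lt_trichotomy α.degree n with hlt | heq | hgt
    · rw [ha α hlt]; simp
    · rw [if_pos heq]
      refine ((hmon α).const_mul (MvPowerSeries.coeff α a)).congr' ?_
      filter_upwards [ev3] with t ht
      rw [mon_smul, heq]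
      field_simp
    · rw [if_neg hgt.ne']
      have h0 : Tendsto (fun t : ℂ => t ^ (α.degree - n)) (𝓝[≠] 0) (𝓝 0) := by
        have : Tendsto (fun t : ℂ => t ^ (α.degree - n)) (𝓝 0) (𝓝 (0 ^ (α.degree - n))) :=
          (continuous_pow _).tendsto 0
        rw [zero_pow (by omega)] at this
        exact this.mono_left nhdsWithin_le_nhds
      have h1 := h0.mul ((hmon α).const_mul (MvPowerSeries.coeff α a))
      rw [zero_mul] at h1
      refine h1.congr' ?_
      filter_upwards [ev3] with t ht
      rw [mon_smul]
      have : t ^ α.degree = t ^ (α.degree - n) * t ^ n := by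
        rw [← pow_add]; congr 1; omega
      rw [this]
      field_simp
  · filter_upwards [ev1, ev2, ev3] with t h1 h2 h3 α
    rcases lt_or_ge α.degree n with hlt | hge
    · rw [ha α hlt]; simp
    · have h4 : ‖mon (z t) α‖ ≤ B ^ α.degree :=
        norm_mon_le _ _ (fun i => (norm_le_pi_norm _ i).trans h1.le) α
      have h5 : t ^ α.degree = t ^ (α.degree - n) * t ^ n := by
        rw [← pow_add]; congr 1; omega
      have h6 : τ ^ α.degree = τ ^ (α.degree - n) * τ ^ n := by
        rw [← pow_add]; congr 1; omega
      have h7 : (t ^ n)⁻¹ * (MvPowerSeries.coeff α a * mon (t • z t) α) =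
          MvPowerSeries.coeff α a * (t ^ (α.degree - n) * mon (z t) α) := by
        rw [mon_smul, h5]; field_simp
      rw [h7, norm_mul, norm_mul, norm_pow, mul_assoc]
      refine mul_le_mul_of_nonneg_left ?_ (norm_nonneg _)
      calc ‖t‖ ^ (α.degree - n) * ‖mon (z t) α‖ ≤ τ ^ (α.degree - n) * B ^ α.degree :=
            mul_le_mul (pow_le_pow_left₀ (norm_nonneg _) h2.le _) h4 (norm_nonneg _) (by positivity)
        _ = (τ * B) ^ α.degree * (τ ^ n)⁻¹ := by rw [mul_pow, h6]; field_simp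
        _ = r ^ α.degree * (τ ^ n)⁻¹ := by
            congr 2; rw [hτ]; field_simp

theorem Rep.lead_of_tendsto {a : MvPowerSeries (Fin m) ℂ} {u : (Fin m → ℂ) → ℂ} (h : Rep a u)
    (n : ℕ) (Q : (Fin m → ℂ) → ℂ)
    (hQ : ∀ y, Tendsto (fun t : ℂ => (t ^ n)⁻¹ * u (t • y)) (𝓝[≠] 0) (𝓝 (Q y))) :
    (∀ α : Fin m →₀ ℕ, α.degree < n → MvPowerSeries.coeff α a = 0) ∧
      ∀ y, MvPolynomial.eval y (lead n a) = Q y := by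
  have ev3 : ∀ᶠ t in 𝓝[≠] (0 : ℂ), t ≠ 0 := eventually_mem_nhdsWithin
  have low : ∀ l, l ≤ n → ∀ α : Fin m →₀ ℕ, α.degree < l → MvPowerSeries.coeff α a = 0 := by
    intro l
    induction l with
    | zero => intro _ α hα; omega
    | succ l ih =>
      intro hl α hα
      have ih' := ih (by omega)
      rcases Nat.lt_succ_iff_lt_or_eq.1 hα with h1 | h1
      · exact ih' α h1
      · have h0 : lead l a = 0 := by
          apply MvPolynomial.funext
          intro y
          rw [map_zero]
          refine tendsto_nhds_unique (h.tendsto l ih' y (fun _ => y) tendsto_const_nhds) ?_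
          have h2 : Tendsto (fun t : ℂ => t ^ (n - l)) (𝓝[≠] 0) (𝓝 0) := by
            have : Tendsto (fun t : ℂ => t ^ (n - l)) (𝓝 0) (𝓝 (0 ^ (n - l))) :=
              (continuous_pow _).tendsto 0
            rw [zero_pow (by omega)] at this
            exact this.mono_left nhdsWithin_le_nhds
          have h3 := h2.mul (hQ y)
          rw [zero_mul] at h3
          refine h3.congr' ?_
          filter_upwards [ev3] with t ht
          have : t ^ n = t ^ (n - l) * t ^ l := by
            rw [← pow_add]; congr 1; omega
          rw [this]; field_simp
        have := coeff_lead l a α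
        rw [h0, if_pos h1] at this
        simpa using this.symm
  refine ⟨low n le_rfl, fun y => ?_⟩
  exact tendsto_nhds_unique (h.tendsto n (low n le_rfl) y (fun _ => y) tendsto_const_nhds) (hQ y)

theorem Rep.eq_zero {a : MvPowerSeries (Fin m) ℂ} (h : Rep a (fun _ => 0)) : a = 0 := by
  ext α
  have := (h.lead_of_tendsto (α.degree + 1) (fun _ => 0) (fun y => by simp)).1 α (by omega)
  simpa using this

theorem Rep.unique {a b : MvPowerSeries (Fin m) ℂ} {u v : (Fin m → ℂ) → ℂ} (h : Rep a u)
    (h' : Rep b v) (huv : u =ᶠ[𝓝 0] v) : a = b := by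
  have h1 := (h.congr huv).sub h'
  simp only [sub_self] at h1
  exact sub_eq_zero.1 h1.eq_zero

theorem Rep.eventually_zero {u : (Fin m → ℂ) → ℂ} (h : Rep (0 : MvPowerSeries (Fin m) ℂ) u) :
    ∀ᶠ y in 𝓝 0, u y = 0 := by
  obtain ⟨r, hr, hs, hu⟩ := h.unfold
  filter_upwards [Metric.ball_mem_nhds (0 : Fin m → ℂ) hr] with z hz
  rw [hu z (by simpa using (mem_ball_zero_iff.1 hz).le)]
  simp

theorem hasDerivAt_mon (d : Fin m → ℂ) (α : Fin m →₀ ℕ) :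
    HasDerivAt (fun t : ℂ => mon (fun k => 1 + t * d k) α) (∑ k, d k * α k) 0 := by
  have h := HasDerivAt.fun_finsetProd (u := (Finset.univ : Finset (Fin m)))
    (f := fun (k : Fin m) (t : ℂ) => (1 + t * d k) ^ α k)
    (f' := fun k => d k * α k) (x := (0 : ℂ)) (fun k _ => by
      have h1 : HasDerivAt (fun t : ℂ => 1 + t * d k) (d k) 0 := by
        simpa using ((hasDerivAt_id (0 : ℂ)).mul_const (d k)).const_add 1
      have h2 := h1.fun_pow (α k)
      convert h2 using 1
      simp; ring)
  unfold mon
  have e : ∑ k, d k * (α k : ℂ) = ∑ i, (∏ j ∈ Finset.univ.erase i,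
      (1 + (0 : ℂ) * d j) ^ α j) • (d i * (α i : ℂ)) := by simp
  rw [e]
  exact h

/-- weight -/
def wt (d : Fin m → ℂ) (α : Fin m →₀ ℕ) : ℂ := ∑ k, d k * α k

theorem norm_wt_le (d : Fin m → ℂ) (α) : ‖wt d α‖ ≤ ‖d‖ * α.degree := by
  rw [wt, degree_eq]
  push_cast
  rw [Finset.mul_sum]
  refine (norm_sum_le _ _).trans (Finset.sum_le_sum fun k _ => ?_)
  rw [norm_mul, Complex.norm_natCast]
  exact mul_le_mul_of_nonneg_right (norm_le_pi_norm d k) (by positivity)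

theorem Rep.euler {a : MvPowerSeries (Fin m) ℂ} {u : (Fin m → ℂ) → ℂ} (h : Rep a u)
    (hu : ∀ᶠ y in 𝓝 0, DifferentiableAt ℂ u y) (d : Fin m → ℂ) :
    Rep (fun α => wt d α * MvPowerSeries.coeff α a)
      (fun y => fderiv ℂ u y (fun k => d k * y k)) := by
  obtain ⟨r, hr, hs, hsum⟩ := h.unfold
  obtain ⟨s, hs0, hdiff⟩ := Metric.eventually_nhds_iff.1 hu
  set ρ := min (r / 2) (s / 2) with hρ
  have hρ0 : 0 < ρ := by positivity
  have hρr : ρ ≤ r / 2 := min_le_left _ _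
  have hsm : ∀ α : Fin m →₀ ℕ, ‖wt d α * MvPowerSeries.coeff α a‖ * ρ ^ α.degree ≤
      ‖d‖ * (‖MvPowerSeries.coeff α a‖ * r ^ α.degree) := by
    intro α
    rw [norm_mul]
    have h1 : ρ ^ α.degree ≤ r ^ α.degree * (1 / 2) ^ α.degree := by
      rw [← mul_pow]
      exact pow_le_pow_left₀ hρ0.le (by linarith) _
    have h2 : (α.degree : ℝ) * (1 / 2) ^ α.degree ≤ 1 := by
      rw [div_pow, one_pow, mul_one_div, div_le_one (by positivity)]
      exact_mod_cast Nat.lt_two_pow_self.le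
    calc ‖wt d α‖ * ‖MvPowerSeries.coeff α a‖ * ρ ^ α.degree
        ≤ (‖d‖ * α.degree) * ‖MvPowerSeries.coeff α a‖ * (r ^ α.degree * (1 / 2) ^ α.degree) := by
          refine mul_le_mul (mul_le_mul_of_nonneg_right (norm_wt_le d α) (norm_nonneg _)) h1
            (by positivity) (by positivity)
      _ = (‖d‖ * (‖MvPowerSeries.coeff α a‖ * r ^ α.degree)) * (α.degree * (1 / 2) ^ α.degree) := by
          ring
      _ ≤ (‖d‖ * (‖MvPowerSeries.coeff α a‖ * r ^ α.degree)) * 1 :=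
          mul_le_mul_of_nonneg_left h2 (by positivity)
      _ = _ := mul_one _
  refine Rep.of_tsum ρ hρ0 ((hs.mul_left ‖d‖).of_nonneg_of_le (fun _ => by positivity) hsm) ?_
  intro z hz
  have hd : DifferentiableAt ℂ u z := hdiff (by
    rw [dist_zero_right]
    have := min_le_right (r / 2) (s / 2)
    linarith)
  set τ : ℝ := 1 / (1 + ‖d‖) with hτ
  have hτ0 : 0 < τ := by positivity
  have hnorm : ∀ t : ℂ, ‖t‖ < τ → ∀ k, ‖(1 + t * d k) * z k‖ ≤ r := by
    intro t ht k
    have h1 : ‖t * d k‖ ≤ 1 := by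
      rw [norm_mul]
      calc ‖t‖ * ‖d k‖ ≤ τ * (1 + ‖d‖) :=
            mul_le_mul ht.le ((norm_le_pi_norm d k).trans (by linarith)) (norm_nonneg _) hτ0.le
        _ = 1 := by rw [hτ]; field_simp
    have h2 : ‖1 + t * d k‖ ≤ 2 := (norm_add_le _ _).trans (by rw [norm_one]; linarith)
    rw [norm_mul]
    calc _ ≤ 2 * (r / 2) :=
          mul_le_mul h2 (((norm_le_pi_norm z k).trans hz).trans hρr) (norm_nonneg _) (by norm_num)
      _ = r := by ring
  have hmonmul : ∀ (t : ℂ) (α : Fin m →₀ ℕ), mon (fun k => (1 + t * d k) * z k) α =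
      mon (fun k => 1 + t * d k) α * mon z α := by
    intro t α
    simp [mon, mul_pow, Finset.prod_mul_distrib]
  have key := Complex.hasSum_deriv_of_summable_norm (U := Metric.ball (0 : ℂ) τ) (z := 0)
    (F := fun (α : Fin m →₀ ℕ) (t : ℂ) =>
      MvPowerSeries.coeff α a * mon (fun k => (1 + t * d k) * z k) α) hs ?_ Metric.isOpen_ball ?_
      (Metric.mem_ball_self hτ0)
  · have h1 : deriv (fun t : ℂ => ∑' α : Fin m →₀ ℕ,
        MvPowerSeries.coeff α a * mon (fun k => (1 + t * d k) * z k) α) 0 =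
        fderiv ℂ u z (fun k => d k * z k) := by
      have h2 : (fun t : ℂ => ∑' α : Fin m →₀ ℕ,
        MvPowerSeries.coeff α a * mon (fun k => (1 + t * d k) * z k) α) =ᶠ[𝓝 0]
          fun t : ℂ => u (fun k => (1 + t * d k) * z k) := by
        filter_upwards [Metric.ball_mem_nhds (0 : ℂ) hτ0] with t ht
        rw [hsum]
        exact (pi_norm_le_iff_of_nonneg hr.le).2 (hnorm t (by simpa using ht))
      rw [h2.deriv_eq]
      have h3 : HasDerivAt (fun t : ℂ => (fun k => (1 + t * d k) * z k : Fin m → ℂ))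
          (fun k => d k * z k) 0 := by
        rw [hasDerivAt_pi]
        intro k
        simpa using ((((hasDerivAt_id (0 : ℂ)).mul_const (d k)).const_add 1).mul_const (z k))
      have h4 : (fun k => (1 + (0 : ℂ) * d k) * z k : Fin m → ℂ) = z := by funext k; simp
      have h5 : HasFDerivAt u (fderiv ℂ u z) (fun k => (1 + (0 : ℂ) * d k) * z k) := by
        rw [h4]; exact hd.hasFDerivAt
      exact (h5.comp_hasDerivAt (0 : ℂ) h3).deriv
    rw [← h1, ← key.tsum_eq]
    congr 1; funext α
    show _ = wt d α * MvPowerSeries.coeff α a * mon z α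
    simp only [hmonmul]
    rw [(((hasDerivAt_mon d α).mul_const (mon z α)).const_mul _).deriv, wt]
    ring
  · intro α
    simp only [hmonmul]
    unfold mon
    fun_prop
  · intro α t ht
    rw [norm_mul]
    exact mul_le_mul_of_nonneg_left (norm_mon_le _ _ (hnorm t (by simpa using ht)) α)
      (norm_nonneg _)

end
end GeomLin

namespace GeomLin
noncomputable section
open WA Filter Topology

variable {m n p q : ℕ}

theorem Rep.coord (k : Fin m) : Rep (MvPowerSeries.X k) (fun y : Fin m → ℂ => y k) := by
  refine ⟨1, one_pos, WA.mono (Finsupp.single k 1), fun α => ?_, fun y hy => ?_⟩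
  · classical
    rw [cf_mono, MvPowerSeries.coeff_X]; simp
  · rw [ev_mono, mon_single]; simp

/-- formal partial derivative -/
def pd (k : Fin m) (a : MvPowerSeries (Fin m) ℂ) : MvPowerSeries (Fin m) ℂ :=
  fun γ => (γ k + 1) * MvPowerSeries.coeff (γ + Finsupp.single k 1) a

theorem coeff_pd (k : Fin m) (a : MvPowerSeries (Fin m) ℂ) (γ : Fin m →₀ ℕ) :
    MvPowerSeries.coeff γ (pd k a) = (γ k + 1) * MvPowerSeries.coeff (γ + Finsupp.single k 1) a :=
  rfl

theorem Rep.partial {a : MvPowerSeries (Fin m) ℂ} {u : (Fin m → ℂ) → ℂ} (h : Rep a u)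
    (hu : AnalyticAt ℂ u 0) (k : Fin m) :
    Rep (pd k a) (fun y => fderiv ℂ u y (Pi.single k 1)) := by
  have han : AnalyticAt ℂ (fun y => fderiv ℂ u y (Pi.single k 1)) 0 :=
    ((ContinuousLinearMap.apply ℂ ℂ (Pi.single k 1 : Fin m → ℂ)).analyticAt _).comp hu.fderiv
  obtain ⟨χ, hχ⟩ := Rep.exists _ han
  have h1 := (Rep.coord k).mul hχ
  have h2 := h.euler (hu.eventually_analyticAt.mono fun y hy => hy.differentiableAt)
    (Pi.single k 1)
  have h3 := h1.unique h2 (Eventually.of_forall fun y => by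
    have : (fun k' => (Pi.single k (1:ℂ) : Fin m → ℂ) k' * y k') = y k • Pi.single k (1:ℂ) := by
      funext k'
      by_cases hk : k' = k
      · subst hk; simp
      · simp [hk]
    show _ = fderiv ℂ u y _
    rw [this, map_smul, smul_eq_mul])
  have h4 : χ = pd k a := by
    ext γ
    have := congrArg (MvPowerSeries.coeff (Finsupp.single k 1 + γ)) h3
    rw [MvPowerSeries.X, MvPowerSeries.coeff_add_monomial_mul, one_mul] at this
    rw [this, coeff_pd]
    show wt (Pi.single k 1) (Finsupp.single k 1 + γ) * _ = _
    rw [add_comm]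
    congr 1
    rw [wt]
    simp [Pi.single_apply]
  rwa [h4] at hχ

theorem lead_pd (k : Fin m) (a : MvPowerSeries (Fin m) ℂ) (n : ℕ) :
    lead n (pd k a) = MvPolynomial.pderiv k (lead (n + 1) a) := by
  ext γ
  rw [MvPolynomial.coeff_pderiv, coeff_lead, coeff_lead, coeff_pd, map_add, Finsupp.degree_single]
  by_cases h : γ.degree = n
  · simp [h]; ring
  · simp [h]

theorem hasFDerivAt_eval (P : MvPolynomial (Fin m) ℂ) (y : Fin m → ℂ) :
    HasFDerivAt (fun y : Fin m → ℂ => MvPolynomial.eval y P)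
      (∑ k, MvPolynomial.eval y (MvPolynomial.pderiv k P) •
        (ContinuousLinearMap.proj (R := ℂ) (φ := fun _ : Fin m => ℂ) k)) y := by
  induction P using MvPolynomial.induction_on with
  | C a =>
    simp only [MvPolynomial.eval_C]
    refine (hasFDerivAt_const a y).congr_fderiv ?_
    ext v
    simp
  | add P Q hP hQ =>
    simp only [map_add]
    refine (hP.add hQ).congr_fderiv ?_
    ext v
    simp [add_mul, Finset.sum_add_distrib]
  | mul_X P i hP =>
    have h := hP.mul (ContinuousLinearMap.proj (R := ℂ) (φ := fun _ : Fin m => ℂ) i).hasFDerivAt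
    simp only [map_mul, MvPolynomial.eval_X]
    refine h.congr_fderiv ?_
    ext v
    simp [Derivation.leibniz, MvPolynomial.pderiv_X, Pi.single_apply, Finset.sum_add_distrib,
      add_mul, Finset.mul_sum, apply_ite]
    refine Finset.sum_congr rfl fun k _ => by ring

theorem fderiv_eval (P : MvPolynomial (Fin m) ℂ) (y v : Fin m → ℂ) :
    fderiv ℂ (fun y : Fin m → ℂ => MvPolynomial.eval y P) y v =
      ∑ k, MvPolynomial.eval y (MvPolynomial.pderiv k P) * v k := by
  rw [(hasFDerivAt_eval P y).fderiv]
  simp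

/-- Euler operator on polynomials -/
def eulerP (v : Fin m → ℂ) (P : MvPolynomial (Fin m) ℂ) : MvPolynomial (Fin m) ℂ :=
  ∑ k, MvPolynomial.C (v k) * (MvPolynomial.X k * MvPolynomial.pderiv k P)

theorem coeff_eulerP (v : Fin m → ℂ) (P : MvPolynomial (Fin m) ℂ) (α) :
    MvPolynomial.coeff α (eulerP v P) = wt v α * MvPolynomial.coeff α P := by
  rw [eulerP, MvPolynomial.coeff_sum, wt, Finset.sum_mul]
  refine Finset.sum_congr rfl fun k _ => ?_
  rw [MvPolynomial.coeff_C_mul, MvPolynomial.coeff_X_mul', mul_assoc]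
  congr 1
  split_ifs with h
  · rw [MvPolynomial.coeff_pderiv]
    have h1 : Finsupp.single k 1 ≤ α := by
      rw [Finsupp.single_le_iff]
      have := Finsupp.mem_support_iff.1 h
      omega
    rw [tsub_add_cancel_of_le h1, mul_comm]
    congr 1
    have h2 := DFunLike.congr_fun (tsub_add_cancel_of_le h1) k
    rw [Finsupp.add_apply, Finsupp.single_eq_same] at h2
    exact_mod_cast h2
  · rw [Finsupp.notMem_support_iff.1 h]; simp

theorem eval_eulerP (v : Fin m → ℂ) (P : MvPolynomial (Fin m) ℂ) (y) :
    MvPolynomial.eval y (eulerP v P) =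
      ∑ k, v k * (y k * MvPolynomial.eval y (MvPolynomial.pderiv k P)) := by
  simp [eulerP]

/-- The normalized situation. -/
structure Core (p q m : ℕ) where
  X : Fin p → (Fin m → ℂ) → Fin m → ℂ
  F : Fin q → (Fin m → ℂ) → ℂ
  ρ : Fin p → Fin m → ℂ
  κ : Fin p → Fin m
  k : Fin q → ℕ
  G : Fin q → (Fin m → ℂ) → ℂ
  hm : m = p + q
  hX : ∀ i, AnalyticAt ℂ (X i) 0
  hF : ∀ s, AnalyticAt ℂ (F s) 0
  hcomm : ∀ i j, ∀ᶠ x in 𝓝 0, fderiv ℂ (X j) x (X i x) = fderiv ℂ (X i) x (X j x)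
  hFX : ∀ i s, ∀ᶠ x in 𝓝 0, fderiv ℂ (F s) x (X i x) = 0
  hX0 : ∀ i, X i 0 = 0
  hDX : ∀ i v, fderiv ℂ (X i) 0 v = fun k => ρ i k * v k
  hκ : ∀ i j, ρ i (κ j) = if i = j then 1 else 0
  hG : ∀ s y, Tendsto (fun t : ℂ => (t ^ k s)⁻¹ * F s (t • y)) (𝓝[≠] 0) (𝓝 (G s y))
  hGind : Dense {y | LinearIndependent ℂ fun s => fderiv ℂ (G s) y}

namespace Core
variable (D : Core p q m)

/-- Taylor series of the first integrals -/
def a (s : Fin q) : MvPowerSeries (Fin m) ℂ := (Rep.exists _ (D.hF s)).choose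

theorem rep_a (s : Fin q) : Rep (D.a s) (D.F s) := (Rep.exists _ (D.hF s)).choose_spec

/-- leading polynomial -/
def L (s : Fin q) : MvPolynomial (Fin m) ℂ := lead (D.k s) (D.a s)

theorem a_low (s : Fin q) (α : Fin m →₀ ℕ) (h : α.degree < D.k s) :
    MvPowerSeries.coeff α (D.a s) = 0 :=
  ((D.rep_a s).lead_of_tendsto _ _ (D.hG s)).1 α h

theorem G_eq (s : Fin q) : D.G s = fun y => MvPolynomial.eval y (D.L s) := by
  funext y
  exact (((D.rep_a s).lead_of_tendsto _ _ (D.hG s)).2 y).symm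

theorem k_pos (s : Fin q) : 0 < D.k s := by
  by_contra h0
  have h0 : D.k s = 0 := by omega
  obtain ⟨y, hy⟩ := D.hGind.nonempty
  refine hy.ne_zero s ?_
  ext v
  show fderiv ℂ (D.G s) y v = 0
  rw [D.G_eq, fderiv_eval]
  refine Finset.sum_eq_zero fun k _ => ?_
  have : MvPolynomial.pderiv k (D.L s) = 0 := by
    ext γ
    rw [MvPolynomial.coeff_pderiv, L, coeff_lead, if_neg]
    · simp
    · rw [map_add, Finsupp.degree_single, h0]; omega
  rw [this]; simp

theorem rep_pd (s : Fin q) (k : Fin m) :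
    Rep (pd k (D.a s)) (fun y => fderiv ℂ (D.F s) y (Pi.single k 1)) :=
  (D.rep_a s).partial (D.hF s) k

theorem pd_low (s : Fin q) (k : Fin m) (α : Fin m →₀ ℕ) (h : α.degree < D.k s - 1) :
    MvPowerSeries.coeff α (pd k (D.a s)) = 0 := by
  rw [coeff_pd, D.a_low, mul_zero]
  rw [map_add, Finsupp.degree_single]; omega

theorem lead_pd_a (s : Fin q) (k : Fin m) :
    lead (D.k s - 1) (pd k (D.a s)) = MvPolynomial.pderiv k (D.L s) := by
  rw [lead_pd, L]
  congr 2
  have := D.k_pos s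
  omega

/-- limits of the rescaled derivatives of `F` along moving points -/
theorem tendsto_pd (s : Fin q) (k : Fin m) (y : Fin m → ℂ)
    (z : ℂ → Fin m → ℂ) (hz : Tendsto z (𝓝[≠] 0) (𝓝 y)) :
    Tendsto (fun t : ℂ => (t ^ (D.k s - 1))⁻¹ * fderiv ℂ (D.F s) (t • z t) (Pi.single k 1))
      (𝓝[≠] 0) (𝓝 (MvPolynomial.eval y (MvPolynomial.pderiv k (D.L s)))) := by
  rw [← lead_pd_a]
  exact (D.rep_pd s k).tendsto _ (D.pd_low s k) y z hz

end Core

theorem clm_eq_sum (l : (Fin m → ℂ) →L[ℂ] ℂ) (v : Fin m → ℂ) :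
    l v = ∑ k, v k * l (Pi.single k 1) := by
  conv_lhs => rw [show v = ∑ k, v k • (Pi.single k (1:ℂ) : Fin m → ℂ) by
    funext j; simp [Finset.sum_apply, Pi.single_apply]]
  rw [map_sum]
  simp

theorem fderiv_eq_sum (u : (Fin m → ℂ) → ℂ) (y v : Fin m → ℂ) :
    fderiv ℂ u y v = ∑ k, v k * fderiv ℂ u y (Pi.single k 1) := clm_eq_sum _ v

theorem tendsto_lin {u : (Fin m → ℂ) → Fin n → ℂ} {u' : (Fin m → ℂ) →L[ℂ] (Fin n → ℂ)}
    (h : HasFDerivAt u u' 0) (h0 : u 0 = 0) (y : Fin m → ℂ) :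
    Tendsto (fun t : ℂ => t⁻¹ • u (t • y)) (𝓝[≠] 0) (𝓝 (u' y)) := by
  have h1 : HasDerivAt (fun t : ℂ => t • y) y 0 := by
    simpa using (hasDerivAt_id (0:ℂ)).smul_const y
  have h2 : HasDerivAt (fun t : ℂ => u (t • y)) (u' y) 0 := by
    have h3 : HasFDerivAt u u' ((0:ℂ) • y) := by simpa using h
    exact h3.comp_hasDerivAt (0:ℂ) h1
  have h3 := h2.tendsto_slope
  refine h3.congr fun t => ?_
  simp [slope, h0]

theorem tendsto_pull (y : Fin m → ℂ) : Tendsto (fun t : ℂ => t • y) (𝓝[≠] 0) (𝓝 0) := by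
  have : Tendsto (fun t : ℂ => t • y) (𝓝 0) (𝓝 ((0:ℂ) • y)) :=
    (continuous_id.smul continuous_const).tendsto _
  rw [zero_smul] at this
  exact this.mono_left nhdsWithin_le_nhds

namespace Core
variable (D : Core p q m)

theorem euler_zero (i : Fin p) (s : Fin q) : eulerP (D.ρ i) (D.L s) = 0 := by
  apply MvPolynomial.funext
  intro y
  rw [eval_eulerP, map_zero]
  have h1 : ∀ k, Tendsto (fun t : ℂ => t⁻¹ * D.X i (t • y) k) (𝓝[≠] 0) (𝓝 (D.ρ i k * y k)) := by
    intro k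
    have := tendsto_lin (D.hX i).differentiableAt.hasFDerivAt (D.hX0 i) y
    rw [D.hDX] at this
    exact (tendsto_pi_nhds.1 this) k
  have h2 := tendsto_finsetSum (Finset.univ : Finset (Fin m)) fun k _ =>
    (h1 k).mul (D.tendsto_pd s k y (fun _ => y) tendsto_const_nhds)
  have h3 : ∀ᶠ t in 𝓝[≠] (0:ℂ), ∑ k, t⁻¹ * D.X i (t • y) k *
      ((t ^ (D.k s - 1))⁻¹ * fderiv ℂ (D.F s) (t • y) (Pi.single k 1)) = 0 := by
    filter_upwards [(tendsto_pull y).eventually (D.hFX i s)] with t ht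
    rw [fderiv_eq_sum] at ht
    have : ∑ k, t⁻¹ * D.X i (t • y) k *
      ((t ^ (D.k s - 1))⁻¹ * fderiv ℂ (D.F s) (t • y) (Pi.single k 1)) =
      t⁻¹ * (t ^ (D.k s - 1))⁻¹ *
        ∑ k, D.X i (t • y) k * fderiv ℂ (D.F s) (t • y) (Pi.single k 1) := by
      rw [Finset.mul_sum]; exact Finset.sum_congr rfl fun k _ => by ring
    rw [this, ht, mul_zero]
  have h4 := tendsto_nhds_unique (h2.congr' h3) tendsto_const_nhds
  rw [← h4]
  exact Finset.sum_congr rfl fun k _ => by ring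

theorem wt_zero (i : Fin p) (s : Fin q) (α) (h : MvPolynomial.coeff α (D.L s) ≠ 0) :
    wt (D.ρ i) α = 0 := by
  have := coeff_eulerP (D.ρ i) (D.L s) α
  rw [D.euler_zero] at this
  simpa [h] using this.symm

theorem span_lemma (y : Fin m → ℂ) (hy : ∀ k, y k ≠ 0)
    (hli : LinearIndependent ℂ fun s => fderiv ℂ (D.G s) y) (v : Fin m → ℂ)
    (hv : ∀ s, ∑ k, v k * (y k * MvPolynomial.eval y (MvPolynomial.pderiv k (D.L s))) = 0)
    (γ : Fin m → ℂ) (hγ : ∀ i, ∑ k, D.ρ i k * γ k = 0) : ∑ k, v k * γ k = 0 := by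
  let R : (Fin m → ℂ) →ₗ[ℂ] (Fin p → ℂ) := Matrix.mulVecLin (Matrix.of D.ρ)
  have hR : ∀ γ i, R γ i = ∑ k, D.ρ i k * γ k := fun γ i => rfl
  have hsurj : Function.Surjective R := by
    intro b
    refine ⟨∑ i, b i • Pi.single (D.κ i) 1, ?_⟩
    funext j
    rw [map_sum, Finset.sum_apply]
    have : ∀ i, R (b i • Pi.single (D.κ i) 1) j = if j = i then b i else 0 := by
      intro i
      rw [map_smul, Pi.smul_apply, hR]
      simp [Pi.single_apply, D.hκ]
    simp [this]
  have hrank : Module.finrank ℂ (LinearMap.ker R) = q := by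
    have := LinearMap.finrank_range_add_finrank_ker R
    rw [LinearMap.range_eq_top.2 hsurj, finrank_top] at this
    simp at this
    have := D.hm
    omega
  let T : ((Fin m → ℂ) →L[ℂ] ℂ) →ₗ[ℂ] (Fin m → ℂ) :=
    { toFun := fun l k => y k * l (Pi.single k 1)
      map_add' := fun l l' => by funext k; simp [mul_add]
      map_smul' := fun c l => by funext k; simp; ring }
  have hT : LinearMap.ker T = ⊥ := by
    rw [LinearMap.ker_eq_bot']
    intro l hl
    ext v
    rw [clm_eq_sum]
    refine Finset.sum_eq_zero fun k _ => ?_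
    have := congrFun hl k
    have h2 : l (Pi.single k 1) = 0 := by simpa [T, hy k] using this
    rw [h2, mul_zero]
  have hli2 : LinearIndependent ℂ fun s => T (fderiv ℂ (D.G s) y) := hli.map' T hT
  have hTs : ∀ s k, T (fderiv ℂ (D.G s) y) k =
      y k * MvPolynomial.eval y (MvPolynomial.pderiv k (D.L s)) := by
    intro s k
    show y k * fderiv ℂ (D.G s) y (Pi.single k 1) = _
    rw [D.G_eq, fderiv_eval]
    simp [Pi.single_apply]
  have hmem : ∀ s, T (fderiv ℂ (D.G s) y) ∈ LinearMap.ker R := by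
    intro s
    rw [LinearMap.mem_ker]
    funext i
    rw [hR]
    simp only [hTs]
    rw [← eval_eulerP, D.euler_zero]; simp
  let w : Fin q → LinearMap.ker R := fun s => ⟨_, hmem s⟩
  have hw : LinearIndependent ℂ w := by
    apply LinearIndependent.of_comp (LinearMap.ker R).subtype
    exact hli2
  have hspan := hw.span_eq_top_of_card_eq_finrank' (by simp [hrank])
  let φ : LinearMap.ker R →ₗ[ℂ] ℂ :=
    (Fintype.linearCombination ℂ v) ∘ₗ (LinearMap.ker R).subtype
  have hφ : φ = 0 := by
    apply LinearMap.ext_on_range hspan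
    intro s
    show Fintype.linearCombination ℂ v (T (fderiv ℂ (D.G s) y)) = 0
    rw [Fintype.linearCombination_apply, ← hv s]
    exact Finset.sum_congr rfl fun k _ => by rw [hTs, smul_eq_mul, mul_comm]
  have hγm : γ ∈ LinearMap.ker R := by
    rw [LinearMap.mem_ker]; funext i; rw [hR, hγ]; rfl
  have := LinearMap.congr_fun hφ ⟨γ, hγm⟩
  have h2 : Fintype.linearCombination ℂ v γ = 0 := this
  rw [Fintype.linearCombination_apply] at h2
  rw [← h2]
  exact Finset.sum_congr rfl fun k _ => by rw [smul_eq_mul, mul_comm]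

theorem dense_good : Dense {y : Fin m → ℂ | (∀ k, y k ≠ 0) ∧
    LinearIndependent ℂ fun s => fderiv ℂ (D.G s) y} := by
  have h1 : Dense {y : Fin m → ℂ | ∀ k, y k ≠ 0} := by
    have := dense_pi (Set.univ : Set (Fin m)) (s := fun _ => ({0}ᶜ : Set ℂ))
      (fun i _ => dense_compl_singleton 0)
    convert this using 1
    ext y; simp
  have h2 : IsOpen {y : Fin m → ℂ | ∀ k, y k ≠ 0} := by
    simp only [Set.ofPred_forall]
    exact isOpen_iInter_of_finite fun k => isOpen_ne_fun (continuous_apply k) continuous_const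
  exact h1.inter_of_isOpen_left D.hGind h2

/-- the standard annihilator vectors -/
def gam (k : Fin m) : Fin m → ℂ := fun k' =>
  (if k' = k then 1 else 0) - ∑ i, D.ρ i k * (if k' = D.κ i then 1 else 0)

theorem sum_gam (k : Fin m) (v : Fin m → ℂ) :
    ∑ k', v k' * D.gam k k' = v k - ∑ i, D.ρ i k * v (D.κ i) := by
  simp only [gam, mul_sub, Finset.sum_sub_distrib, Finset.mul_sum]
  congr 1
  · simp
  · rw [Finset.sum_comm]
    refine Finset.sum_congr rfl fun i _ => ?_
    simp [mul_comm]

theorem gam_ann (k : Fin m) (i : Fin p) : ∑ k', D.ρ i k' * D.gam k k' = 0 := by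
  rw [sum_gam]; simp [D.hκ]

theorem rational (j : Fin p) (k : Fin m) : ∃ r : ℚ, D.ρ j k = r := by
  obtain ⟨τ, hτ⟩ := LinearMap.exists_leftInverse_of_injective
    (LinearMap.toSpanSingleton ℚ ℂ 1) (by
      rw [LinearMap.ker_eq_bot']
      intro r hr
      simpa [LinearMap.toSpanSingleton_apply] using hr)
  have hτ1 : τ 1 = 1 := by
    have := LinearMap.congr_fun hτ 1
    simpa [LinearMap.toSpanSingleton_apply] using this
  obtain ⟨y, hy0, hy⟩ := D.dense_good.nonempty
  have h0 := D.span_lemma y hy0 hy (fun k => (τ (D.ρ j k) : ℂ) - D.ρ j k) (fun s => by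
    rw [← eval_eulerP]
    have : eulerP (fun k => (τ (D.ρ j k) : ℂ) - D.ρ j k) (D.L s) = 0 := by
      ext α
      rw [coeff_eulerP, MvPolynomial.coeff_zero]
      by_cases hc : MvPolynomial.coeff α (D.L s) = 0
      · rw [hc, mul_zero]
      · have h1 := D.wt_zero j s α hc
        have h2 : ((τ (wt (D.ρ j) α) : ℚ) : ℂ) = ∑ k, (τ (D.ρ j k) : ℂ) * α k := by
          rw [wt, map_sum]
          push_cast
          refine Finset.sum_congr rfl fun k _ => ?_
          have : D.ρ j k * (α k : ℂ) = (α k : ℚ) • D.ρ j k := by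
            rw [Rat.smul_def]; push_cast; ring
          rw [this, map_smul, smul_eq_mul]; push_cast; ring
        rw [h1, map_zero] at h2
        have h3 : wt (fun k => (τ (D.ρ j k) : ℂ) - D.ρ j k) α = 0 := by
          rw [wt]
          simp only [sub_mul, Finset.sum_sub_distrib]
          rw [← h2]
          have : ∑ k, D.ρ j k * (α k : ℂ) = 0 := h1
          rw [this]; simp
        rw [h3, zero_mul]
    rw [this, map_zero]) (D.gam k) (D.gam_ann k)
  rw [sum_gam] at h0
  have h1 : ∀ i, ((τ (D.ρ j (D.κ i)) : ℚ) : ℂ) - D.ρ j (D.κ i) = 0 := by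
    intro i
    rw [D.hκ]
    split_ifs
    · rw [hτ1]; simp
    · simp
  simp only [h1] at h0
  refine ⟨τ (D.ρ j k), ?_⟩
  simp at h0
  exact (sub_eq_zero.1 h0).symm

/-- the eigenvalue of the homological operator -/
def lam (j : Fin p) (α : Fin m →₀ ℕ) (k : Fin m) : ℂ := wt (D.ρ j) α - D.ρ j k

theorem lower_bound : ∃ c : ℝ, 0 < c ∧ ∀ j α k, D.lam j α k ≠ 0 → c ≤ ‖D.lam j α k‖ := by
  choose r hr using D.rational
  let N : ℕ := ∏ j, ∏ k, (r j k).den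
  have hN : 0 < N := Finset.prod_pos fun j _ => Finset.prod_pos fun k _ => (r j k).den_pos
  have hintz : ∀ j k, ∃ z : ℤ, (N : ℂ) * D.ρ j k = z := by
    intro j k
    obtain ⟨c, hc⟩ : (r j k).den ∣ N :=
      (Finset.dvd_prod_of_mem (fun k => (r j k).den) (Finset.mem_univ k)).trans
        (Finset.dvd_prod_of_mem (fun j => ∏ k, (r j k).den) (Finset.mem_univ j))
    refine ⟨c * (r j k).num, ?_⟩
    rw [hc, hr]
    have h1 := Rat.den_mul_eq_num (r j k)
    have h2 : ((r j k).den : ℂ) * (r j k : ℂ) = (r j k).num := by exact_mod_cast h1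
    push_cast
    rw [mul_comm ((r j k).den : ℂ), mul_assoc, h2]
  choose z hz using hintz
  refine ⟨1 / N, by positivity, fun j α k hne => ?_⟩
  have h1 : (N : ℂ) * D.lam j α k = ((∑ k', z j k' * α k' - z j k : ℤ) : ℂ) := by
    rw [lam, wt, mul_sub, hz, Finset.mul_sum]
    push_cast
    congr 1
    refine Finset.sum_congr rfl fun k' _ => ?_
    rw [← hz]; ring
  have h2 : (∑ k', z j k' * (α k' : ℤ) - z j k : ℤ) ≠ 0 := by
    intro h
    rw [h] at h1
    simp [hN.ne', hne] at h1
  have h3 : (1 : ℝ) ≤ ‖(N : ℂ) * D.lam j α k‖ := by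
    rw [h1, Complex.norm_intCast]
    exact_mod_cast Int.one_le_abs h2
  rw [norm_mul, Complex.norm_natCast] at h3
  rw [div_le_iff₀ (by positivity)]; linarith

/-- the final algebraic consequence of the first integrals -/
theorem coeff_relation (P : Fin m → MvPolynomial (Fin m) ℂ)
    (hP : ∀ s y, ∑ k, MvPolynomial.eval y (P k) *
      MvPolynomial.eval y (MvPolynomial.pderiv k (D.L s)) = 0)
    (γ : Fin m → ℂ) (hγ : ∀ i, ∑ k, D.ρ i k * γ k = 0) (b : Fin m →₀ ℕ) :
    ∑ k, MvPolynomial.coeff (b + Finsupp.single k 1) (P k) * γ k = 0 := by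
  classical
  let T : MvPolynomial (Fin m) ℂ := ∑ k, MvPolynomial.C (γ k) *
    (P k * MvPolynomial.monomial (∑ k' ∈ Finset.univ.erase k, Finsupp.single k' 1) 1)
  have hev : ∀ y, MvPolynomial.eval y T =
      ∑ k, γ k * (MvPolynomial.eval y (P k) * ∏ k' ∈ Finset.univ.erase k, y k') := by
    intro y
    have : ∀ k : Fin m, MvPolynomial.monomial (∑ k' ∈ Finset.univ.erase k, Finsupp.single k' 1)
        (1 : ℂ) = ∏ k' ∈ Finset.univ.erase k, MvPolynomial.X k' := by
      intro k
      rw [MvPolynomial.monomial_sum_one]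
      rfl
    simp [T, this]
  have hT : T = 0 := by
    apply MvPolynomial.funext
    intro y
    rw [map_zero]
    have hc : Continuous fun y : Fin m → ℂ => MvPolynomial.eval y T :=
      MvPolynomial.continuous_eval T
    refine congrFun (hc.ext_on D.dense_good continuous_const (g := fun _ => 0) ?_) y
    rintro y ⟨hy0, hy⟩
    have h1 := D.span_lemma y hy0 hy (fun k => MvPolynomial.eval y (P k) / y k) (fun s => by
      rw [← hP s y]
      refine Finset.sum_congr rfl fun k _ => ?_
      have := hy0 k
      field_simp) γ hγ
    show MvPolynomial.eval y T = 0
    rw [hev]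
    have h2 := congrArg (fun x => x * ∏ k, y k) h1
    simp only [zero_mul, Finset.sum_mul] at h2
    rw [← h2]
    refine Finset.sum_congr rfl fun k _ => ?_
    rw [← Finset.mul_prod_erase Finset.univ y (Finset.mem_univ k)]
    have := hy0 k
    field_simp
  have h1 := congrArg (MvPolynomial.coeff (b + ∑ k, Finsupp.single k 1)) hT
  rw [MvPolynomial.coeff_zero, MvPolynomial.coeff_sum] at h1
  rw [← h1]
  refine Finset.sum_congr rfl fun k _ => ?_
  rw [MvPolynomial.coeff_C_mul, ← Finset.add_sum_erase Finset.univ _ (Finset.mem_univ k),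
    ← add_assoc, MvPolynomial.coeff_mul_monomial]
  ring

end Core
end
end GeomLin

namespace GeomLin
noncomputable section
open WA Filter Topology

variable {m n p q : ℕ}

theorem norm_update_zero_le (y : Fin m → ℂ) (k : Fin m) : ‖Function.update y k 0‖ ≤ ‖y‖ := by
  refine (pi_norm_le_iff_of_nonneg (norm_nonneg _)).2 fun j => ?_
  by_cases h : j = k
  · subst h; simp
  · simpa [h] using norm_le_pi_norm y j

theorem ev_sub_shift (y : Fin m → ℂ) (hy : ‖y‖ ≤ 1) (k : Fin m)
    (hy' : ‖Function.update y k 0‖ ≤ 1) (w : WA m) :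
    ev y hy (w - y k • shift k w) = ev (Function.update y k 0) hy' w := by
  rw [map_sub, map_smul, ev_apply, ev_apply, ev_apply, smul_eq_mul, ← tsum_mul_left]
  have h0 := (summable_term _ hy' w).of_norm
  have h1 := (summable_term y hy w).of_norm
  let f1 : (Fin m →₀ ℕ) → ℂ := fun α => if α k = 0 then 0 else w.cf α * mon y α
  have h2 : ∀ α, w.cf α * mon y α = w.cf α * mon (Function.update y k 0) α + f1 α := by
    intro α
    simp only [f1]
    have hm : ∀ z : Fin m → ℂ, mon z α = z k ^ α k * ∏ i ∈ Finset.univ.erase k, z i ^ α i :=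
      fun z => (Finset.mul_prod_erase Finset.univ (fun i => z i ^ α i) (Finset.mem_univ k)).symm
    have he : ∏ i ∈ Finset.univ.erase k, Function.update y k 0 i ^ α i =
        ∏ i ∈ Finset.univ.erase k, y i ^ α i :=
      Finset.prod_congr rfl fun i hi => by
        rw [Function.update_of_ne (Finset.ne_of_mem_erase hi)]
    rw [hm, hm, he]
    by_cases h : α k = 0
    · simp [h]
    · simp [h]
  have h3 : ∑' β, y k * ((shift k w).cf β * mon y β) = ∑' α, f1 α := by
    rw [← (inj_shift k).tsum_eq (f := f1)]
    · congr 1; funext β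
      simp [f1, cf_shift, mon_add, mon_single]
      ring
    · intro α hα
      have hk : α k ≠ 0 := by
        intro h
        exact hα (by simp [f1, h])
      refine ⟨α - Finsupp.single k 1, ?_⟩
      apply tsub_add_cancel_of_le
      rw [Finsupp.single_le_iff]; omega
  have h4 : Summable f1 := by
    have : f1 = fun α => w.cf α * mon y α - w.cf α * mon (Function.update y k 0) α := by
      funext α; rw [h2 α]; ring
    rw [this]; exact h1.sub h0
  rw [h3, tsum_congr h2, h0.tsum_add h4]
  ring

theorem exists_resolvent (s : Finset (Fin m)) :
    ∃ T : (Fin m → ℂ) → (WA m →L[ℂ] WA m), AnalyticAt ℂ T 0 ∧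
      ∀ᶠ z in 𝓝 0, ∀ hz hz' w, ev z hz w = ev (fun k => if k ∈ s then 0 else z k) hz' (T z w) := by
  classical
  induction s using Finset.induction_on with
  | empty =>
    refine ⟨fun _ => 1, analyticAt_const, Eventually.of_forall fun z hz hz' w => ?_⟩
    simp
  | insert k s hk ih =>
    obtain ⟨T, hT, h⟩ := ih
    have hA : AnalyticAt ℂ (fun z : Fin m → ℂ => Ring.inverse (1 - z k • shift (m := m) k)) 0 := by
      have h1 : AnalyticAt ℂ (fun z : Fin m → ℂ => z k • shift (m := m) k) 0 :=
        ((ContinuousLinearMap.proj (R := ℂ) (φ := fun _ : Fin m => ℂ) k).smulRight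
          (shift k)).analyticAt 0
      have h2 := analyticAt_inverse_one_sub ℂ (WA m →L[ℂ] WA m)
      exact h2.comp_of_eq h1 (zero_smul ℂ (shift (m := m) k))
    refine ⟨fun z => Ring.inverse (1 - z k • shift (m := m) k) * T z, hA.mul hT, ?_⟩
    have hsm : ∀ᶠ z : Fin m → ℂ in 𝓝 0, IsUnit (1 - z k • shift (m := m) k) := by
      have hc : Continuous fun z : Fin m → ℂ => 1 - z k • shift (m := m) k := by fun_prop
      have := hc.tendsto 0
      refine this.eventually ?_
      have h1 : (1 - (0 : Fin m → ℂ) k • shift (m := m) k) = 1 := by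
        rw [Pi.zero_apply]
        exact (congrArg (fun x => 1 - x) (zero_smul ℂ (shift (m := m) k))).trans (sub_zero _)
      rw [h1]
      exact Units.isOpen.mem_nhds isUnit_one
    filter_upwards [h, hsm] with z hz hu h1 h1' w
    have hzs : ‖(fun j => if j ∈ s then 0 else z j)‖ ≤ 1 := by
      refine (pi_norm_le_iff_of_nonneg zero_le_one).2 fun j => ?_
      split_ifs
      · simp
      · exact (norm_le_pi_norm z j).trans h1
    rw [hz h1 hzs w]
    have e : (fun j => if j ∈ insert k s then 0 else z j) =
        Function.update (fun j => if j ∈ s then 0 else z j) k 0 := by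
      funext j
      by_cases hj : j = k
      · subst hj; simp
      · simp [hj]
    set w' := (Ring.inverse (1 - z k • shift (m := m) k) * T z) w with hw'
    have h5 : T z w = w' - z k • shift k w' := by
      have h6 : (1 - z k • shift (m := m) k) * (Ring.inverse (1 - z k • shift (m := m) k) * T z)
          = T z := by
        rw [← mul_assoc, Ring.mul_inverse_cancel _ hu, one_mul]
      have := DFunLike.congr_fun h6 w
      rw [← this]
      rfl
    rw [h5]
    have h7 := ev_sub_shift (fun j => if j ∈ s then 0 else z j) hzs k (by rw [← e]; exact h1') w'
    simp only [hk, if_false] at h7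
    rw [h7]
    congr 2
    exact e.symm

theorem Rep.analyticAt {a : MvPowerSeries (Fin m) ℂ} {u : (Fin m → ℂ) → ℂ} (h : Rep a u) :
    AnalyticAt ℂ u 0 := by
  obtain ⟨r, hr, w, hw, hu⟩ := h
  obtain ⟨T, hT, hev⟩ := exists_resolvent (Finset.univ : Finset (Fin m))
  have h0 : ‖(0 : Fin m → ℂ)‖ ≤ 1 := by simp
  have hrc : (r : ℂ) ≠ 0 := by exact_mod_cast hr.ne'
  have h1 : AnalyticAt ℂ (fun z => ev 0 h0 (T z w)) 0 := by
    exact (((ev 0 h0).comp (ContinuousLinearMap.apply ℂ (WA m) w)).analyticAt _).comp hT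
  have h2 : AnalyticAt ℂ (fun x : Fin m → ℂ => (r : ℂ)⁻¹ • x) 0 :=
    ((r : ℂ)⁻¹ • ContinuousLinearMap.id ℂ (Fin m → ℂ)).analyticAt 0
  have h20 : (fun x : Fin m → ℂ => (r : ℂ)⁻¹ • x) 0 = 0 := by simp
  have h3 : AnalyticAt ℂ (fun x : Fin m → ℂ => ev 0 h0 (T ((r : ℂ)⁻¹ • x) w)) 0 := by
    exact h1.comp_of_eq h2 h20
  refine h3.congr ?_
  have ht : Tendsto (fun x : Fin m → ℂ => (r : ℂ)⁻¹ • x) (𝓝 0) (𝓝 0) := by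
    have := h2.continuousAt.tendsto
    rwa [smul_zero] at this
  have hb : ∀ᶠ z : Fin m → ℂ in 𝓝 0, ‖z‖ ≤ 1 := by
    filter_upwards [Metric.ball_mem_nhds (0 : Fin m → ℂ) one_pos] with z hz
    exact (mem_ball_zero_iff.1 hz).le
  filter_upwards [ht.eventually hev, ht.eventually hb] with x hx hx1
  have h4 := hu _ hx1
  rw [smul_smul, mul_inv_cancel₀ hrc, one_smul] at h4
  have e : (fun k => if k ∈ (Finset.univ : Finset (Fin m)) then 0 else ((r : ℂ)⁻¹ • x) k) = 0 := by
    funext k; simp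
  rw [h4, hx hx1 (by rw [e]; exact h0) w]
  simp only [e]

end
end GeomLin

namespace GeomLin
noncomputable section
open WA Filter Topology

variable {m n p q : ℕ}

theorem fp_small {E : Type*} [NormedAddCommGroup E] [CompleteSpace E] (Φ : E → E) (δ : ℝ)
    (hδ : 0 ≤ δ)
    (hL : ∀ x x', ‖x‖ ≤ δ → ‖x'‖ ≤ δ → ‖Φ x - Φ x'‖ ≤ 1 / 2 * ‖x - x'‖)
    (h0 : ‖Φ 0‖ ≤ δ / 2) : ∃ x, ‖x‖ ≤ δ ∧ Φ x = x := by
  have hmap : Set.MapsTo Φ (Metric.closedBall 0 δ) (Metric.closedBall 0 δ) := by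
    intro x hx
    rw [mem_closedBall_zero_iff] at hx ⊢
    have h1 := hL x 0 hx (by simpa using hδ)
    rw [sub_zero] at h1
    have h2 := norm_add_le (Φ x - Φ 0) (Φ 0)
    rw [sub_add_cancel] at h2
    linarith
  have hc : ContractingWith (1 / 2) (hmap.restrict Φ _ _) := by
    refine ⟨?_, ?_⟩
    · rw [← NNReal.coe_lt_coe]; norm_num
    · refine LipschitzWith.of_dist_le_mul fun x y => ?_
      rw [Subtype.dist_eq, Subtype.dist_eq, dist_eq_norm, dist_eq_norm]
      have := hL x.1 y.1 (mem_closedBall_zero_iff.1 x.2) (mem_closedBall_zero_iff.1 y.2)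
      simpa using this
  obtain ⟨y, hy, hfix, -⟩ := hc.exists_fixedPoint' Metric.isClosed_closedBall.isComplete hmap
    (x := 0) (Metric.mem_closedBall_self hδ) (edist_ne_top _ _)
  exact ⟨y, mem_closedBall_zero_iff.1 hy, hfix⟩

/-- the coordinate elements -/
def YY : Fin m → WA m := fun k => WA.mono (Finsupp.single k 1)

theorem norm_YY : ‖(YY : Fin m → WA m)‖ ≤ 1 :=
  (pi_norm_le_iff_of_nonneg zero_le_one).2 fun k => (norm_mono _).le

/-- the space of unknowns -/
abbrev Wsp (p m : ℕ) := (Fin m → WA m) × (Fin p → Fin p → WA m)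

/-- the nonlinear right hand side -/
def QQ (ρ : Fin p → Fin m → ℂ) (N : Fin p → Fin m → (Fin m → WA m) → WA m) (ε : ℝ)
    (x : Wsp p m) : Fin p → Fin m → WA m := fun j k =>
  ∑ i, (ρ i k • (x.2 j i * x.1 k) +
    ((if j = i then 1 else 0) + x.2 j i) * ((ε : ℂ)⁻¹ • N i k ((ε : ℂ) • (YY + x.1))))

theorem mul_diff_le (a b a' b' : WA m) :
    ‖a * b - a' * b'‖ ≤ ‖a‖ * ‖b - b'‖ + ‖a - a'‖ * ‖b'‖ := by
  have : a * b - a' * b' = a * (b - b') + (a - a') * b' := by ring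
  rw [this]
  exact (norm_add_le _ _).trans (add_le_add (norm_mul_le _ _) (norm_mul_le _ _))

theorem norm_fst_le' (x : Wsp p m) (k) : ‖x.1 k‖ ≤ ‖x‖ :=
  (norm_le_pi_norm x.1 k).trans (norm_fst_le x)

theorem norm_snd_le' (x : Wsp p m) (j i) : ‖x.2 j i‖ ≤ ‖x‖ :=
  ((norm_le_pi_norm (x.2 j) i).trans (norm_le_pi_norm x.2 j)).trans (norm_snd_le x)

theorem abstract_fp (ρ : Fin p → Fin m → ℂ) (N : Fin p → Fin m → (Fin m → WA m) → WA m)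
    (hN : ∀ i k, HasStrictFDerivAt (N i k) (0 : (Fin m → WA m) →L[ℂ] WA m) 0)
    (hN0 : ∀ i k, N i k 0 = 0)
    (S : (Fin p → Fin m → WA m) →L[ℂ] Wsp p m) (r : ℝ) (hr : 0 < r) :
    ∃ ε : ℝ, 0 < ε ∧ 2 * ε < r ∧ ∃ x : Wsp p m, ‖x‖ ≤ 1 ∧ S (QQ ρ N ε x) = x := by
  set K : ℝ := ‖S‖ + 1 with hK
  have hK1 : 1 ≤ K := by rw [hK]; linarith [norm_nonneg S]
  set P : ℝ := p + 1 with hP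
  have hP1 : 1 ≤ P := by rw [hP]; linarith [Nat.cast_nonneg (α := ℝ) p]
  set R : ℝ := ‖ρ‖ + 1 with hR
  have hR1 : 1 ≤ R := by rw [hR]; linarith [norm_nonneg ρ]
  have hρ : ∀ i k, ‖ρ i k‖ ≤ R := fun i k =>
    ((norm_le_pi_norm (ρ i) k).trans (norm_le_pi_norm ρ i)).trans (by rw [hR]; linarith)
  set δ : ℝ := 1 / (8 * K * P * R) with hδ
  have hδ0 : 0 < δ := by positivity
  have hδ1 : δ ≤ 1 := by
    rw [hδ, div_le_one (by positivity)]
    have h1 : 1 ≤ K * P := one_le_mul_of_one_le_of_one_le hK1 hP1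
    have h2 : 1 ≤ K * P * R := one_le_mul_of_one_le_of_one_le h1 hR1
    nlinarith
  set c : ℝ := δ / (16 * K * P) with hc
  have hc0 : 0 < c := by positivity
  -- Lipschitz radius
  have hlip : ∃ r0 : ℝ, 0 < r0 ∧ ∀ i k a b, ‖a‖ < r0 → ‖b‖ < r0 →
      ‖N i k a - N i k b‖ ≤ c * ‖a - b‖ := by
    have h1 : ∀ᶠ z : (Fin m → WA m) × (Fin m → WA m) in 𝓝 (0, 0), ∀ i k,
        ‖N i k z.1 - N i k z.2‖ ≤ c * ‖z.1 - z.2‖ := by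
      rw [eventually_all]; intro i
      rw [eventually_all]; intro k
      have := (hN i k).isLittleO.def hc0
      simpa using this
    obtain ⟨r0, hr0, h2⟩ := Metric.eventually_nhds_iff.1 h1
    refine ⟨r0, hr0, fun i k a b ha hb => h2 (y := (a, b)) ?_ i k⟩
    rw [Prod.dist_eq, max_lt_iff]
    simpa using ⟨ha, hb⟩
  obtain ⟨r0, hr0, hlip⟩ := hlip
  set ε : ℝ := min r r0 / 4 with hε
  have hmr : 0 < min r r0 := lt_min hr hr0
  have hε0 : 0 < ε := by positivity
  have hεr : 2 * ε < r := by have := min_le_left r r0; rw [hε]; linarith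
  have hεr0 : 2 * ε < r0 := by have := min_le_right r r0; rw [hε]; linarith
  have hεn : ‖(ε : ℂ)‖ = ε := by rw [Complex.norm_real, Real.norm_of_nonneg hε0.le]
  refine ⟨ε, hε0, hεr, ?_⟩
  let nn : Fin p → Fin m → (Fin m → WA m) → WA m := fun i k h =>
    (ε : ℂ)⁻¹ • N i k ((ε : ℂ) • (YY + h))
  have hYh : ∀ h : Fin m → WA m, ‖h‖ ≤ δ → ‖YY + h‖ ≤ 2 := fun h hh =>
    (norm_add_le _ _).trans (by linarith [norm_YY (m := m)])
  have hsm : ∀ h : Fin m → WA m, ‖h‖ ≤ δ → ‖(ε : ℂ) • (YY + h)‖ < r0 := by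
    intro h hh
    rw [norm_smul, hεn]
    have := mul_le_mul_of_nonneg_left (hYh h hh) hε0.le
    linarith
  have hnn1 : ∀ i k h h', ‖h‖ ≤ δ → ‖h'‖ ≤ δ → ‖nn i k h - nn i k h'‖ ≤ c * ‖h - h'‖ := by
    intro i k h h' hh hh'
    have h1 := hlip i k _ _ (hsm h hh) (hsm h' hh')
    rw [← smul_sub, add_sub_add_left_eq_sub, norm_smul, hεn] at h1
    show ‖(ε : ℂ)⁻¹ • _ - (ε : ℂ)⁻¹ • _‖ ≤ _
    rw [← smul_sub, norm_smul, norm_inv, hεn, inv_mul_le_iff₀ hε0]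
    linarith
  have hnn2 : ∀ i k h, ‖h‖ ≤ δ → ‖nn i k h‖ ≤ 2 * c := by
    intro i k h hh
    have h1 := hlip i k _ 0 (hsm h hh) (by simpa using hr0)
    rw [hN0, sub_zero, sub_zero, norm_smul, hεn] at h1
    show ‖(ε : ℂ)⁻¹ • _‖ ≤ _
    rw [norm_smul, norm_inv, hεn, inv_mul_le_iff₀ hε0]
    have h2 := mul_le_mul_of_nonneg_left (hYh h hh) (by positivity : 0 ≤ c * ε)
    nlinarith
  have hQ : ∀ x j k, QQ ρ N ε x j k = ∑ i, (ρ i k • (x.2 j i * x.1 k) +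
    ((if j = i then 1 else 0) + x.2 j i) * nn i k x.1) := fun x j k => rfl
  have hone : ∀ j i : Fin p, ‖(if j = i then 1 else 0 : WA m)‖ ≤ 1 := by
    intro j i; split_ifs
    · rw [norm_one]
    · simp
  have hQL : ∀ x x' : Wsp p m, ‖x‖ ≤ δ → ‖x'‖ ≤ δ →
      ‖QQ ρ N ε x - QQ ρ N ε x'‖ ≤ P * (2 * R * δ + 4 * c) * ‖x - x'‖ := by
    intro x x' hx hx'
    have hd : 0 ≤ P * (2 * R * δ + 4 * c) * ‖x - x'‖ := by positivity
    refine (pi_norm_le_iff_of_nonneg hd).2 fun j => (pi_norm_le_iff_of_nonneg hd).2 fun k => ?_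
    rw [Pi.sub_apply, Pi.sub_apply, hQ, hQ, ← Finset.sum_sub_distrib]
    have hterm : ∀ i ∈ (Finset.univ : Finset (Fin p)), ‖(ρ i k • (x.2 j i * x.1 k) +
        ((if j = i then 1 else 0) + x.2 j i) * nn i k x.1) - (ρ i k • (x'.2 j i * x'.1 k) +
        ((if j = i then 1 else 0) + x'.2 j i) * nn i k x'.1)‖ ≤
        (2 * R * δ + 4 * c) * ‖x - x'‖ := by
      intro i _
      have hx1 : ‖x.1‖ ≤ δ := (norm_fst_le x).trans hx
      have hx1' : ‖x'.1‖ ≤ δ := (norm_fst_le x').trans hx'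
      have hd1 : ‖x.1 k - x'.1 k‖ ≤ ‖x - x'‖ := norm_fst_le' (x - x') k
      have hd2 : ‖x.2 j i - x'.2 j i‖ ≤ ‖x - x'‖ := norm_snd_le' (x - x') j i
      have hd3 : ‖x.1 - x'.1‖ ≤ ‖x - x'‖ := norm_fst_le (x - x')
      have e1 : ‖ρ i k • (x.2 j i * x.1 k) - ρ i k • (x'.2 j i * x'.1 k)‖ ≤
          2 * R * δ * ‖x - x'‖ := by
        rw [← smul_sub, norm_smul]
        have h1 := mul_diff_le (x.2 j i) (x.1 k) (x'.2 j i) (x'.1 k)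
        have h2 : ‖x.2 j i‖ * ‖x.1 k - x'.1 k‖ ≤ δ * ‖x - x'‖ :=
          mul_le_mul ((norm_snd_le' x j i).trans hx) hd1 (norm_nonneg _) hδ0.le
        have h3 : ‖x.2 j i - x'.2 j i‖ * ‖x'.1 k‖ ≤ ‖x - x'‖ * δ :=
          mul_le_mul hd2 ((norm_fst_le' x' k).trans hx') (norm_nonneg _) (norm_nonneg _)
        calc _ ≤ R * (2 * δ * ‖x - x'‖) :=
              mul_le_mul (hρ i k) (by linarith) (norm_nonneg _) (by positivity)
          _ = _ := by ring
      have e2 : ‖((if j = i then 1 else 0) + x.2 j i) * nn i k x.1 -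
          ((if j = i then 1 else 0) + x'.2 j i) * nn i k x'.1‖ ≤ 4 * c * ‖x - x'‖ := by
        have h1 := mul_diff_le ((if j = i then 1 else 0) + x.2 j i) (nn i k x.1)
          ((if j = i then 1 else 0) + x'.2 j i) (nn i k x'.1)
        rw [add_sub_add_left_eq_sub] at h1
        have h2 : ‖(if j = i then 1 else 0) + x.2 j i‖ ≤ 2 :=
          (norm_add_le _ _).trans (by linarith [hone j i, (norm_snd_le' x j i).trans hx])
        have h3 : ‖(if j = i then 1 else 0) + x.2 j i‖ * ‖nn i k x.1 - nn i k x'.1‖ ≤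
            2 * (c * ‖x - x'‖) :=
          mul_le_mul h2 ((hnn1 i k _ _ hx1 hx1').trans
            (mul_le_mul_of_nonneg_left hd3 hc0.le)) (norm_nonneg _) (by norm_num)
        have h4 : ‖x.2 j i - x'.2 j i‖ * ‖nn i k x'.1‖ ≤ ‖x - x'‖ * (2 * c) :=
          mul_le_mul hd2 (hnn2 i k _ hx1') (norm_nonneg _) (norm_nonneg _)
        linarith
      rw [add_sub_add_comm]
      refine (norm_add_le _ _).trans ?_
      linarith
    refine (norm_sum_le_of_le _ hterm).trans ?_
    rw [Finset.sum_const, Finset.card_univ, Fintype.card_fin, nsmul_eq_mul, mul_assoc P]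
    refine mul_le_mul_of_nonneg_right (by rw [hP]; linarith) (by positivity)
  have hQ0 : ‖QQ ρ N ε 0‖ ≤ P * (2 * c) := by
    have hd : 0 ≤ P * (2 * c) := by positivity
    refine (pi_norm_le_iff_of_nonneg hd).2 fun j => (pi_norm_le_iff_of_nonneg hd).2 fun k => ?_
    rw [hQ]
    have hterm : ∀ i ∈ (Finset.univ : Finset (Fin p)), ‖ρ i k • ((0 : Wsp p m).2 j i *
        (0 : Wsp p m).1 k) + ((if j = i then 1 else 0) + (0 : Wsp p m).2 j i) *
        nn i k (0 : Wsp p m).1‖ ≤ 2 * c := by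
      intro i _
      have h1 : ρ i k • ((0 : Wsp p m).2 j i * (0 : Wsp p m).1 k) = 0 := by simp
      have h2 : (if j = i then 1 else 0) + (0 : Wsp p m).2 j i = (if j = i then 1 else 0) := by
        simp
      rw [h1, h2, zero_add]
      refine (norm_mul_le _ _).trans ?_
      have := mul_le_mul (hone j i) (hnn2 i k (0 : Wsp p m).1 (by simpa using hδ0.le))
        (norm_nonneg _) (by norm_num)
      linarith
    refine (norm_sum_le_of_le _ hterm).trans ?_
    rw [Finset.sum_const, Finset.card_univ, Fintype.card_fin, nsmul_eq_mul]
    refine mul_le_mul_of_nonneg_right (by rw [hP]; linarith) (by positivity)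
  have hSK : ∀ v, ‖S v‖ ≤ K * ‖v‖ := fun v =>
    (S.le_opNorm v).trans (mul_le_mul_of_nonneg_right (by rw [hK]; linarith) (norm_nonneg _))
  have hKP : K * P * (2 * R * δ) = 1 / 4 := by rw [hδ]; field_simp; norm_num
  have hKc : K * P * c = δ / 16 := by rw [hc]; field_simp
  obtain ⟨x, hx, hfix⟩ := fp_small (fun x => S (QQ ρ N ε x)) δ hδ0.le (fun x x' hx hx' => by
      rw [← map_sub]
      calc _ ≤ K * (P * (2 * R * δ + 4 * c) * ‖x - x'‖) :=
            (hSK _).trans (mul_le_mul_of_nonneg_left (hQL x x' hx hx') (by positivity))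
        _ = (K * P * (2 * R * δ) + 4 * (K * P * c)) * ‖x - x'‖ := by ring
        _ ≤ 1 / 2 * ‖x - x'‖ := by
            refine mul_le_mul_of_nonneg_right ?_ (norm_nonneg _)
            rw [hKP, hKc]; linarith) (by
      calc _ ≤ K * (P * (2 * c)) := (hSK _).trans (mul_le_mul_of_nonneg_left hQ0 (by positivity))
        _ = 2 * (K * P * c) := by ring
        _ ≤ δ / 2 := by rw [hKc]; linarith)
  exact ⟨x, hx.trans hδ1, hfix⟩

end
end GeomLin

namespace GeomLin
noncomputable section
open WA Filter Topology

variable {m n p q : ℕ}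

theorem cf_mul_mono (a : WA m) (k : Fin m) (α : Fin m →₀ ℕ) :
    (a * WA.mono (Finsupp.single k 1)).cf α =
      if Finsupp.single k 1 ≤ α then a.cf (α - Finsupp.single k 1) else 0 := by
  classical
  have h : (WA.mono (Finsupp.single k 1) : WA m).toPS = MvPowerSeries.monomial (Finsupp.single k 1) 1 := by
    ext β
    rw [MvPowerSeries.coeff_monomial]
    rfl
  have h1 := congrArg (MvPowerSeries.coeff α) (toPS_mul a (WA.mono (Finsupp.single k 1)))
  rw [h, MvPowerSeries.coeff_mul_monomial] at h1
  simp only [mul_one] at h1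
  exact h1

theorem Rep.apply_zero {a : MvPowerSeries (Fin m) ℂ} {u : (Fin m → ℂ) → ℂ} (h : Rep a u) :
    u 0 = MvPowerSeries.coeff 0 a := by
  obtain ⟨r, hr, hs, hu⟩ := h.unfold
  rw [hu 0 (by simpa using hr.le), tsum_eq_single 0]
  · simp [mon_zero]
  · intro α hα
    have : ∃ k, α k ≠ 0 := by
      by_contra hh
      push Not at hh
      exact hα (Finsupp.ext hh)
    obtain ⟨k, hk⟩ := this
    have : mon (0 : Fin m → ℂ) α = 0 := by
      rw [mon]
      exact Finset.prod_eq_zero (Finset.mem_univ k) (by simp [hk])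
    rw [this, mul_zero]

/-- scaled evaluation -/
def evs (ε : ℝ) (w : WA m) (x : Fin m → ℂ) : ℂ :=
  if h : ‖(ε : ℂ)⁻¹ • x‖ ≤ 1 then ev _ h w else 0

theorem evs_smul (ε : ℝ) (hε : 0 < ε) (w : WA m) (y : Fin m → ℂ) (hy : ‖y‖ ≤ 1) :
    evs ε w ((ε : ℂ) • y) = ev y hy w := by
  have hrc : (ε : ℂ) ≠ 0 := by exact_mod_cast hε.ne'
  have h1 : (ε : ℂ)⁻¹ • ((ε : ℂ) • y) = y := by
    rw [smul_smul, inv_mul_cancel₀ hrc, one_smul]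
  rw [evs, dif_pos (by rw [h1]; exact hy)]
  simp only [h1]

/-- scaled power series -/
def sps (ε : ℝ) (w : WA m) : MvPowerSeries (Fin m) ℂ := fun α => w.cf α * ((ε : ℂ) ^ α.degree)⁻¹

theorem coeff_sps (ε : ℝ) (w : WA m) (α) :
    MvPowerSeries.coeff α (sps ε w) = w.cf α * ((ε : ℂ) ^ α.degree)⁻¹ := rfl

theorem rep_evs (ε : ℝ) (hε : 0 < ε) (w : WA m) : Rep (sps ε w) (evs ε w) :=
  Rep.ev_scaled w ε hε _ fun y hy => evs_smul ε hε w y hy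

/-- the Euler-type operator on power series -/
def eul (v : Fin m → ℂ) (a : MvPowerSeries (Fin m) ℂ) : MvPowerSeries (Fin m) ℂ :=
  fun α => wt v α * MvPowerSeries.coeff α a

theorem coeff_eul (v : Fin m → ℂ) (a : MvPowerSeries (Fin m) ℂ) (α) :
    MvPowerSeries.coeff α (eul v a) = wt v α * MvPowerSeries.coeff α a := rfl

namespace Core
variable (D : Core p q m)

/-- `j` is the first index with nonzero eigenvalue, and the degree is at least two -/
def sel (j : Fin p) (k : Fin m) (α : Fin m →₀ ℕ) : Prop :=
  2 ≤ α.degree ∧ D.lam j α k ≠ 0 ∧ ∀ j' < j, D.lam j' α k = 0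

open Classical in
/-- inverse of the homological operator -/
def cc (j : Fin p) (k : Fin m) (α : Fin m →₀ ℕ) : ℂ := if D.sel j k α then (D.lam j α k)⁻¹ else 0

/-- invariant monomials of positive degree -/
def Inv (β : Fin m →₀ ℕ) : Prop := β ≠ 0 ∧ ∀ l, wt (D.ρ l) β = 0

open Classical in
/-- indicator of the invariant monomials -/
def ind (β : Fin m →₀ ℕ) : ℂ := if D.Inv β then 1 else 0

theorem ind_bound (β) : ‖D.ind β‖ ≤ 1 := by
  rw [ind]; split_ifs <;> simp

theorem exists_fixed : ∃ (ε : ℝ) (h : Fin m → WA m) (g : Fin p → Fin p → WA m)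
    (Q : Fin p → Fin m → WA m), 0 < ε ∧
    (∀ k α, (h k).cf α = ∑ j, D.cc j k α * (Q j k).cf α) ∧
    (∀ j i β, (g j i).cf β = - (D.ind β * (Q j (D.κ i)).cf (β + Finsupp.single (D.κ i) 1))) ∧
    (∀ j k y hy, ev y hy (Q j k) = ∑ i, (D.ρ i k * (ev y hy (g j i) * ev y hy (h k)) +
      ((if j = i then 1 else 0) + ev y hy (g j i)) * ((ε : ℂ)⁻¹ *
        (D.X i ((ε : ℂ) • (fun k => y k + ev y hy (h k))) k -
          D.ρ i k * (ε * (y k + ev y hy (h k))))))) := by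
  obtain ⟨c, hc, hlow⟩ := D.lower_bound
  have hcc : ∀ j k α, ‖D.cc j k α‖ ≤ c⁻¹ := by
    intro j k α
    rw [cc]
    split_ifs with h
    · rw [norm_inv]
      exact inv_anti₀ hc (hlow _ _ _ h.2.1)
    · simpa using hc.le
  -- the nonlinear parts
  have hu : ∀ i k, AnalyticAt ℂ (fun x : Fin m → ℂ => D.X i x k - D.ρ i k * x k) 0 := by
    intro i k
    have h1 : AnalyticAt ℂ (fun x => D.X i x k) 0 :=
      ((ContinuousLinearMap.proj (R := ℂ) (φ := fun _ : Fin m => ℂ) k).analyticAt _).comp (D.hX i)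
    have h2 : AnalyticAt ℂ (fun x : Fin m → ℂ => x k) 0 :=
      (ContinuousLinearMap.proj (R := ℂ) (φ := fun _ : Fin m => ℂ) k).analyticAt _
    exact h1.sub (analyticAt_const.mul h2)
  have hfd : ∀ i k v, fderiv ℂ (fun x : Fin m → ℂ => D.X i x k - D.ρ i k * x k) 0 v = 0 := by
    intro i k v
    have h1 : HasFDerivAt (fun x => D.X i x k)
        ((ContinuousLinearMap.proj (R := ℂ) (φ := fun _ : Fin m => ℂ) k).comp
          (fderiv ℂ (D.X i) 0)) 0 :=
      (ContinuousLinearMap.proj (R := ℂ) (φ := fun _ : Fin m => ℂ) k).hasFDerivAt.comp 0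
        (D.hX i).differentiableAt.hasFDerivAt
    have h2 : HasFDerivAt (fun x : Fin m → ℂ => D.ρ i k * x k)
        (D.ρ i k • ContinuousLinearMap.proj (R := ℂ) (φ := fun _ : Fin m => ℂ) k) 0 :=
      (ContinuousLinearMap.proj (R := ℂ) (φ := fun _ : Fin m => ℂ) k).hasFDerivAt.const_mul _
    rw [(h1.fun_sub h2).fderiv]
    simp [D.hDX]
  choose N hN1 hN2 r hr hN3 using fun i k => functional_calculus m _ (hu i k)
  have hr' : ∃ r0 : ℝ, 0 < r0 ∧ ∀ i k, r0 ≤ r i k := by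
    have : ∀ᶠ t in 𝓝[>] (0:ℝ), ∀ i k, t ≤ r i k := by
      rw [eventually_all]; intro i
      rw [eventually_all]; intro k
      exact (eventually_le_nhds (hr i k)).filter_mono nhdsWithin_le_nhds
    obtain ⟨t, ht, ht0⟩ := (this.and eventually_mem_nhdsWithin).exists
    exact ⟨t, ht0, ht⟩
  obtain ⟨r0, hr0, hr0'⟩ := hr'
  let S : (Fin p → Fin m → WA m) →L[ℂ] Wsp p m :=
    ContinuousLinearMap.prod
      (ContinuousLinearMap.pi fun k => ∑ j, (WA.mult (D.cc j k) c⁻¹ (hcc j k)).comp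
        ((ContinuousLinearMap.proj (R := ℂ) (φ := fun _ : Fin m => WA m) k).comp
          (ContinuousLinearMap.proj (R := ℂ) (φ := fun _ : Fin p => Fin m → WA m) j)))
      (ContinuousLinearMap.pi fun j => ContinuousLinearMap.pi fun i =>
        -((WA.mult D.ind 1 D.ind_bound).comp ((WA.shift (D.κ i)).comp
        ((ContinuousLinearMap.proj (R := ℂ) (φ := fun _ : Fin m => WA m) (D.κ i)).comp
          (ContinuousLinearMap.proj (R := ℂ) (φ := fun _ : Fin p => Fin m → WA m) j)))))
  obtain ⟨ε, hε, hεr, x, hx, hfix⟩ := abstract_fp D.ρ N (fun i k => by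
      have := hN1 i k
      have h0 : ∑ k', fderiv ℂ (fun x : Fin m → ℂ => D.X i x k - D.ρ i k * x k) 0
          (Pi.single k' 1) • ContinuousLinearMap.proj (R := ℂ) (φ := fun _ : Fin m => WA m) k' = 0 :=
        Finset.sum_eq_zero fun k' _ => by
          rw [hfd]
          exact zero_smul ℂ
            (ContinuousLinearMap.proj (R := ℂ) (φ := fun _ : Fin m => WA m) k')
      exact h0 ▸ this) (fun i k => by rw [hN2]; simp [D.hX0]) S r0 hr0
  refine ⟨ε, x.1, x.2, QQ D.ρ N ε x, hε, ?_, ?_, ?_⟩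
  · intro k α
    conv_lhs => rw [← hfix]
    show ((∑ j, (WA.mult (D.cc j k) c⁻¹ (hcc j k)).comp
        ((ContinuousLinearMap.proj (R := ℂ) (φ := fun _ : Fin m => WA m) k).comp
          (ContinuousLinearMap.proj (R := ℂ) (φ := fun _ : Fin p => Fin m → WA m) j))) _).cf α = _
    rw [sum_apply, cf_finset_sum]
    rfl
  · intro j i β
    conv_lhs => rw [← hfix]
    show (-(WA.mult D.ind 1 D.ind_bound (WA.shift (D.κ i) _))).cf β = _
    rw [cf_neg, cf_mult, cf_shift]
    rfl
  · intro j k y hy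
    have hnorm : ‖(ε : ℂ) • (YY + x.1)‖ < r0 := by
      rw [norm_smul, Complex.norm_real, Real.norm_of_nonneg hε.le]
      have h1 : ‖(YY : Fin m → WA m) + x.1‖ ≤ 2 :=
        (norm_add_le _ _).trans (by linarith [norm_YY (m := m), (norm_fst_le x).trans hx])
      have := mul_le_mul_of_nonneg_left h1 hε.le
      linarith
    rw [QQ, map_sum]
    refine Finset.sum_congr rfl fun i _ => ?_
    rw [map_add, map_smul, ev_mul, ev_mul, map_smul, smul_eq_mul, smul_eq_mul, map_add,
      hN3 i k _ (hnorm.trans_le (hr0' i k)) y hy]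
    have e1 : (fun k => ev y hy (((ε : ℂ) • (YY + x.1) : Fin m → WA m) k)) =
        (ε : ℂ) • (fun k => y k + ev y hy (x.1 k)) := by
      funext k
      rw [Pi.smul_apply, map_smul, Pi.add_apply, map_add, YY, ev_mono, mon_single]
      rfl
    have e2 : ev y hy (if j = i then 1 else 0) = if j = i then 1 else 0 := by
      split_ifs
      · exact ev_one y hy
      · exact map_zero _
    rw [e1, e2]
    rfl

theorem exists_solution : ∃ (ψ : (Fin m → ℂ) → Fin m → ℂ) (g : Fin p → Fin p → (Fin m → ℂ) → ℂ)
    (e : Fin p → Fin m → MvPowerSeries (Fin m) ℂ),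
    AnalyticAt ℂ ψ 0 ∧ ψ 0 = 0 ∧ (∀ v, fderiv ℂ ψ 0 v = v) ∧
    (∀ j i, AnalyticAt ℂ (g j i) 0) ∧ (∀ j i, g j i 0 = if j = i then 1 else 0) ∧
    (∀ l j i, ∀ᶠ y in 𝓝 0, fderiv ℂ (g j i) y (fun k => D.ρ l k * y k) = 0) ∧
    (∀ j k, Rep (e j k) (fun y => fderiv ℂ ψ y (fun k' => D.ρ j k' * y k') k -
      ∑ i, g j i y * D.X i (ψ y) k)) ∧
    (∀ j k α, D.sel j k α → MvPowerSeries.coeff α (e j k) = 0) ∧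
    (∀ j i β, D.Inv β →
      MvPowerSeries.coeff (β + Finsupp.single (D.κ i) 1) (e j (D.κ i)) = 0) := by
  obtain ⟨ε, h, g, Q, hε, hh, hg, hQ⟩ := D.exists_fixed
  have hεc : (ε : ℂ) ≠ 0 := by exact_mod_cast hε.ne'
  let w : Fin m → WA m := fun k => WA.mono (Finsupp.single k 1) + h k
  let gw : Fin p → Fin p → WA m := fun j i => (if j = i then 1 else 0) + g j i
  let ψ : (Fin m → ℂ) → Fin m → ℂ := fun x k => ε * evs ε (w k) x
  let G : Fin p → Fin p → (Fin m → ℂ) → ℂ := fun j i => evs ε (gw j i)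
  have hψrep : ∀ k, Rep ((ε : ℂ) • sps ε (w k)) (fun x => ψ x k) := fun k =>
    (rep_evs ε hε (w k)).const_mul (ε : ℂ)
  have hψan : AnalyticAt ℂ ψ 0 := by
    rw [analyticAt_pi_iff]
    exact fun k => (hψrep k).analyticAt
  have hGrep : ∀ j i, Rep (sps ε (gw j i)) (G j i) := fun j i => rep_evs ε hε _
  let B : Fin p → Fin m → WA m := fun j k => Q j k + D.ρ j k • w k +
    ∑ i, D.ρ i k • (g j i * WA.mono (Finsupp.single k 1))
  have hlow : ∀ k α, α.degree < 2 → (h k).cf α = 0 := by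
    intro k α hα
    rw [hh]
    refine Finset.sum_eq_zero fun j _ => ?_
    rw [cc, if_neg (fun hs => by have := hs.1; omega), zero_mul]
  have hwlow : ∀ k α, α.degree < 2 → (w k).cf α = if α = Finsupp.single k 1 then 1 else 0 := by
    intro k α hα
    show (WA.mono (Finsupp.single k 1) + h k).cf α = _
    rw [cf_add, hlow k α hα, add_zero, cf_mono]
  have hE : ∀ j k, Rep (eul (D.ρ j) ((ε : ℂ) • sps ε (w k)) -
      (ε : ℂ) • sps ε (B j k)) (fun y => fderiv ℂ ψ y (fun k' => D.ρ j k' * y k') k -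
      ∑ i, G j i y * D.X i (ψ y) k) := by
    intro j k
    have h1 := (hψrep k).euler ((hψrep k).analyticAt.eventually_analyticAt.mono
      fun y hy => hy.differentiableAt) (D.ρ j)
    have h2 := (rep_evs ε hε (B j k)).const_mul (ε : ℂ)
    refine (h1.sub h2).congr ?_
    have hball : ∀ᶠ x : Fin m → ℂ in 𝓝 0, ‖(ε : ℂ)⁻¹ • x‖ ≤ 1 := by
      filter_upwards [Metric.ball_mem_nhds (0 : Fin m → ℂ) hε] with x hx
      rw [norm_smul, norm_inv, Complex.norm_real, Real.norm_of_nonneg hε.le,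
        inv_mul_le_iff₀ hε, mul_one]
      exact (mem_ball_zero_iff.1 hx).le
    filter_upwards [hball, hψan.eventually_analyticAt] with x hx hxa
    congr 1
    · have := (hasFDerivAt_pi'.1 hxa.differentiableAt.hasFDerivAt) k
      rw [this.fderiv]
      rfl
    · obtain ⟨y, rfl⟩ : ∃ y, x = (ε : ℂ) • y := ⟨(ε : ℂ)⁻¹ • x, by
        rw [smul_smul, mul_inv_cancel₀ hεc, one_smul]⟩
      have hy : ‖y‖ ≤ 1 := by
        rwa [smul_smul, inv_mul_cancel₀ hεc, one_smul] at hx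
      have hw : ∀ k, evs ε (w k) ((ε : ℂ) • y) = y k + ev y hy (h k) := by
        intro k
        rw [evs_smul ε hε _ y hy, map_add, ev_mono, mon_single]
      have hψy : ψ ((ε : ℂ) • y) = (ε : ℂ) • (fun k => y k + ev y hy (h k)) := by
        funext k
        show (ε : ℂ) * _ = _
        rw [hw]; rfl
      have hGy : ∀ i, G j i ((ε : ℂ) • y) = (if j = i then 1 else 0) + ev y hy (g j i) := by
        intro i
        show evs ε _ _ = _
        rw [evs_smul ε hε _ y hy, map_add]
        congr 1
        split_ifs
        · exact ev_one y hy
        · exact map_zero _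
      simp only [hGy]
      rw [hψy, evs_smul ε hε _ y hy]
      have hB : ev y hy (B j k) = ev y hy (Q j k) + D.ρ j k * (y k + ev y hy (h k)) +
          ∑ i, D.ρ i k * (ev y hy (g j i) * y k) := by
        show ev y hy (Q j k + D.ρ j k • w k +
          ∑ i, D.ρ i k • (g j i * WA.mono (Finsupp.single k 1))) = _
        rw [map_add, map_add, map_smul, map_sum, smul_eq_mul, map_add, ev_mono, mon_single]
        congr 1
        refine Finset.sum_congr rfl fun i _ => ?_
        rw [map_smul, ev_mul, ev_mono, mon_single, smul_eq_mul]
      have hδ : D.ρ j k * (y k + ev y hy (h k)) =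
          ∑ i, (if j = i then 1 else 0) * (D.ρ i k * (y k + ev y hy (h k))) := by
        simp
      rw [hB, hQ, hδ, ← Finset.sum_add_distrib, ← Finset.sum_add_distrib, Finset.mul_sum]
      refine Finset.sum_congr rfl fun i _ => ?_
      field_simp
      ring
  have hcoeff : ∀ j k α, (D.lam j α k * (w k).cf α = (Q j k).cf α +
      ∑ i, D.ρ i k * (g j i * WA.mono (Finsupp.single k 1)).cf α) →
      MvPowerSeries.coeff α (eul (D.ρ j) ((ε : ℂ) • sps ε (w k)) -
      (ε : ℂ) • sps ε (B j k)) = 0 := by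
    intro j k α hyp
    have hBc : (B j k).cf α = (Q j k).cf α + D.ρ j k * (w k).cf α +
        ∑ i, D.ρ i k * (g j i * WA.mono (Finsupp.single k 1)).cf α := by
      show (Q j k + D.ρ j k • w k +
          ∑ i, D.ρ i k • (g j i * WA.mono (Finsupp.single k 1))).cf α = _
      rw [cf_add, cf_add, cf_smul, cf_finset_sum]
      congr 1
    have hsm : ∀ v : WA m, MvPowerSeries.coeff α ((ε : ℂ) • sps ε v) =
        (ε : ℂ) * (v.cf α * ((ε : ℂ) ^ α.degree)⁻¹) := fun v => rfl
    rw [map_sub, hsm]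
    show wt (D.ρ j) α * MvPowerSeries.coeff α ((ε : ℂ) • sps ε (w k)) - _ = 0
    rw [hsm, hBc]
    rw [lam] at hyp
    linear_combination (ε : ℂ) * ((ε : ℂ) ^ α.degree)⁻¹ * hyp
  refine ⟨ψ, G, _, hψan, ?_, ?_, fun j i => (hGrep j i).analyticAt, ?_, ?_, hE, ?_, ?_⟩
  · funext k
    rw [(hψrep k).apply_zero]
    show (ε : ℂ) * ((w k).cf 0 * _) = 0
    rw [hwlow k 0 (by simp), if_neg]
    · simp
    · intro h0
      have := DFunLike.congr_fun h0 k
      simp at this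
  · intro v
    funext k
    have h1 := (hasFDerivAt_pi'.1 hψan.differentiableAt.hasFDerivAt) k
    have h2 : fderiv ℂ ψ 0 v k = fderiv ℂ (fun x => ψ x k) 0 v := by
      rw [h1.fderiv]; rfl
    rw [h2, fderiv_eq_sum]
    have h3 : ∀ k', fderiv ℂ (fun x => ψ x k) 0 (Pi.single k' 1) = if k' = k then 1 else 0 := by
      intro k'
      have h4 := ((hψrep k).partial (hψrep k).analyticAt k').apply_zero
      rw [h4, coeff_pd]
      have h5 : MvPowerSeries.coeff (0 + Finsupp.single k' 1) ((ε : ℂ) • sps ε (w k)) =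
        (ε : ℂ) * ((w k).cf (0 + Finsupp.single k' 1) *
          ((ε : ℂ) ^ (0 + Finsupp.single k' 1 : Fin m →₀ ℕ).degree)⁻¹) := rfl
      rw [h5, zero_add, hwlow _ _ (by simp), Finsupp.degree_single]
      have h6 : (Finsupp.single k' 1 = (Finsupp.single k 1 : Fin m →₀ ℕ)) ↔ k' = k :=
        Finsupp.single_left_inj one_ne_zero
      by_cases hk : k' = k
      · simp [hk, hεc]
      · simp [h6, hk]
    simp [h3]
  · intro j i
    rw [(hGrep j i).apply_zero, coeff_sps]
    show ((if j = i then 1 else 0) + g j i : WA m).cf 0 * _ = _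
    have hi0 : D.ind 0 = 0 := if_neg (fun hi => hi.1 rfl)
    rw [cf_add, hg, hi0]
    split_ifs
    · simp [cf_one]
    · simp
  · intro l j i
    have h1 := (hGrep j i).euler ((hGrep j i).analyticAt.eventually_analyticAt.mono
      fun y hy => hy.differentiableAt) (D.ρ l)
    refine Rep.eventually_zero (u := fun y => fderiv ℂ (G j i) y (fun k => D.ρ l k * y k)) ?_
    suffices h0 : (0 : MvPowerSeries (Fin m) ℂ) = eul (D.ρ l) (sps ε (gw j i)) by
      rw [h0]; exact h1
    ext α
    show 0 = wt (D.ρ l) α * (((if j = i then 1 else 0) + g j i : WA m).cf α * _)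
    by_cases hα : wt (D.ρ l) α = 0
    · rw [hα, zero_mul]
    · have hi0 : D.ind α = 0 := if_neg (fun hi => hα (hi.2 l))
      rw [cf_add, hg, hi0]
      have h0 : α ≠ 0 := by
        rintro rfl
        exact hα (by simp [wt])
      have : ((if j = i then 1 else 0) : WA m).cf α = 0 := by
        split_ifs
        · simp [cf_one, h0]
        · simp
      rw [this]; simp
  · intro j k α hsel
    apply hcoeff
    have h1 : (w k).cf α = (D.lam j α k)⁻¹ * (Q j k).cf α := by
      show (WA.mono (Finsupp.single k 1) + h k).cf α = _
      rw [cf_add, cf_mono, if_neg, zero_add, hh, Finset.sum_eq_single j]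
      · rw [cc, if_pos hsel]
      · intro j' _ hj'
        rw [cc, if_neg, zero_mul]
        intro hs
        rcases lt_or_gt_of_ne hj' with h1 | h1
        · exact hs.2.1 (hsel.2.2 j' h1)
        · exact hsel.2.1 (hs.2.2 j h1)
      · simp
      · rintro rfl
        have := hsel.1
        simp at this
    rw [h1, ← mul_assoc, mul_inv_cancel₀ hsel.2.1, one_mul, Finset.sum_eq_zero, add_zero]
    intro i _
    rw [cf_mul_mono]
    split_ifs with hle
    · rw [hg, ind, if_neg]
      · simp
      · intro hi
        have h2 := hi.2 j
        apply hsel.2.1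
        rw [lam]
        have h3 : wt (D.ρ j) α = wt (D.ρ j) (α - Finsupp.single k 1) + D.ρ j k := by
          conv_lhs => rw [← tsub_add_cancel_of_le hle]
          simp [wt, mul_add, Finset.sum_add_distrib, Finsupp.single_apply]
        rw [h3, h2]; ring
    · simp
  · intro j i β hβ
    apply hcoeff
    have h1 : D.lam j (β + Finsupp.single (D.κ i) 1) (D.κ i) = 0 := by
      have : wt (D.ρ j) (β + Finsupp.single (D.κ i) 1) = wt (D.ρ j) β + D.ρ j (D.κ i) := by
        simp [wt, mul_add, Finset.sum_add_distrib, Finsupp.single_apply]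
      rw [lam, this, hβ.2]; ring
    rw [h1, zero_mul]
    have h2 : ∀ i', (g j i' * WA.mono (Finsupp.single (D.κ i) 1)).cf
        (β + Finsupp.single (D.κ i) 1) = (g j i').cf β := by
      intro i'
      rw [cf_mul_mono, if_pos le_add_self, add_tsub_cancel_right]
    simp only [h2, D.hκ]
    simp only [ite_mul, one_mul, zero_mul, Finset.sum_ite_eq', Finset.mem_univ, if_true]
    rw [hg, ind, if_pos hβ]; ring

end Core
end
end GeomLin

namespace GeomLin
noncomputable section
open WA Filter Topology

variable {m n p q : ℕ}

/-- A solution of the projected equations. -/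
structure Sol (D : Core p q m) where
  ψ : (Fin m → ℂ) → Fin m → ℂ
  g : Fin p → Fin p → (Fin m → ℂ) → ℂ
  e : Fin p → Fin m → MvPowerSeries (Fin m) ℂ
  hψ : AnalyticAt ℂ ψ 0
  hψ0 : ψ 0 = 0
  hDψ : ∀ v, fderiv ℂ ψ 0 v = v
  hg : ∀ j i, AnalyticAt ℂ (g j i) 0
  hg0 : ∀ j i, g j i 0 = if j = i then 1 else 0
  hginv : ∀ l j i, ∀ᶠ y in 𝓝 0, fderiv ℂ (g j i) y (fun k => D.ρ l k * y k) = 0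
  hE : ∀ j k, Rep (e j k) (fun y => fderiv ℂ ψ y (fun k' => D.ρ j k' * y k') k -
      ∑ i, g j i y * D.X i (ψ y) k)
  hsel : ∀ j k α, D.sel j k α → MvPowerSeries.coeff α (e j k) = 0
  hInv : ∀ j i β, D.Inv β →
      MvPowerSeries.coeff (β + Finsupp.single (D.κ i) 1) (e j (D.κ i)) = 0

theorem Core.exists_sol (D : Core p q m) : Nonempty (Sol D) := by
  obtain ⟨ψ, g, e, h1, h2, h3, h4, h5, h6, h7, h8, h9⟩ := D.exists_solution
  exact ⟨⟨ψ, g, e, h1, h2, h3, h4, h5, h6, h7, h8, h9⟩⟩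

theorem tendsto_clm_apply {ι : Type*} {l : Filter ι} {T : ι → (Fin m → ℂ) →L[ℂ] (Fin n → ℂ)}
    {v : ι → Fin m → ℂ} {T0 : (Fin m → ℂ) →L[ℂ] (Fin n → ℂ)} {v0 : Fin m → ℂ}
    (hT : Tendsto T l (𝓝 T0)) (hv : Tendsto v l (𝓝 v0)) :
    Tendsto (fun t => T t (v t)) l (𝓝 (T0 v0)) :=
  (isBoundedBilinearMap_apply.continuous.tendsto (T0, v0)).comp (hT.prodMk_nhds hv)

namespace Sol
variable {D : Core p q m} (S : Sol D)

/-- the defect -/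
def E (j : Fin p) (y : Fin m → ℂ) (k : Fin m) : ℂ :=
  fderiv ℂ S.ψ y (fun k' => D.ρ j k' * y k') k - ∑ i, S.g j i y * D.X i (S.ψ y) k

theorem repE (j k) : Rep (S.e j k) (fun y => S.E j y k) := S.hE j k

theorem E_eq (j : Fin p) (y : Fin m → ℂ) :
    fderiv ℂ S.ψ y (fun k' => D.ρ j k' * y k') = S.E j y + ∑ i, S.g j i y • D.X i (S.ψ y) := by
  funext k
  rw [Pi.add_apply, Finset.sum_apply]
  simp [E]

theorem ψ_tendsto : Tendsto S.ψ (𝓝 0) (𝓝 0) := by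
  have := S.hψ.continuousAt.tendsto
  rwa [S.hψ0] at this

theorem fderiv_coord (y v) (h : DifferentiableAt ℂ S.ψ y) (k : Fin m) :
    fderiv ℂ S.ψ y v k = fderiv ℂ (fun x => S.ψ x k) y v := by
  rw [((hasFDerivAt_pi'.1 h.hasFDerivAt) k).fderiv]; rfl

/-- the first commutation: second Lie derivatives of `ψ` commute. -/
theorem lie_symm (j l : Fin p) (k : Fin m) : ∀ᶠ y in 𝓝 0,
    fderiv ℂ (fun y => fderiv ℂ S.ψ y (fun k' => D.ρ j k' * y k') k) y (fun k => D.ρ l k * y k) =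
    fderiv ℂ (fun y => fderiv ℂ S.ψ y (fun k' => D.ρ l k' * y k') k) y (fun k => D.ρ j k * y k) := by
  have han : AnalyticAt ℂ (fun x => S.ψ x k) 0 := (analyticAt_pi_iff.1 S.hψ) k
  obtain ⟨s, hs⟩ := Rep.exists _ han
  have h1 : ∀ j, Rep (eul (D.ρ j) s) (fun y => fderiv ℂ S.ψ y (fun k' => D.ρ j k' * y k') k) := by
    intro j
    refine Rep.congr (hs.euler (han.eventually_analyticAt.mono
      fun y hy => hy.differentiableAt) (D.ρ j)) ?_
    filter_upwards [S.hψ.eventually_analyticAt] with y hy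
    exact (S.fderiv_coord y _ hy.differentiableAt k).symm
  have h2 : ∀ j l, Rep (eul (D.ρ l) (eul (D.ρ j) s)) (fun y => fderiv ℂ (fun y => fderiv ℂ S.ψ y
      (fun k' => D.ρ j k' * y k') k) y (fun k => D.ρ l k * y k)) := fun j l =>
    (h1 j).euler ((h1 j).analyticAt.eventually_analyticAt.mono fun y hy => hy.differentiableAt) _
  have h3 := (h2 j l).sub (h2 l j)
  have h4 : eul (D.ρ l) (eul (D.ρ j) s) - eul (D.ρ j) (eul (D.ρ l) s) = 0 := by
    ext α
    rw [map_sub, coeff_eul, coeff_eul, coeff_eul, coeff_eul, map_zero]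
    ring
  rw [h4] at h3
  filter_upwards [h3.eventually_zero] with y hy
  exact sub_eq_zero.1 hy

theorem fderiv_E (j l : Fin p) (k : Fin m) : ∀ᶠ y in 𝓝 0,
    fderiv ℂ (fun y => S.E j y k) y (fun k => D.ρ l k * y k) =
    fderiv ℂ (fun y => fderiv ℂ S.ψ y (fun k' => D.ρ j k' * y k') k) y (fun k => D.ρ l k * y k)
    - ∑ i, S.g j i y * (fderiv ℂ (D.X i) (S.ψ y) (S.E l y) k +
      ∑ i', S.g l i' y * fderiv ℂ (D.X i) (S.ψ y) (D.X i' (S.ψ y)) k) := by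
  have hXψ : ∀ i, AnalyticAt ℂ (fun y => D.X i (S.ψ y) k) 0 := by
    intro i
    have h1 : AnalyticAt ℂ (fun x => D.X i x k) 0 := (analyticAt_pi_iff.1 (D.hX i)) k
    exact h1.comp_of_eq S.hψ S.hψ0
  have hu : AnalyticAt ℂ (fun y => fderiv ℂ S.ψ y (fun k' => D.ρ j k' * y k') k) 0 := by
    have h1 : AnalyticAt ℂ (fun y => ∑ i, S.g j i y * D.X i (S.ψ y) k) 0 :=
      Finset.analyticAt_fun_sum _ fun i _ => (S.hg j i).mul (hXψ i)
    refine ((S.repE j k).analyticAt.add h1).congr (Eventually.of_forall fun y => ?_)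
    simp [E]
  have hXan : ∀ᶠ y in 𝓝 (0 : Fin m → ℂ), ∀ i, AnalyticAt ℂ (D.X i) (S.ψ y) :=
    eventually_all.2 fun i => S.ψ_tendsto.eventually (D.hX i).eventually_analyticAt
  have hgan : ∀ᶠ y in 𝓝 (0 : Fin m → ℂ), ∀ i, AnalyticAt ℂ (S.g j i) y :=
    eventually_all.2 fun i => (S.hg j i).eventually_analyticAt
  have hginv : ∀ᶠ y in 𝓝 (0 : Fin m → ℂ), ∀ i, fderiv ℂ (S.g j i) y (fun k => D.ρ l k * y k) = 0 :=
    eventually_all.2 fun i => S.hginv l j i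
  filter_upwards [hXan, hgan, hginv, hu.eventually_analyticAt, S.hψ.eventually_analyticAt]
    with y hX hg hgi hu hψ
  have h1 : ∀ i, HasFDerivAt (fun y => D.X i (S.ψ y) k)
      ((ContinuousLinearMap.proj (R := ℂ) (φ := fun _ : Fin m => ℂ) k).comp
        ((fderiv ℂ (D.X i) (S.ψ y)).comp (fderiv ℂ S.ψ y))) y := fun i =>
    (ContinuousLinearMap.proj (R := ℂ) (φ := fun _ : Fin m => ℂ) k).hasFDerivAt.comp y
      ((hX i).differentiableAt.hasFDerivAt.comp y hψ.differentiableAt.hasFDerivAt)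
  have h2 := hu.differentiableAt.hasFDerivAt.fun_sub (HasFDerivAt.fun_sum (u := Finset.univ)
    fun i _ => (hg i).differentiableAt.hasFDerivAt.fun_mul (h1 i))
  have h3 : (fun y => S.E j y k) = fun y => fderiv ℂ S.ψ y (fun k' => D.ρ j k' * y k') k -
      ∑ i, S.g j i y * D.X i (S.ψ y) k := rfl
  rw [h3, h2.fderiv]
  rw [sub_apply, sum_apply]
  congr 1
  refine Finset.sum_congr rfl fun i _ => ?_
  rw [add_apply, smul_apply, smul_apply, hgi, smul_zero, add_zero, smul_eq_mul]
  show _ * fderiv ℂ (D.X i) (S.ψ y) (fderiv ℂ S.ψ y (fun k => D.ρ l k * y k)) k = _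
  rw [S.E_eq, map_add, map_sum, Pi.add_apply, Finset.sum_apply]
  simp only [map_smul, Pi.smul_apply, smul_eq_mul]

theorem lie (j l : Fin p) (k : Fin m) : ∀ᶠ y in 𝓝 0,
    fderiv ℂ (fun y => S.E j y k) y (fun k => D.ρ l k * y k) +
      ∑ i, S.g j i y * fderiv ℂ (D.X i) (S.ψ y) (S.E l y) k =
    fderiv ℂ (fun y => S.E l y k) y (fun k => D.ρ j k * y k) +
      ∑ i, S.g l i y * fderiv ℂ (D.X i) (S.ψ y) (S.E j y) k := by
  have hc : ∀ᶠ y in 𝓝 (0 : Fin m → ℂ), ∀ i i', fderiv ℂ (D.X i') (S.ψ y) (D.X i (S.ψ y)) =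
      fderiv ℂ (D.X i) (S.ψ y) (D.X i' (S.ψ y)) :=
    eventually_all.2 fun i => eventually_all.2 fun i' => S.ψ_tendsto.eventually (D.hcomm i i')
  filter_upwards [S.fderiv_E j l k, S.fderiv_E l j k, S.lie_symm j l k, hc] with y h1 h2 h3 h4
  rw [h1, h2, h3]
  simp only [mul_add, Finset.sum_add_distrib, Finset.mul_sum]
  have : ∑ i, ∑ i', S.g j i y * (S.g l i' y * fderiv ℂ (D.X i) (S.ψ y) (D.X i' (S.ψ y)) k) =
      ∑ i, ∑ i', S.g l i y * (S.g j i' y * fderiv ℂ (D.X i) (S.ψ y) (D.X i' (S.ψ y)) k) := by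
    rw [Finset.sum_comm]
    refine Finset.sum_congr rfl fun i _ => Finset.sum_congr rfl fun i' _ => ?_
    rw [h4 i i']; ring
  rw [this]
  ring

/-- low degree coefficients vanish -/
theorem low (j k) (α : Fin m →₀ ℕ) (hα : α.degree < 2) : MvPowerSeries.coeff α (S.e j k) = 0 := by
  have h := (S.repE j k).lead_of_tendsto 1 (fun _ => 0) (fun y => by
    have h1 : Tendsto (fun t : ℂ => fderiv ℂ S.ψ (t • y) (fun k' => D.ρ j k' * y k') k) (𝓝[≠] 0)
        (𝓝 (D.ρ j k * y k)) := by
      have h2 : ContinuousAt (fderiv ℂ S.ψ) 0 := S.hψ.fderiv.continuousAt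
      have h3 := tendsto_clm_apply (h2.tendsto.comp (tendsto_pull y))
        (tendsto_const_nhds (x := (fun k' => D.ρ j k' * y k')))
      rw [S.hDψ] at h3
      exact tendsto_pi_nhds.1 h3 k
    have h2 : ∀ i, Tendsto (fun t : ℂ => t⁻¹ * D.X i (S.ψ (t • y)) k) (𝓝[≠] 0)
        (𝓝 (D.ρ i k * y k)) := by
      intro i
      have hX : HasFDerivAt (D.X i) (fderiv ℂ (D.X i) 0) (S.ψ 0) := by
        rw [S.hψ0]; exact (D.hX i).differentiableAt.hasFDerivAt
      have h3 := tendsto_lin (hX.comp 0 S.hψ.differentiableAt.hasFDerivAt)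
        (by simp [S.hψ0, D.hX0]) y
      have h4 := tendsto_pi_nhds.1 h3 k
      have h5 : ((fderiv ℂ (D.X i) 0).comp (fderiv ℂ S.ψ 0)) y k = D.ρ i k * y k := by
        show fderiv ℂ (D.X i) 0 (fderiv ℂ S.ψ 0 y) k = _
        rw [S.hDψ, D.hDX]
      rw [h5] at h4
      exact h4
    have h3 : ∀ i, Tendsto (fun t : ℂ => S.g j i (t • y)) (𝓝[≠] 0)
        (𝓝 (if j = i then 1 else 0)) := by
      intro i
      have := (S.hg j i).continuousAt.tendsto.comp (tendsto_pull y)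
      rw [S.hg0] at this
      exact this
    have h4 := h1.sub (tendsto_finsetSum (Finset.univ : Finset (Fin p)) fun i _ =>
      (h3 i).mul (h2 i))
    have h5 : D.ρ j k * y k - ∑ i, (if j = i then 1 else 0) * (D.ρ i k * y k) = 0 := by simp
    rw [h5] at h4
    refine h4.congr' ?_
    filter_upwards [self_mem_nhdsWithin] with t ht
    have ht : t ≠ 0 := ht
    have h6 : (fun k' => D.ρ j k' * (t • y) k') = t • (fun k' => D.ρ j k' * y k') := by
      funext k'; simp; ring
    rw [E, h6, map_smul, Pi.smul_apply, smul_eq_mul, pow_one, mul_sub, ← mul_assoc,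
      inv_mul_cancel₀ ht, one_mul, Finset.mul_sum]
    congr 1
    exact Finset.sum_congr rfl fun i _ => by ring)
  have h0 : lead 1 (S.e j k) = 0 := MvPolynomial.funext fun y => by rw [h.2, map_zero]
  rcases Nat.lt_or_ge α.degree 1 with h1 | h1
  · exact h.1 α h1
  · have h2 := congrArg (MvPolynomial.coeff α) h0
    rw [coeff_lead, if_pos (by omega)] at h2
    simpa using h2

theorem rel_a (d : ℕ) (hd : ∀ j k (α : Fin m →₀ ℕ), α.degree < d → MvPowerSeries.coeff α (S.e j k) = 0)
    (j l : Fin p) (k : Fin m) (α : Fin m →₀ ℕ) (hα : α.degree = d) :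
    D.lam l α k * MvPowerSeries.coeff α (S.e j k) =
    D.lam j α k * MvPowerSeries.coeff α (S.e l k) := by
  have hlim : ∀ j l y, Tendsto (fun t : ℂ => (t ^ d)⁻¹ *
      ∑ i, S.g j i (t • y) * fderiv ℂ (D.X i) (S.ψ (t • y)) (S.E l (t • y)) k) (𝓝[≠] 0)
      (𝓝 (D.ρ j k * MvPolynomial.eval y (lead d (S.e l k)))) := by
    intro j l y
    have h3 : ∀ i, Tendsto (fun t : ℂ => S.g j i (t • y)) (𝓝[≠] 0)
        (𝓝 (if j = i then 1 else 0)) := by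
      intro i
      have := (S.hg j i).continuousAt.tendsto.comp (tendsto_pull y)
      rw [S.hg0] at this
      exact this
    have h4 : Tendsto (fun t : ℂ => (t ^ d)⁻¹ • S.E l (t • y)) (𝓝[≠] 0)
        (𝓝 (fun k => MvPolynomial.eval y (lead d (S.e l k)))) :=
      tendsto_pi_nhds.2 fun k => (S.repE l k).tendsto d (hd l k) y (fun _ => y) tendsto_const_nhds
    have h5 : ∀ i, Tendsto (fun t : ℂ => fderiv ℂ (D.X i) (S.ψ (t • y))
        ((t ^ d)⁻¹ • S.E l (t • y)) k) (𝓝[≠] 0)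
        (𝓝 (D.ρ i k * MvPolynomial.eval y (lead d (S.e l k)))) := by
      intro i
      have h6 : ContinuousAt (fderiv ℂ (D.X i)) 0 := (D.hX i).fderiv.continuousAt
      have h7 := tendsto_clm_apply (h6.tendsto.comp (S.ψ_tendsto.comp (tendsto_pull y))) h4
      rw [D.hDX] at h7
      exact tendsto_pi_nhds.1 h7 k
    have h6 := tendsto_finsetSum (Finset.univ : Finset (Fin p)) fun i _ => (h3 i).mul (h5 i)
    have h7 : ∑ i, (if j = i then 1 else 0) * (D.ρ i k * MvPolynomial.eval y (lead d (S.e l k))) =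
      D.ρ j k * MvPolynomial.eval y (lead d (S.e l k)) := by simp
    rw [h7] at h6
    refine h6.congr fun t => ?_
    rw [Finset.mul_sum]
    refine Finset.sum_congr rfl fun i _ => ?_
    rw [map_smul, Pi.smul_apply, smul_eq_mul]; ring
  have hlim2 : ∀ j l y, Tendsto (fun t : ℂ => (t ^ d)⁻¹ *
      fderiv ℂ (fun y => S.E j y k) (t • y) (fun k => D.ρ l k * (t • y) k)) (𝓝[≠] 0)
      (𝓝 (MvPolynomial.eval y (lead d (eul (D.ρ l) (S.e j k))))) := by
    intro j l y
    have h1 : Rep (eul (D.ρ l) (S.e j k)) (fun y => fderiv ℂ (fun y => S.E j y k) y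
        (fun k => D.ρ l k * y k)) := (S.repE j k).euler
      ((S.repE j k).analyticAt.eventually_analyticAt.mono fun y hy => hy.differentiableAt) _
    exact h1.tendsto d (fun α hα => by rw [coeff_eul, hd j k α hα, mul_zero]) y (fun _ => y)
      tendsto_const_nhds
  have heq : lead d (eul (D.ρ l) (S.e j k)) + MvPolynomial.C (D.ρ j k) * lead d (S.e l k) =
      lead d (eul (D.ρ j) (S.e l k)) + MvPolynomial.C (D.ρ l k) * lead d (S.e j k) := by
    apply MvPolynomial.funext
    intro y
    rw [map_add, map_add, map_mul, map_mul, MvPolynomial.eval_C, MvPolynomial.eval_C]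
    refine tendsto_nhds_unique ((hlim2 j l y).add (hlim j l y)) ?_
    refine ((hlim2 l j y).add (hlim l j y)).congr' ?_
    filter_upwards [(tendsto_pull y).eventually (S.lie j l k)] with t ht
    rw [← mul_add, ← mul_add, ht]
  have h1 := congrArg (MvPolynomial.coeff α) heq
  simp only [MvPolynomial.coeff_add, MvPolynomial.coeff_C_mul, coeff_lead, if_pos hα,
    coeff_eul] at h1
  rw [Core.lam, Core.lam]
  linear_combination h1

theorem nonres (d : ℕ) (hd2 : 2 ≤ d)
    (hd : ∀ j k (α : Fin m →₀ ℕ), α.degree < d → MvPowerSeries.coeff α (S.e j k) = 0)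
    (j l : Fin p) (k : Fin m) (α : Fin m →₀ ℕ) (hα : α.degree = d) (hl : D.lam l α k ≠ 0) :
    MvPowerSeries.coeff α (S.e j k) = 0 := by
  classical
  let s : Finset (Fin p) := Finset.univ.filter fun l => D.lam l α k ≠ 0
  have hs : s.Nonempty := ⟨l, by simp [s, hl]⟩
  have h0 : D.lam (s.min' hs) α k ≠ 0 := by
    have := s.min'_mem hs
    exact (Finset.mem_filter.1 this).2
  have h1 : D.sel (s.min' hs) k α := by
    refine ⟨by omega, h0, fun j' hj' => ?_⟩
    by_contra hne
    have := s.min'_le j' (by simp [s, hne])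
    exact absurd hj' (not_lt.2 this)
  have h2 := S.rel_a d hd j (s.min' hs) k α hα
  rw [S.hsel _ _ _ h1, mul_zero] at h2
  exact (mul_eq_zero.1 h2).resolve_left h0

theorem wt_add' (v : Fin m → ℂ) (α β : Fin m →₀ ℕ) : wt v (α + β) = wt v α + wt v β := by
  simp [wt, mul_add, Finset.sum_add_distrib]

theorem wt_single' (v : Fin m → ℂ) (k : Fin m) : wt v (Finsupp.single k 1) = v k := by
  simp [wt, Finsupp.single_apply]

/-- consequence of the first integrals -/
theorem rel_b (d : ℕ) (hd2 : 2 ≤ d)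
    (hd : ∀ j k (α : Fin m →₀ ℕ), α.degree < d → MvPowerSeries.coeff α (S.e j k) = 0)
    (j : Fin p) (s : Fin q) (y : Fin m → ℂ) :
    ∑ k, MvPolynomial.eval y (lead d (S.e j k)) *
      MvPolynomial.eval y (MvPolynomial.pderiv k (D.L s)) = 0 := by
  have han : AnalyticAt ℂ (fun y => D.F s (S.ψ y)) 0 := (D.hF s).comp_of_eq S.hψ S.hψ0
  obtain ⟨c, hc⟩ := Rep.exists _ han
  have h1 : Rep (eul (D.ρ j) c) (fun y => fderiv ℂ (fun y => D.F s (S.ψ y)) y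
        (fun k => D.ρ j k * y k)) := hc.euler
      (han.eventually_analyticAt.mono fun y hy => hy.differentiableAt) _
  have h2 : Rep (eul (D.ρ j) c) (fun y => fderiv ℂ (D.F s) (S.ψ y) (S.E j y)) := by
    refine h1.congr ?_
    have hF : ∀ᶠ y in 𝓝 (0 : Fin m → ℂ), ∀ i, fderiv ℂ (D.F s) (S.ψ y) (D.X i (S.ψ y)) = 0 :=
      eventually_all.2 fun i => S.ψ_tendsto.eventually (D.hFX i s)
    filter_upwards [S.hψ.eventually_analyticAt, hF,
      S.ψ_tendsto.eventually (D.hF s).eventually_analyticAt] with y hψ hFX hF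
    have h3 : HasFDerivAt (fun y => D.F s (S.ψ y)) ((fderiv ℂ (D.F s) (S.ψ y)).comp
      (fderiv ℂ S.ψ y)) y :=
      hF.differentiableAt.hasFDerivAt.comp y hψ.differentiableAt.hasFDerivAt
    rw [h3.fderiv]
    show fderiv ℂ (D.F s) (S.ψ y) (fderiv ℂ S.ψ y (fun k => D.ρ j k * y k)) = _
    rw [S.E_eq, map_add, map_sum, Finset.sum_eq_zero, add_zero]
    intro i _
    rw [map_smul, hFX, smul_zero]
  have hz : ∀ y : Fin m → ℂ, Tendsto (fun t : ℂ => t⁻¹ • S.ψ (t • y)) (𝓝[≠] 0) (𝓝 y) := by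
    intro y
    have := tendsto_lin S.hψ.differentiableAt.hasFDerivAt S.hψ0 y
    rwa [S.hDψ] at this
  have h3 := h2.lead_of_tendsto (d + (D.k s - 1)) (fun y => ∑ k, MvPolynomial.eval y (lead d (S.e j k)) *
      MvPolynomial.eval y (MvPolynomial.pderiv k (D.L s))) (fun y => by
    have h4 := tendsto_finsetSum (Finset.univ : Finset (Fin m)) fun k _ =>
      ((S.repE j k).tendsto d (hd j k) y (fun _ => y) tendsto_const_nhds).mul
        (D.tendsto_pd s k y _ (hz y))
    refine h4.congr' ?_
    filter_upwards [self_mem_nhdsWithin] with t ht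
    have ht : t ≠ 0 := ht
    rw [smul_smul, mul_inv_cancel₀ ht, one_smul, clm_eq_sum (fderiv ℂ (D.F s) (S.ψ (t • y))),
      Finset.mul_sum]
    refine Finset.sum_congr rfl fun k _ => ?_
    rw [pow_add, mul_inv]; ring)
  have h5 : lead (d + (D.k s - 1)) (eul (D.ρ j) c) =
      ∑ k, lead d (S.e j k) * MvPolynomial.pderiv k (D.L s) := by
    apply MvPolynomial.funext
    intro y
    rw [h3.2, map_sum]
    simp only [map_mul]
  have h6 : lead (d + (D.k s - 1)) (eul (D.ρ j) c) = 0 := by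
    ext β
    rw [MvPolynomial.coeff_zero]
    by_cases hβ : wt (D.ρ j) β = 0
    · rw [coeff_lead, coeff_eul, hβ]; simp
    · rw [h5, MvPolynomial.coeff_sum]
      refine Finset.sum_eq_zero fun k _ => ?_
      rw [MvPolynomial.coeff_mul]
      refine Finset.sum_eq_zero fun x hx => ?_
      rw [Finset.HasAntidiagonal.mem_antidiagonal] at hx
      by_contra hne
      obtain ⟨hn1, hn2⟩ := mul_ne_zero_iff.1 hne
      rw [coeff_lead] at hn1
      split_ifs at hn1 with hdeg
      · have hlam : D.lam j x.1 k = 0 := by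
          by_contra hl
          exact hn1 (S.nonres d hd2 hd j j k x.1 hdeg hl)
        · rw [MvPolynomial.coeff_pderiv] at hn2
          have := D.wt_zero j s _ (fun h => hn2 (by rw [h, zero_mul]))
          apply hβ
          rw [wt_add', wt_single'] at this
          rw [Core.lam] at hlam
          rw [← hx, wt_add']
          linear_combination this + hlam
      · exact hn1 rfl
  rw [← h3.2, h6, map_zero]

theorem step (d : ℕ) (hd2 : 2 ≤ d)
    (hd : ∀ j k (α : Fin m →₀ ℕ), α.degree < d → MvPowerSeries.coeff α (S.e j k) = 0)
    (j : Fin p) (k : Fin m) (α : Fin m →₀ ℕ) (hα : α.degree = d) :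
    MvPowerSeries.coeff α (S.e j k) = 0 := by
  classical
  by_cases hres : ∀ l, D.lam l α k = 0
  swap
  · push Not at hres
    obtain ⟨l, hl⟩ := hres
    exact S.nonres d hd2 hd j l k α hα hl
  have hb := S.rel_b d hd2 hd j
  by_cases hk : α k = 0
  · have h1 := D.coeff_relation (fun k' => lead d (S.e j k') * MvPolynomial.X k) (fun s y => by
      have := congrArg (fun x => y k * x) (hb s y)
      simp only [mul_zero, Finset.mul_sum] at this
      rw [← this]
      refine Finset.sum_congr rfl fun k' _ => ?_
      rw [map_mul, MvPolynomial.eval_X]; ring) (fun k' => (α k' : ℂ) - if k' = k then 1 else 0)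
      (fun i => by
        have := hres i
        rw [Core.lam, wt] at this
        simp only [mul_sub, Finset.sum_sub_distrib]
        simpa using this) α
    rw [Finset.sum_eq_single k] at h1
    · rw [MvPolynomial.coeff_mul_X, coeff_lead, if_pos hα, hk] at h1
      simpa using h1
    · intro k' _ hk'
      rw [MvPolynomial.coeff_mul_X', if_neg, zero_mul]
      rw [Finsupp.mem_support_iff, Finsupp.add_apply, hk, Finsupp.single_apply, if_neg hk']
      simp
    · simp
  · obtain ⟨b, rfl⟩ : ∃ b, α = b + Finsupp.single k 1 := by
      refine ⟨α - Finsupp.single k 1, (tsub_add_cancel_of_le ?_).symm⟩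
      rw [Finsupp.single_le_iff]; omega
    have hbInv : D.Inv b := by
      refine ⟨?_, fun l => ?_⟩
      · rintro rfl
        simp at hα
        omega
      · have := hres l
        rw [Core.lam, wt_add', wt_single'] at this
        linear_combination this
    have h1 := D.coeff_relation (fun k' => lead d (S.e j k')) hb (D.gam k) (D.gam_ann k) b
    rw [D.sum_gam k (fun k' => MvPolynomial.coeff (b + Finsupp.single k' 1) (lead d (S.e j k')))] at h1
    have hdeg : ∀ k', (b + Finsupp.single k' 1).degree = d := by
      intro k'
      rw [map_add, Finsupp.degree_single] at hα ⊢
      exact hα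
    simp only [coeff_lead, hdeg, if_true, S.hInv j _ b hbInv, mul_zero, Finset.sum_const_zero,
      sub_zero] at h1
    exact h1

theorem e_zero (j k) : S.e j k = 0 := by
  have : ∀ d, ∀ j k (α : Fin m →₀ ℕ), α.degree < d → MvPowerSeries.coeff α (S.e j k) = 0 := by
    intro d
    induction d with
    | zero => intro j k α h; omega
    | succ d ih =>
      intro j k α h
      rcases Nat.lt_or_ge α.degree 2 with h2 | h2
      · exact S.low j k α h2
      · rcases Nat.lt_or_ge α.degree d with h3 | h3
        · exact ih j k α h3
        · have h4 : α.degree = d := by omega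
          exact S.step d (by omega) ih j k α h4
  ext α
  rw [this _ j k α (Nat.lt_succ_self _), map_zero]

/-- the exact equation -/
theorem exact_eq (j : Fin p) : ∀ᶠ y in 𝓝 0, fderiv ℂ S.ψ y (fun k' => D.ρ j k' * y k') =
    ∑ i, S.g j i y • D.X i (S.ψ y) := by
  have : ∀ᶠ y in 𝓝 0, ∀ k, S.E j y k = 0 := eventually_all.2 fun k => by
    have := S.repE j k
    rw [S.e_zero] at this
    exact this.eventually_zero
  filter_upwards [this] with y hy
  rw [S.E_eq, show S.E j y = 0 from funext hy, zero_add]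

end Sol
end
end GeomLin

namespace GeomLin
noncomputable section
open WA Filter Topology

variable {m n p q : ℕ}

theorem analyticAt_det (M : Fin p → Fin p → (Fin m → ℂ) → ℂ) (y : Fin m → ℂ)
    (h : ∀ i j, AnalyticAt ℂ (M i j) y) :
    AnalyticAt ℂ (fun y => (Matrix.of fun i j => M i j y).det) y := by
  simp only [Matrix.det_apply', Matrix.of_apply]
  exact Finset.analyticAt_fun_sum _ fun σ _ => analyticAt_const.mul
    (Finset.analyticAt_fun_prod _ fun i _ => h _ _)

theorem analyticAt_inv (M : Fin p → Fin p → (Fin m → ℂ) → ℂ) (y : Fin m → ℂ)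
    (h : ∀ i j, AnalyticAt ℂ (M i j) y) (hdet : (Matrix.of fun i j => M i j y).det ≠ 0) (i j) :
    AnalyticAt ℂ (fun y => (Matrix.of fun i j => M i j y)⁻¹ i j) y := by
  have h1 : AnalyticAt ℂ (fun y => (Matrix.of fun i j => M i j y).adjugate i j) y := by
    simp only [Matrix.adjugate_apply]
    have : (fun y => ((Matrix.of fun i j => M i j y).updateRow j (Pi.single i 1)).det) =
      fun y => (Matrix.of fun a b => (fun a b y => if a = j then (Pi.single i 1 : Fin p → ℂ) b
        else M a b y) a b y).det := by
      funext y
      congr 1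
      ext a b
      simp [Matrix.updateRow_apply]
    rw [this]
    apply analyticAt_det
    intro a b
    split_ifs
    · exact analyticAt_const
    · exact h a b
  have h2 := (analyticAt_det M y h).inv hdet
  have h3 : (fun y => (Matrix.of fun i j => M i j y)⁻¹ i j) = fun y =>
      ((Matrix.of fun i j => M i j y).det)⁻¹ * (Matrix.of fun i j => M i j y).adjugate i j := by
    funext y
    rw [Matrix.inv_def, Ring.inverse_eq_inv', Matrix.smul_apply, smul_eq_mul]
  rw [h3]
  exact h2.mul h1

theorem fderiv_inv_zero (M : Fin p → Fin p → (Fin m → ℂ) → ℂ) (y v : Fin m → ℂ)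
    (h : ∀ i j, AnalyticAt ℂ (M i j) y) (hdet : (Matrix.of fun i j => M i j y).det ≠ 0)
    (hv : ∀ i j, fderiv ℂ (M i j) y v = 0) (i j) :
    fderiv ℂ (fun y => (Matrix.of fun i j => M i j y)⁻¹ i j) y v = 0 := by
  have hN := analyticAt_inv M y h hdet
  have hev : ∀ᶠ z in 𝓝 y, (Matrix.of fun i j => M i j z).det ≠ 0 :=
    (analyticAt_det M y h).continuousAt.eventually_ne hdet
  have h1 : ∀ b, ∑ a, (Matrix.of fun i j => M i j y) a b *
      fderiv ℂ (fun y => (Matrix.of fun i j => M i j y)⁻¹ i a) y v = 0 := by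
    intro b
    have h2 : (fun z => ∑ a, (Matrix.of fun i j => M i j z)⁻¹ i a * M a b z) =ᶠ[𝓝 y]
        fun _ => (1 : Matrix (Fin p) (Fin p) ℂ) i b := by
      filter_upwards [hev] with z hz
      rw [← Matrix.nonsing_inv_mul (Matrix.of fun i j => M i j z) (Ne.isUnit hz),
        Matrix.mul_apply]
      rfl
    have h3 := HasFDerivAt.fun_sum (u := Finset.univ) (fun a _ =>
      (hN i a).differentiableAt.hasFDerivAt.fun_mul (h a b).differentiableAt.hasFDerivAt)
    have h4 := h2.fderiv_eq (𝕜 := ℂ)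
    rw [h3.fderiv, fderiv_const_apply] at h4
    have h5 := congrArg (fun l => l v) h4
    simp only [sum_apply, add_apply, smul_apply, hv, mul_zero, zero_add, smul_eq_mul] at h5
    exact h5
  have h2 := Matrix.eq_zero_of_vecMul_eq_zero (M := Matrix.of fun i j => M i j y) hdet
    (v := fun a => fderiv ℂ (fun y => (Matrix.of fun i j => M i j y)⁻¹ i a) y v) (by
      funext b
      rw [Matrix.vecMul, dotProduct, Pi.zero_apply, ← h1 b]
      exact Finset.sum_congr rfl fun a _ => mul_comm _ _)
  exact congrFun h2 j

theorem Core.final (D : Core p q m) (U : Set (Fin m → ℂ)) (hU : U ∈ 𝓝 0) :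
    ∃ V W : Set (Fin m → ℂ), IsOpen V ∧ V ⊆ U ∧ (0 : Fin m → ℂ) ∈ V ∧
      IsOpen W ∧ (0 : Fin m → ℂ) ∈ W ∧
      ∃ φ ψ : (Fin m → ℂ) → (Fin m → ℂ),
        AnalyticOnNhd ℂ φ V ∧ AnalyticOnNhd ℂ ψ W ∧
        Set.MapsTo φ V W ∧ Set.MapsTo ψ W V ∧
        (∀ x ∈ V, ψ (φ x) = x) ∧ (∀ y ∈ W, φ (ψ y) = y) ∧ φ 0 = 0 ∧
        ∃ f : Fin p → Fin p → (Fin m → ℂ) → ℂ,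
          (∀ i j, AnalyticOnNhd ℂ (f i j) W) ∧
          (∀ y ∈ W, (Matrix.of fun i j => f i j y).det ≠ 0) ∧
          (∀ i j l, ∀ y ∈ W, fderiv ℂ (f i j) y (fun k => D.ρ l k * y k) = 0) ∧
          (∀ i, ∀ x ∈ V, fderiv ℂ φ x (D.X i x) =
            ∑ j, f i j (φ x) • fun k => D.ρ j k * φ x k) := by
  obtain ⟨S⟩ := D.exists_sol
  have hid : fderiv ℂ S.ψ 0 = ((ContinuousLinearEquiv.refl ℂ (Fin m → ℂ) :
      (Fin m → ℂ) ≃L[ℂ] (Fin m → ℂ)) : (Fin m → ℂ) →L[ℂ] (Fin m → ℂ)) := by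
    ext v k
    rw [S.hDψ]; rfl
  have hst : HasStrictFDerivAt S.ψ ((ContinuousLinearEquiv.refl ℂ (Fin m → ℂ) :
      (Fin m → ℂ) ≃L[ℂ] (Fin m → ℂ)) : (Fin m → ℂ) →L[ℂ] (Fin m → ℂ)) 0 := by
    rw [← hid]; exact S.hψ.hasStrictFDerivAt
  let R := hst.toOpenPartialHomeomorph S.ψ
  have hR : (R : (Fin m → ℂ) → Fin m → ℂ) = S.ψ := hst.toOpenPartialHomeomorph_coe
  have hs0 : (0 : Fin m → ℂ) ∈ R.source := hst.mem_toOpenPartialHomeomorph_source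
  have hsym : AnalyticAt ℂ R.symm 0 := by
    have := R.analyticAt_symm' hs0 (by rw [hR]; exact S.hψ) (by rw [hR]; exact hid)
    rwa [hR, S.hψ0] at this
  have hdet0 : (Matrix.of fun i j => S.g i j 0).det ≠ 0 := by
    have : (Matrix.of fun i j => S.g i j 0) = 1 := by
      ext i j
      rw [Matrix.of_apply, S.hg0, Matrix.one_apply]
    rw [this, Matrix.det_one]; exact one_ne_zero
  have hgood : ∀ᶠ y in 𝓝 (0 : Fin m → ℂ), y ∈ R.source ∧ AnalyticAt ℂ S.ψ y ∧
      (∀ j i, AnalyticAt ℂ (S.g j i) y) ∧ (Matrix.of fun i j => S.g i j y).det ≠ 0 ∧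
      (∀ l j i, fderiv ℂ (S.g j i) y (fun k => D.ρ l k * y k) = 0) ∧
      (∀ j, fderiv ℂ S.ψ y (fun k' => D.ρ j k' * y k') = ∑ i, S.g j i y • D.X i (S.ψ y)) ∧
      S.ψ y ∈ U ∧ AnalyticAt ℂ R.symm (S.ψ y) := by
    refine Eventually.and (R.open_source.mem_nhds hs0) (S.hψ.eventually_analyticAt.and
      (Eventually.and ?_ (Eventually.and ?_ (Eventually.and ?_ (Eventually.and ?_
        (Eventually.and ?_ ?_))))))
    · exact eventually_all.2 fun j => eventually_all.2 fun i => (S.hg j i).eventually_analyticAt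
    · exact (analyticAt_det S.g 0 S.hg).continuousAt.eventually_ne hdet0
    · exact eventually_all.2 fun l => eventually_all.2 fun j => eventually_all.2 fun i =>
        S.hginv l j i
    · exact eventually_all.2 fun j => S.exact_eq j
    · exact S.ψ_tendsto.eventually hU
    · exact S.ψ_tendsto.eventually hsym.eventually_analyticAt
  obtain ⟨W, hW, hWo, hW0⟩ := eventually_nhds_iff.1 hgood
  have hinv : ∀ y ∈ W, R.symm (S.ψ y) = y := fun y hy => by
    have := R.left_inv (hW y hy).1
    rwa [hR] at this
  have hVo : IsOpen (S.ψ '' W) := by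
    have := R.isOpen_image_of_subset_source hWo (fun y hy => (hW y hy).1)
    rwa [hR] at this
  refine ⟨S.ψ '' W, W, hVo, ?_, ⟨0, hW0, S.hψ0⟩, hWo, hW0, R.symm, S.ψ, ?_, ?_, ?_, ?_, ?_, hinv,
    ?_, fun i j y => (Matrix.of fun i j => S.g i j y)⁻¹ i j, ?_, ?_, ?_, ?_⟩
  · rintro _ ⟨y, hy, rfl⟩
    exact (hW y hy).2.2.2.2.2.2.1
  · rintro _ ⟨y, hy, rfl⟩
    exact (hW y hy).2.2.2.2.2.2.2
  · exact fun y hy => (hW y hy).2.1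
  · rintro _ ⟨y, hy, rfl⟩
    rw [hinv y hy]; exact hy
  · exact fun y hy => ⟨y, hy, rfl⟩
  · rintro _ ⟨y, hy, rfl⟩
    rw [hinv y hy]
  · have := hinv 0 hW0
    rwa [S.hψ0] at this
  · exact fun i j y hy => analyticAt_inv S.g y (hW y hy).2.2.1 (hW y hy).2.2.2.1 i j
  · intro y hy
    have h1 : (Matrix.of fun i j => (Matrix.of fun i j => S.g i j y)⁻¹ i j) =
      (Matrix.of fun i j => S.g i j y)⁻¹ := rfl
    rw [h1]
    have h2 := congrArg Matrix.det
      (Matrix.nonsing_inv_mul (Matrix.of fun i j => S.g i j y) (Ne.isUnit (hW y hy).2.2.2.1))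
    rw [Matrix.det_mul, Matrix.det_one] at h2
    exact left_ne_zero_of_mul_eq_one h2
  · intro i j l y hy
    exact fderiv_inv_zero S.g y _ (hW y hy).2.2.1 (hW y hy).2.2.2.1
      (fun a b => (hW y hy).2.2.2.2.1 l a b) i j
  · rintro i _ ⟨y, hy, rfl⟩
    rw [hinv y hy]
    obtain ⟨h1, h2, h3, h4, h5, h6, h7, h8⟩ := hW y hy
    have hcomp : ∀ v, fderiv ℂ R.symm (S.ψ y) (fderiv ℂ S.ψ y v) = v := by
      intro v
      have h9 := h8.differentiableAt.hasFDerivAt.comp y h2.differentiableAt.hasFDerivAt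
      have h10 : (R.symm ∘ S.ψ) =ᶠ[𝓝 y] id := by
        filter_upwards [hWo.mem_nhds hy] with z hz
        exact hinv z hz
      have h11 := h10.fderiv_eq (𝕜 := ℂ)
      rw [h9.fderiv, fderiv_id] at h11
      exact congrArg (fun l => l v) h11
    have h12 : ∀ j, (fun k => D.ρ j k * y k) =
        ∑ i, S.g j i y • fderiv ℂ R.symm (S.ψ y) (D.X i (S.ψ y)) := by
      intro j
      rw [← hcomp (fun k => D.ρ j k * y k), h6, map_sum]
      simp only [map_smul]
    simp only [h12]
    simp only [Finset.smul_sum, smul_smul]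
    rw [Finset.sum_comm]
    have h13 := Matrix.nonsing_inv_mul (Matrix.of fun i j => S.g i j y) (Ne.isUnit h4)
    have h14 : ∀ i', ∑ j, (Matrix.of fun i j => S.g i j y)⁻¹ i j * S.g j i' y =
        if i = i' then 1 else 0 := by
      intro i'
      have := congrFun (congrFun h13 i) i'
      rw [Matrix.mul_apply, Matrix.one_apply] at this
      exact this
    simp only [← Finset.sum_smul, h14]
    simp

end
end GeomLin

namespace GeomLin
noncomputable section
open WA Filter Topology

variable {m n p q : ℕ}

theorem lin_comm {X Y : (Fin m → ℂ) → Fin m → ℂ} (hX : AnalyticAt ℂ X 0) (hY : AnalyticAt ℂ Y 0)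
    (hX0 : X 0 = 0) (hY0 : Y 0 = 0)
    (h : ∀ᶠ x in 𝓝 0, fderiv ℂ Y x (X x) = fderiv ℂ X x (Y x)) (y : Fin m → ℂ) :
    fderiv ℂ Y 0 (fderiv ℂ X 0 y) = fderiv ℂ X 0 (fderiv ℂ Y 0 y) := by
  have hfX : Tendsto (fun t : ℂ => fderiv ℂ X (t • y)) (𝓝[≠] 0) (𝓝 (fderiv ℂ X 0)) :=
    (hX.fderiv.continuousAt.tendsto).comp (tendsto_pull y)
  have hfY : Tendsto (fun t : ℂ => fderiv ℂ Y (t • y)) (𝓝[≠] 0) (𝓝 (fderiv ℂ Y 0)) :=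
    (hY.fderiv.continuousAt.tendsto).comp (tendsto_pull y)
  have h1 := tendsto_clm_apply hfY (tendsto_lin hX.differentiableAt.hasFDerivAt hX0 y)
  have h2 := tendsto_clm_apply hfX (tendsto_lin hY.differentiableAt.hasFDerivAt hY0 y)
  refine tendsto_nhds_unique h1 (h2.congr' ?_)
  filter_upwards [(tendsto_pull y).eventually h] with t ht
  rw [map_smul, map_smul, ht]

theorem maxGen_le_eigen {A : Matrix (Fin m) (Fin m) ℂ} (h : IsSemisimpleMatrixC A) (μ : ℂ)
    {x : Fin m → ℂ} (hx : x ∈ Module.End.maxGenEigenspace (Matrix.toLin' A) μ) :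
    A.mulVec x = μ • x := by
  obtain ⟨P, hP, d, hA⟩ := h
  have hPd : IsUnit P.det := (Matrix.isUnit_iff_isUnit_det _).1 hP
  have hAP : A * P = P * Matrix.diagonal d := by
    rw [hA, Matrix.mul_assoc, Matrix.nonsing_inv_mul _ hPd, Matrix.mul_one]
  obtain ⟨n, hn⟩ := Module.End.mem_maxGenEigenspace _ _ _ |>.1 hx
  have key : ∀ (n : ℕ) (z : Fin m → ℂ), ((Matrix.toLin' A - μ • 1) ^ n) (P.mulVec z) =
      P.mulVec (fun k => (d k - μ) ^ n * z k) := by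
    intro n
    induction n with
    | zero => intro z; simp
    | succ n ih =>
      intro z
      rw [pow_succ, Module.End.mul_apply]
      have : (Matrix.toLin' A - μ • 1) (P.mulVec z) = P.mulVec (fun k => (d k - μ) * z k) := by
        have e1 : (fun k => (d k - μ) * z k) = (Matrix.diagonal d).mulVec z - μ • z := by
          funext k; simp [Matrix.mulVec_diagonal, sub_mul]
        rw [e1, Matrix.mulVec_sub, Matrix.mulVec_smul, Matrix.mulVec_mulVec, ← hAP,
          ← Matrix.mulVec_mulVec]
        simp
      rw [this, ih]
      congr 1; funext k; ring
  have hxz : x = P.mulVec (P⁻¹.mulVec x) := by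
    rw [Matrix.mulVec_mulVec, Matrix.mul_nonsing_inv _ hPd, Matrix.one_mulVec]
  set z := P⁻¹.mulVec x with hz
  rw [hxz, key] at hn
  have hinj : Function.Injective P.mulVec := Matrix.mulVec_injective_of_isUnit hP
  have hn' : (fun k => (d k - μ) ^ n * z k) = 0 := hinj (by rw [hn, Matrix.mulVec_zero])
  have h0 : (fun k => (d k - μ) ^ 1 * z k) = 0 := by
    funext k
    have := congrFun hn' k
    simp only [Pi.zero_apply, mul_eq_zero] at this ⊢
    rcases this with h | h
    · left; rw [pow_one]; exact eq_zero_of_pow_eq_zero h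
    · exact Or.inr h
  have := key 1 z
  rw [h0, Matrix.mulVec_zero, ← hxz, pow_one] at this
  simpa [sub_eq_zero] using this

theorem simul_diag (A : Fin p → Matrix (Fin m) (Fin m) ℂ) (hc : ∀ i j, A i * A j = A j * A i)
    (hss : ∀ i, IsSemisimpleMatrixC (A i)) :
    ∃ (P : Matrix (Fin m) (Fin m) ℂ) (d : Fin p → Fin m → ℂ), IsUnit P ∧
      ∀ i, A i * P = P * Matrix.diagonal (d i) := by
  have htop := Module.End.iSup_iInf_maxGenEigenspace_eq_top_of_iSup_maxGenEigenspace_eq_top_of_commute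
    (fun i => Matrix.toLin' (A i))
    (fun i j _ => by
      show Matrix.toLin' (A i) * Matrix.toLin' (A j) = Matrix.toLin' (A j) * Matrix.toLin' (A i)
      rw [Module.End.mul_eq_comp, Module.End.mul_eq_comp, ← Matrix.toLin'_mul, hc, Matrix.toLin'_mul])
    (fun i => Module.End.iSup_maxGenEigenspace_eq_top _)
  let S : Set (Fin m → ℂ) := {x | ∃ μ : Fin p → ℂ, ∀ i, (A i).mulVec x = μ i • x}
  have hS : Submodule.span ℂ S = ⊤ := by
    rw [eq_top_iff, ← htop]
    refine iSup_le fun μ => fun x hx => Submodule.subset_span ⟨μ, fun i => ?_⟩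
    exact maxGen_le_eigen (hss i) _ ((Submodule.mem_iInf _).1 hx i)
  obtain ⟨κ, a, ha, hspan, hli⟩ := exists_linearIndependent' ℂ (fun x : S => (x : Fin m → ℂ))
  have hs2 : ⊤ ≤ Submodule.span ℂ (Set.range ((fun x : S => (x : Fin m → ℂ)) ∘ a)) := by
    rw [hspan, Subtype.range_coe, hS]
  let b := Module.Basis.mk hli hs2
  have : Fintype κ := FiniteDimensional.fintypeBasisIndex b
  have hcard : Fintype.card κ = m := by
    rw [← Module.finrank_eq_card_basis b]; simp
  let b' := b.reindex (Fintype.equivFinOfCardEq hcard)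
  have hb' : ∀ j, b' j ∈ S := by
    intro j
    simp only [b', b, Module.Basis.reindex_apply, Module.Basis.mk_apply]
    exact (a _).2
  choose μ hμ using hb'
  refine ⟨Matrix.of fun r c => b' c r, fun i c => μ c i, ?_, fun i => ?_⟩
  · rw [← Matrix.linearIndependent_cols_iff_isUnit]
    exact b'.linearIndependent
  · ext r c
    have := congrFun (hμ c i) r
    rw [Matrix.mul_diagonal]
    simp only [Pi.smul_apply, smul_eq_mul] at this
    rw [Matrix.of_apply, mul_comm, ← this]
    rfl

theorem select_cols (d : Fin p → Fin m → ℂ) (h : LinearIndependent ℂ d) :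
    ∃ κ : Fin p → Fin m, IsUnit (Matrix.of fun i j => d i (κ j)) := by
  have hcols : Submodule.span ℂ (Set.range fun k : Fin m => fun i => d i k) = ⊤ := by
    have hr : (Matrix.of d).rank = p := by
      have := LinearIndependent.rank_matrix (M := Matrix.of d) h
      simpa using this
    rw [Matrix.rank_eq_finrank_span_cols] at hr
    apply Submodule.eq_top_of_finrank_eq
    rw [Module.finrank_fin_fun]
    exact hr
  obtain ⟨κ, a, ha, hspan, hli⟩ := exists_linearIndependent' ℂ (fun k : Fin m => fun i => d i k)
  let b := Module.Basis.mk hli (by rw [hspan, hcols])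
  have : Fintype κ := FiniteDimensional.fintypeBasisIndex b
  have hcard : Fintype.card κ = p := by
    rw [← Module.finrank_eq_card_basis b]; simp
  let e := Fintype.equivFinOfCardEq hcard
  refine ⟨fun j => a (e.symm j), ?_⟩
  rw [← Matrix.linearIndependent_cols_iff_isUnit]
  have := (b.reindex e).linearIndependent
  have e1 : (⇑(b.reindex e)) = (Matrix.of fun i j => d i (a (e.symm j))).col := by
    funext j i
    simp [b, Matrix.col]
  rw [e1] at this
  exact this

theorem taylor_limit {F : (Fin m → ℂ) → ℂ} (hF : AnalyticAt ℂ F 0) (k : ℕ)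
    (hlow : ∀ l < k, iteratedFDeriv ℂ l F 0 = 0) (y : Fin m → ℂ) :
    Tendsto (fun t : ℂ => (t ^ k)⁻¹ * F (t • y)) (𝓝[≠] 0)
      (𝓝 ((k.factorial : ℂ)⁻¹ • iteratedFDeriv ℂ k F 0 (fun _ => y))) := by
  obtain ⟨P, r, hP⟩ := hF
  have hfac : ∀ l (z : Fin m → ℂ), P l (fun _ => z) =
      (l.factorial : ℂ)⁻¹ • iteratedFDeriv ℂ l F 0 (fun _ => z) := by
    intro l z
    have := hP.factorial_smul z l
    have h0 : (l.factorial : ℂ) ≠ 0 := by exact_mod_cast l.factorial_ne_zero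
    rw [← this, nsmul_eq_mul, smul_eq_mul, inv_mul_cancel_left₀ h0]
  have hO := hP.hasFPowerSeriesAt.isBigO_sub_partialSum_pow (k+1)
  have hO2 := hO.comp_tendsto (tendsto_pull y)
  rw [← hfac]
  have hsum : ∀ t : ℂ, P.partialSum (k+1) (t • y) = t ^ k * P k (fun _ => y) := by
    intro t
    rw [FormalMultilinearSeries.partialSum, Finset.sum_range_succ, Finset.sum_eq_zero, zero_add]
    · have := (P k).map_smul_univ (fun _ => t) (fun _ => y)
      simpa using this
    · intro l hl
      rw [hfac, hlow l (Finset.mem_range.1 hl)]; simp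
  have hdiff : Tendsto (fun t : ℂ => (t ^ k)⁻¹ * F (t • y) - P k (fun _ => y)) (𝓝[≠] 0) (𝓝 0) := by
    have h3 : (fun t : ℂ => (t ^ k)⁻¹ * F (t • y) - P k (fun _ => y)) =O[𝓝[≠] 0] (fun t : ℂ => t) := by
      have h4 := (Asymptotics.isBigO_refl (fun t : ℂ => (t^k)⁻¹) (𝓝[≠] 0)).norm_right.mul hO2
      have h5 : (fun t : ℂ => ‖(t^k)⁻¹‖ * ((fun x => ‖x‖ ^ (k+1)) ∘ fun t : ℂ => t • y) t) =O[𝓝[≠] 0] (fun t : ℂ => t) := by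
        refine Asymptotics.IsBigO.of_bound (‖y‖^(k+1)) ?_
        filter_upwards [self_mem_nhdsWithin] with t ht
        have ht : ‖t‖ ≠ 0 := by simpa using ht
        simp only [Function.comp, norm_mul, norm_inv, norm_pow, norm_smul, norm_norm]
        apply le_of_eq
        field_simp
        ring
      refine (h4.trans h5).congr' ?_ EventuallyEq.rfl
      filter_upwards [self_mem_nhdsWithin] with t ht
      have ht : t ≠ 0 := ht
      simp only [Function.comp, zero_add, hsum]
      field_simp
    exact h3.trans_tendsto (tendsto_id.mono_left nhdsWithin_le_nhds)
  have := hdiff.add_const (P k (fun _ => y))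
  simpa using this

end
end GeomLin

namespace GeomLin
noncomputable section
open WA Filter Topology

variable {m n p q : ℕ}

theorem reduction
    (hm : m = p + q)
    (U : Set (Fin m → ℂ)) (hUopen : IsOpen U) (hU0 : (0 : Fin m → ℂ) ∈ U)
    (X : Fin p → (Fin m → ℂ) → (Fin m → ℂ)) (F : Fin q → (Fin m → ℂ) → ℂ)
    (hXan : ∀ i, AnalyticOnNhd ℂ (X i) U)
    (hFan : ∀ j, AnalyticOnNhd ℂ (F j) U)
    (hcomm : ∀ i j, ∀ x ∈ U, fderiv ℂ (X j) x (X i x) - fderiv ℂ (X i) x (X j x) = 0)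
    (hFint : ∀ i j, ∀ x ∈ U, fderiv ℂ (F j) x (X i x) = 0)
    (hfix : ∀ i, X i 0 = 0)
    (A : Fin p → Matrix (Fin m) (Fin m) ℂ)
    (hA : ∀ i v, (A i).mulVec v = fderiv ℂ (X i) 0 v)
    (hss : ∀ i, IsSemisimpleMatrixC (A i))
    (hAind : Dense {x : Fin m → ℂ | LinearIndependent ℂ fun i => (A i).mulVec x})
    (k : Fin q → ℕ) (G : Fin q → (Fin m → ℂ) → ℂ)
    (hklow : ∀ j, ∀ l < k j, iteratedFDeriv ℂ l (F j) 0 = 0)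
    (hG : ∀ j x, G j x = (((k j).factorial : ℂ))⁻¹ • iteratedFDeriv ℂ (k j) (F j) 0 (fun _ => x))
    (hGind : Dense {x : Fin m → ℂ | LinearIndependent ℂ fun j => fderiv ℂ (G j) x}) :
    ∃ (D : Core p q m) (e : (Fin m → ℂ) ≃L[ℂ] (Fin m → ℂ)) (M C : Matrix (Fin p) (Fin p) ℂ),
      M * C = 1 ∧ C * M = 1 ∧ (∀ i z, D.X i z = ∑ l, C i l • e.symm (X l (e z))) ∧
      (∀ l w, (A l).mulVec (e w) = e (∑ b, M l b • fun k => D.ρ b k * w k)) ∧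
      (∀ b w, e (fun k => D.ρ b k * w k) = ∑ l, C b l • (A l).mulVec (e w)) := by
  have hU : U ∈ 𝓝 0 := hUopen.mem_nhds hU0
  have hAc : ∀ i j, A i * A j = A j * A i := by
    intro i j
    apply Matrix.toLin'.injective
    apply LinearMap.ext
    intro y
    rw [Matrix.toLin'_apply, Matrix.toLin'_apply, ← Matrix.mulVec_mulVec, ← Matrix.mulVec_mulVec,
      hA j, hA i, hA i, hA j]
    refine lin_comm (hXan j 0 hU0) (hXan i 0 hU0) (hfix j) (hfix i) ?_ y
    filter_upwards [hU] with x hx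
    exact sub_eq_zero.1 (hcomm j i x hx)
  obtain ⟨P, d, hP, hAP⟩ := simul_diag A hAc hss
  have hPd : IsUnit P.det := (Matrix.isUnit_iff_isUnit_det _).1 hP
  let e : (Fin m → ℂ) ≃L[ℂ] (Fin m → ℂ) :=
    (Matrix.toLin'OfInv (Matrix.mul_nonsing_inv _ hPd) (Matrix.nonsing_inv_mul _ hPd)).toContinuousLinearEquiv.symm
  have he : ∀ v, e v = P.mulVec v := fun v => rfl
  have hAe : ∀ i w, (A i).mulVec (e w) = e (fun k => d i k * w k) := by
    intro i w
    rw [he, he, Matrix.mulVec_mulVec, hAP, ← Matrix.mulVec_mulVec]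
    congr 1; funext k; rw [Matrix.mulVec_diagonal]
  have hdLI : LinearIndependent ℂ d := by
    obtain ⟨x, hx⟩ := hAind.nonempty
    have hx : LinearIndependent ℂ fun i => (A i).mulVec x := hx
    let L : (Fin m → ℂ) →ₗ[ℂ] (Fin m → ℂ) := e.toLinearMap ∘ₗ Matrix.toLin' (Matrix.diagonal (e.symm x))
    apply LinearIndependent.of_comp L
    convert hx using 1
    funext i
    have h1 : (A i).mulVec x = e (fun k => d i k * e.symm x k) := by
      rw [← hAe, e.apply_symm_apply]
    rw [h1]
    show e _ = e _
    congr 1; funext k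
    rw [Matrix.toLin'_apply, Matrix.mulVec_diagonal, mul_comm]
  obtain ⟨κ, hMu⟩ := select_cols d hdLI
  set M : Matrix (Fin p) (Fin p) ℂ := Matrix.of fun i j => d i (κ j) with hM
  have hMd : IsUnit M.det := (Matrix.isUnit_iff_isUnit_det _).1 hMu
  set C := M⁻¹ with hC
  have hMC : M * C = 1 := Matrix.mul_nonsing_inv _ hMd
  have hCM : C * M = 1 := Matrix.nonsing_inv_mul _ hMd
  let ρ : Fin p → Fin m → ℂ := fun b k => ∑ j, C b j * d j k
  have hdρ : ∀ l k, d l k = ∑ b, M l b * ρ b k := by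
    have h1 : M * (C * Matrix.of d) = Matrix.of d := by rw [← Matrix.mul_assoc, hMC, Matrix.one_mul]
    intro l k
    exact (congrFun (congrFun h1 l) k).symm
  have hX' : ∀ i, ∀ z ∈ e ⁻¹' U, HasFDerivAt (fun z => ∑ l, C i l • e.symm (X l (e z)))
      (∑ l, C i l • (e.symm : (Fin m → ℂ) →L[ℂ] (Fin m → ℂ)) ∘L (fderiv ℂ (X l) (e z)) ∘L (e : (Fin m → ℂ) →L[ℂ] (Fin m → ℂ))) z := by
    intro i z hz
    refine HasFDerivAt.fun_sum fun l _ => HasFDerivAt.fun_const_smul ?_ _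
    have h1 : HasFDerivAt (X l) (fderiv ℂ (X l) (e z)) (e z) := (hXan l _ hz).differentiableAt.hasFDerivAt
    exact e.symm.hasFDerivAt.comp z (h1.comp z e.hasFDerivAt)
  have heU : e ⁻¹' U ∈ 𝓝 (0 : Fin m → ℂ) :=
    (hUopen.preimage e.continuous).mem_nhds (by simpa using hU0)
  have hexp : ∀ i j, ∀ z ∈ e ⁻¹' U, fderiv ℂ (fun z => ∑ l, C j l • e.symm (X l (e z))) z
      (∑ l, C i l • e.symm (X l (e z))) =
      ∑ l, ∑ r, (C j l * C i r) • e.symm (fderiv ℂ (X l) (e z) (X r (e z))) := by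
    intro i j z hz
    rw [(hX' j z hz).fderiv]
    simp only [sum_apply, smul_apply, ContinuousLinearMap.comp_apply, ContinuousLinearEquiv.coe_coe,
      map_sum, map_smul, ContinuousLinearEquiv.apply_symm_apply, Finset.smul_sum, smul_smul]
    rw [Finset.sum_comm]
    refine Finset.sum_congr rfl fun r _ => Finset.sum_congr rfl fun l _ => ?_
    rw [mul_comm]
  have hGt : ∀ s y, Tendsto (fun t : ℂ => (t ^ k s)⁻¹ * F s (t • y)) (𝓝[≠] 0) (𝓝 (G s y)) := by
    intro s y
    rw [hG]
    exact taylor_limit (hFan s 0 hU0) _ (hklow s) y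
  refine ⟨
    { X := fun i z => ∑ l, C i l • e.symm (X l (e z))
      F := fun s z => F s (e z)
      ρ := ρ
      κ := κ
      k := k
      G := fun s z => G s (e z)
      hm := hm
      hX := ?_
      hF := ?_
      hcomm := ?_
      hFX := ?_
      hX0 := ?_
      hDX := ?_
      hκ := ?_
      hG := ?_
      hGind := ?_ }, e, M, C, hMC, hCM, fun _ _ => rfl, ?_, ?_⟩
  · intro i
    refine Finset.analyticAt_fun_sum _ fun l _ => analyticAt_const.fun_smul ?_
    have h1 : AnalyticAt ℂ (X l) (e 0) := hXan l _ (by simpa using hU0)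
    exact (e.symm.analyticAt _).comp (h1.comp (e.analyticAt 0))
  · intro s
    have h1 : AnalyticAt ℂ (F s) (e 0) := hFan s _ (by simpa using hU0)
    exact h1.comp (e.analyticAt 0)
  · intro i j
    filter_upwards [heU] with z hz
    rw [hexp i j z hz, hexp j i z hz, Finset.sum_comm]
    refine Finset.sum_congr rfl fun r _ => Finset.sum_congr rfl fun l _ => ?_
    rw [sub_eq_zero.1 (hcomm r l (e z) hz), mul_comm]
  · intro i s
    filter_upwards [heU] with z hz
    have h1 : HasFDerivAt (F s) (fderiv ℂ (F s) (e z)) (e z) := (hFan s _ hz).differentiableAt.hasFDerivAt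
    have h2 : HasFDerivAt (fun z => F s (e z)) _ z := h1.comp z e.hasFDerivAt
    rw [h2.fderiv]
    simp only [ContinuousLinearMap.comp_apply, ContinuousLinearEquiv.coe_coe,
      map_sum, map_smul, ContinuousLinearEquiv.apply_symm_apply]
    refine Finset.sum_eq_zero fun l _ => ?_
    rw [hFint l s _ hz, smul_zero]
  · intro i
    simp [hfix]
  · intro i v
    rw [(hX' i 0 (by simpa using hU0)).fderiv]
    simp only [sum_apply, smul_apply, ContinuousLinearMap.comp_apply, ContinuousLinearEquiv.coe_coe,
      map_zero]
    simp only [← hA, hAe, ContinuousLinearEquiv.symm_apply_apply]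
    funext k
    simp [ρ, Finset.sum_mul, mul_assoc]
  · intro i j
    have := congrFun (congrFun hCM i) j
    rw [Matrix.one_apply] at this
    exact this
  · intro s y
    simp only [map_smul]
    exact hGt s (e y)
  · have hpre : {y | LinearIndependent ℂ fun s => fderiv ℂ (fun z => G s (e z)) y} =
        e ⁻¹' {x | LinearIndependent ℂ fun j => fderiv ℂ (G j) x} := by
      ext y
      simp only [Set.mem_ofPred_eq, Set.mem_preimage]
      have h1 : ∀ s, fderiv ℂ (fun z => G s (e z)) y = (fderiv ℂ (G s) (e y)).comp (e : (Fin m → ℂ) →L[ℂ] (Fin m → ℂ)) :=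
        fun s => e.comp_right_fderiv
      simp only [h1]
      let L : ((Fin m → ℂ) →L[ℂ] ℂ) →ₗ[ℂ] ((Fin m → ℂ) →L[ℂ] ℂ) :=
        { toFun := fun T => T.comp (e : (Fin m → ℂ) →L[ℂ] (Fin m → ℂ))
          map_add' := fun _ _ => rfl
          map_smul' := fun _ _ => rfl }
      have hL : LinearMap.ker L = ⊥ := by
        rw [LinearMap.ker_eq_bot]
        intro S T h
        ext1 v
        have h2 : S (e (e.symm v)) = T (e (e.symm v)) := DFunLike.congr_fun h (e.symm v)
        rwa [e.apply_symm_apply] at h2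
      exact LinearMap.linearIndependent_iff L hL
    rw [hpre]
    exact hGind.preimage e.toHomeomorph.isOpenMap
  · intro l w
    rw [hAe]
    congr 1; funext k
    simp [hdρ l k, Finset.sum_mul, mul_assoc]
  · intro b w
    simp only [hAe, ← map_smul, ← map_sum]
    congr 1; funext k
    simp [ρ, Finset.sum_mul, mul_assoc]

end
end GeomLin

/-- Geometric linearization of a nondegenerate fixed point of a complex analytic
integrable system of type (p,q). -/
theorem geometric_linearization_complex
    (p q m : ℕ) (hm : m = p + q)
    (U : Set (Fin m → ℂ)) (hUopen : IsOpen U) (hU0 : (0 : Fin m → ℂ) ∈ U)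
    (X : Fin p → (Fin m → ℂ) → (Fin m → ℂ)) (F : Fin q → (Fin m → ℂ) → ℂ)
    (hXan : ∀ i, AnalyticOnNhd ℂ (X i) U)
    (hFan : ∀ j, AnalyticOnNhd ℂ (F j) U)
    -- the vector fields commute:  [X_i, X_j] = 0 on U
    (hcomm : ∀ i j, ∀ x ∈ U, fderiv ℂ (X j) x (X i x) - fderiv ℂ (X i) x (X j x) = 0)
    -- the functions F_j are common first integrals
    (hFint : ∀ i j, ∀ x ∈ U, fderiv ℂ (F j) x (X i x) = 0)
    -- the X_i are linearly independent on a dense subset of U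
    (hXind : U ⊆ closure {x ∈ U | LinearIndependent ℂ fun i => X i x})
    -- the differentials DF_j are linearly independent on a dense subset of U
    (hFind : U ⊆ closure {x ∈ U | LinearIndependent ℂ fun j => fderiv ℂ (F j) x})
    -- 0 is a fixed point
    (hfix : ∀ i, X i 0 = 0)
    -- A_i is the linear part of X_i at 0
    (A : Fin p → Matrix (Fin m) (Fin m) ℂ)
    (hA : ∀ i v, (A i).mulVec v = fderiv ℂ (X i) 0 v)
    -- each A_i is semisimple
    (hss : ∀ i, IsSemisimpleMatrixC (A i))
    -- the linear vector fields A_i x are independent on a dense subset of ℂ^m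
    (hAind : Dense {x : Fin m → ℂ | LinearIndependent ℂ fun i => (A i).mulVec x})
    -- G_j is the lowest-degree nonzero homogeneous Taylor term of F_j at 0
    (k : Fin q → ℕ) (G : Fin q → (Fin m → ℂ) → ℂ)
    (hklow : ∀ j, ∀ l < k j, iteratedFDeriv ℂ l (F j) 0 = 0)
    (hG : ∀ j x, G j x = (((k j).factorial : ℂ))⁻¹ • iteratedFDeriv ℂ (k j) (F j) 0 (fun _ => x))
    (hGne : ∀ j, G j ≠ 0)
    -- the differentials DG_j are linearly independent on a dense subset of ℂ^m
    (hGind : Dense {x : Fin m → ℂ | LinearIndependent ℂ fun j => fderiv ℂ (G j) x}) :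
    ∃ V W : Set (Fin m → ℂ), IsOpen V ∧ V ⊆ U ∧ (0 : Fin m → ℂ) ∈ V ∧
      IsOpen W ∧ (0 : Fin m → ℂ) ∈ W ∧
      ∃ φ ψ : (Fin m → ℂ) → (Fin m → ℂ),
        AnalyticOnNhd ℂ φ V ∧ AnalyticOnNhd ℂ ψ W ∧
        Set.MapsTo φ V W ∧ Set.MapsTo ψ W V ∧
        (∀ x ∈ V, ψ (φ x) = x) ∧ (∀ y ∈ W, φ (ψ y) = y) ∧ φ '' V = W ∧ φ 0 = 0 ∧
        ∃ f : Fin p → Fin p → (Fin m → ℂ) → ℂ,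
          (∀ i j, AnalyticOnNhd ℂ (f i j) W) ∧
          (∀ y ∈ W, (Matrix.of fun i j => f i j y).det ≠ 0) ∧
          (∀ i j l, ∀ y ∈ W, fderiv ℂ (f i j) y ((A l).mulVec y) = 0) ∧
          (∀ i, ∀ x ∈ V, fderiv ℂ φ x (X i x) =
            ∑ j, f i j (φ x) • (A j).mulVec (φ x)) := by
  obtain ⟨D, e, M, C, hMC, hCM, hDX, hAe, hρe⟩ := GeomLin.reduction hm U hUopen hU0 X F hXan hFan
    hcomm hFint hfix A hA hss hAind k G hklow hG hGind
  have heU : e ⁻¹' U ∈ nhds (0 : Fin m → ℂ) :=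
    (hUopen.preimage e.continuous).mem_nhds (by simpa using hU0)
  obtain ⟨V, W, hVo, hVU, hV0, hWo, hW0, φ, ψ, hφ, hψ, hφm, hψm, hψφ, hφψ, hφ0, f, hf, hdet,
    hinv, heq⟩ := D.final _ heU
  have hXe : ∀ i z, X i (e z) = ∑ a, M i a • e (D.X a z) := by
    intro i z
    simp only [hDX, map_sum, map_smul, ContinuousLinearEquiv.apply_symm_apply, Finset.smul_sum,
      smul_smul]
    rw [Finset.sum_comm]
    simp only [← Finset.sum_smul]
    have h1 : ∀ l, ∑ a, M i a * C a l = (1 : Matrix (Fin p) (Fin p) ℂ) i l := fun l => by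
      rw [← hMC, Matrix.mul_apply]
    simp only [h1, Matrix.one_apply, ite_smul, one_smul, zero_smul, Finset.sum_ite_eq,
      Finset.mem_univ, if_true]
  have hMaps1 : Set.MapsTo (fun x => e (φ (e.symm x))) (e.symm ⁻¹' V) (e.symm ⁻¹' W) := by
    intro x hx
    simpa using hφm hx
  have hMaps2 : Set.MapsTo (fun x => e (ψ (e.symm x))) (e.symm ⁻¹' W) (e.symm ⁻¹' V) := by
    intro x hx
    simpa using hψm hx
  have hr : ∀ y ∈ e.symm ⁻¹' W, e (φ (e.symm (e (ψ (e.symm y))))) = y := by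
    intro y hy
    rw [e.symm_apply_apply, hφψ _ hy, e.apply_symm_apply]
  have hcomp : ∀ y ∈ e.symm ⁻¹' W, ∀ a b, AnalyticAt ℂ (fun y => f a b (e.symm y)) y :=
    fun y hy a b => (hf a b _ hy).comp (e.symm.analyticAt y)
  refine ⟨e.symm ⁻¹' V, e.symm ⁻¹' W, hVo.preimage e.symm.continuous, ?_, ?_,
    hWo.preimage e.symm.continuous, ?_, fun x => e (φ (e.symm x)), fun x => e (ψ (e.symm x)),
    ?_, ?_, hMaps1, hMaps2, ?_, hr, ?_, ?_,
    fun i j y => ∑ a, ∑ b, M i a * f a b (e.symm y) * C b j, ?_, ?_, ?_, ?_⟩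
  · intro x hx
    simpa using hVU hx
  · simpa using hV0
  · simpa using hW0
  · intro x hx
    exact (e.analyticAt _).comp ((hφ _ hx).comp (e.symm.analyticAt x))
  · intro x hx
    exact (e.analyticAt _).comp ((hψ _ hx).comp (e.symm.analyticAt x))
  · intro x hx
    simp only [ContinuousLinearEquiv.symm_apply_apply]
    rw [hψφ _ hx, e.apply_symm_apply]
  · refine Set.Subset.antisymm hMaps1.image_subset fun y hy => ⟨_, hMaps2 hy, hr y hy⟩
  · simp [hφ0]
  · intro i j y hy
    exact Finset.analyticAt_fun_sum _ fun a _ => Finset.analyticAt_fun_sum _ fun b _ =>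
      (analyticAt_const.fun_mul (hcomp y hy a b)).fun_mul analyticAt_const
  · intro y hy
    have h1 : (Matrix.of fun i j => ∑ a, ∑ b, M i a * f a b (e.symm y) * C b j) =
        M * (Matrix.of fun i j => f i j (e.symm y)) * C := by
      ext i j
      simp only [Matrix.mul_apply, Matrix.of_apply, Finset.sum_mul]
      rw [Finset.sum_comm]
    rw [h1, Matrix.det_mul, Matrix.det_mul]
    have h2 : M.det * C.det = 1 := by rw [← Matrix.det_mul, hMC, Matrix.det_one]
    have h3 : M.det ≠ 0 := left_ne_zero_of_mul_eq_one h2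
    have h4 : C.det ≠ 0 := right_ne_zero_of_mul_eq_one h2
    exact mul_ne_zero (mul_ne_zero h3 (hdet _ hy)) h4
  · intro i j l y hy
    have hfd : ∀ a b, HasFDerivAt (fun y => f a b (e.symm y))
        ((fderiv ℂ (f a b) (e.symm y)).comp (e.symm : (Fin m → ℂ) →L[ℂ] (Fin m → ℂ))) y :=
      fun a b => (hf a b _ hy).differentiableAt.hasFDerivAt.comp y e.symm.hasFDerivAt
    have hz : ∀ a b, fderiv ℂ (f a b) (e.symm y) (e.symm ((A l).mulVec y)) = 0 := by
      intro a b
      have h1 : (A l).mulVec y = e (∑ b, M l b • fun k => D.ρ b k * e.symm y k) := by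
        rw [← hAe, e.apply_symm_apply]
      rw [h1, e.symm_apply_apply, map_sum]
      refine Finset.sum_eq_zero fun c _ => ?_
      rw [map_smul, hinv a b c _ hy, smul_zero]
    have hsum := HasFDerivAt.fun_sum (u := Finset.univ) fun a (_ : a ∈ Finset.univ) =>
      HasFDerivAt.fun_sum (u := Finset.univ) fun b (_ : b ∈ Finset.univ) =>
        ((hfd a b).const_mul (M i a)).mul_const (C b j)
    rw [hsum.fderiv]
    simp only [sum_apply, smul_apply, ContinuousLinearMap.comp_apply,
      ContinuousLinearEquiv.coe_coe, hz, smul_zero, Finset.sum_const_zero]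
  · intro i x hx
    have hφd : HasFDerivAt (fun x => e (φ (e.symm x)))
        ((e : (Fin m → ℂ) →L[ℂ] (Fin m → ℂ)).comp ((fderiv ℂ φ (e.symm x)).comp
          (e.symm : (Fin m → ℂ) →L[ℂ] (Fin m → ℂ)))) x :=
      e.hasFDerivAt.comp x ((hφ _ hx).differentiableAt.hasFDerivAt.comp x e.symm.hasFDerivAt)
    rw [hφd.fderiv]
    have h1 : X i x = ∑ a, M i a • e (D.X a (e.symm x)) := by
      rw [← hXe, e.apply_symm_apply]
    rw [h1]
    simp only [ContinuousLinearMap.comp_apply, ContinuousLinearEquiv.coe_coe, map_sum, map_smul,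
      ContinuousLinearEquiv.symm_apply_apply]
    simp only [heq _ _ hx, map_sum, map_smul, hρe, Finset.smul_sum, Finset.sum_smul, smul_smul]
    conv_lhs =>
      enter [2, a]
      rw [Finset.sum_comm]
    rw [Finset.sum_comm]
    simp only [mul_assoc]
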